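/- Let Γ be a lattice in G = SL(2,ℝ) and let x₀ ∈ Γ\G be a point whose backward H-trajectory diverges, i.e. x₀h(s) leaves every compact subset of Γ\G as s → −∞. Then for every smooth compactly supported function ψ on Γ\G there exists a constant C₀ > 0 such that for all real T with |T| > 1, |∫_{−∞}^{0} ψ(x₀h(s)a(T)) ds − |T|·∫_{Γ\G} ψ dμ| ≤ C₀. -/

import Mathlib

noncomputable section
open MeasureTheory Matrix Filter Topology

abbrev SL2 : Type := Matrix.SpecialLinearGroup (Fin 2) ℝ

instance : TopologicalSpace SL2 :=
  TopologicalSpace.induced (fun g : SL2 => (g : Matrix (Fin 2) (Fin 2) ℝ)) inferInstance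

instance : MeasurableSpace SL2 := borel SL2

/-- `h(s) = [[cosh(s/2), sinh(s/2)], [sinh(s/2), cosh(s/2)]]` -/
def hmat (s : ℝ) : SL2 :=
  ⟨!![Real.cosh (s/2), Real.sinh (s/2); Real.sinh (s/2), Real.cosh (s/2)], by
    rw [Matrix.det_fin_two_of]
    nlinarith [Real.cosh_sq_sub_sinh_sq (s/2)]⟩

/-- `a(t) = [[e^{t/2}, 0], [0, e^{-t/2}]]` -/
def amat (t : ℝ) : SL2 :=
  ⟨!![Real.exp (t/2), 0; 0, Real.exp (-(t/2))], by
    rw [Matrix.det_fin_two_of]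
    rw [← Real.exp_add]
    simp⟩

/-- the quotient `Γ\G` by right cosets `Γg` -/
def XQuot (Γ : Subgroup SL2) : Type := Quotient (QuotientGroup.rightRel Γ)

instance (Γ : Subgroup SL2) : TopologicalSpace (XQuot Γ) :=
  inferInstanceAs (TopologicalSpace (Quotient (QuotientGroup.rightRel Γ)))

instance (Γ : Subgroup SL2) : MeasurableSpace (XQuot Γ) := borel (XQuot Γ)

/-- the natural projection `G → Γ\G`, `g ↦ Γg` -/
def qmk (Γ : Subgroup SL2) (g : SL2) : XQuot Γ := Quotient.mk (QuotientGroup.rightRel Γ) g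

/-- the right action of `G` on `Γ\G`: `(Γg)g' = Γgg'`. -/
def rmul (Γ : Subgroup SL2) (x : XQuot Γ) (g : SL2) : XQuot Γ :=
  Quotient.map' (fun h => h * g)
    (fun a b hab => by
      rw [QuotientGroup.rightRel_apply] at hab ⊢
      simpa [mul_assoc] using hab) x

/-- `Γ` is a lattice in `SL(2,ℝ)`: a discrete subgroup of finite covolume. -/
def IsLatticeSL2 (Γ : Subgroup SL2) : Prop :=
  DiscreteTopology Γ ∧
    ∃ μG : Measure SL2, μG.IsHaarMeasure ∧
      ∃ F : Set SL2, IsFundamentalDomain Γ F μG ∧ μG F ≠ ⊤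

/-- a function on `Γ\G` is smooth iff its lift to `G ⊆ M₂(ℝ) = ℝ⁴` extends to a smooth
function on the ambient matrix space (equivalently, it is smooth on the manifold `Γ\G`). -/
def IsSmoothQuot (Γ : Subgroup SL2) (ψ : XQuot Γ → ℝ) : Prop :=
  ∃ Ψ : (Fin 2 → Fin 2 → ℝ) → ℝ, ContDiff ℝ (⊤ : ℕ∞) Ψ ∧
    ∀ g : SL2, ψ (qmk Γ g) = Ψ (fun i j => (g : Matrix (Fin 2) (Fin 2) ℝ) i j)

/-! ### The topological group `SL(2,ℝ)` -/

instance : IsTopologicalGroup SL2 := Matrix.SpecialLinearGroup.topologicalGroup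

instance : T2Space SL2 := inferInstanceAs (T2Space {A : Matrix (Fin 2) (Fin 2) ℝ // A.det = 1})

instance : BorelSpace SL2 := ⟨rfl⟩

theorem isClosedEmbedding_entries :
    IsClosedEmbedding (fun (g : SL2) (i j : Fin 2) => (g : Matrix (Fin 2) (Fin 2) ℝ) i j) := by
  have h : IsClosed {A : Matrix (Fin 2) (Fin 2) ℝ | A.det = 1} :=
    isClosed_eq (Continuous.matrix_det continuous_id) continuous_const
  exact h.isClosedEmbedding_subtypeVal

instance : SecondCountableTopology SL2 :=
  isClosedEmbedding_entries.isInducing.secondCountableTopology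

instance : LocallyCompactSpace SL2 := isClosedEmbedding_entries.locallyCompactSpace

instance (Γ : Subgroup SL2) : BorelSpace (XQuot Γ) := ⟨rfl⟩

theorem continuous_entry (i j : Fin 2) :
    Continuous fun g : SL2 => (g : Matrix (Fin 2) (Fin 2) ℝ) i j :=
  (continuous_apply_apply i j).comp isClosedEmbedding_entries.continuous

theorem continuous_SL2_of_entries {Y : Type*} [TopologicalSpace Y] {f : Y → SL2}
    (h : ∀ i j, Continuous fun y => (f y : Matrix (Fin 2) (Fin 2) ℝ) i j) : Continuous f :=
  isClosedEmbedding_entries.isInducing.continuous_iff.2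
    (continuous_pi fun i => continuous_pi fun j => h i j)

/-- the upper triangular unipotent matrix `[[1, x], [0, 1]]` -/
def nmat (x : ℝ) : SL2 := ⟨!![1, x; 0, 1], by simp [Matrix.det_fin_two_of]⟩

/-- the lower triangular unipotent matrix `[[1, 0], [x, 1]]` -/
def lmat (x : ℝ) : SL2 := ⟨!![1, 0; x, 1], by simp [Matrix.det_fin_two_of]⟩

theorem SL2_ext {g h : SL2} (h00 : g.1 0 0 = h.1 0 0) (h01 : g.1 0 1 = h.1 0 1)
    (h10 : g.1 1 0 = h.1 1 0) (h11 : g.1 1 1 = h.1 1 1) : g = h := by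
  apply Subtype.ext
  ext i j
  fin_cases i <;> fin_cases j <;> assumption

theorem SL2_det (g : SL2) : g.1 0 0 * g.1 1 1 - g.1 0 1 * g.1 1 0 = 1 := by
  have := g.2
  rwa [Matrix.det_fin_two] at this

theorem SL2_mul_apply (g h : SL2) (i j : Fin 2) :
    (g * h).1 i j = g.1 i 0 * h.1 0 j + g.1 i 1 * h.1 1 j := by
  change (g.1 * h.1) i j = _
  rw [Matrix.mul_apply, Fin.sum_univ_two]

theorem SL2_inv_val (g : SL2) : (g⁻¹).1 = !![g.1 1 1, -g.1 0 1; -g.1 1 0, g.1 0 0] := by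
  rw [← Matrix.adjugate_fin_two]
  rfl

@[simp] theorem nmat_00 (x : ℝ) : (nmat x).1 0 0 = 1 := rfl
@[simp] theorem nmat_01 (x : ℝ) : (nmat x).1 0 1 = x := rfl
@[simp] theorem nmat_10 (x : ℝ) : (nmat x).1 1 0 = 0 := rfl
@[simp] theorem nmat_11 (x : ℝ) : (nmat x).1 1 1 = 1 := rfl
@[simp] theorem lmat_00 (x : ℝ) : (lmat x).1 0 0 = 1 := rfl
@[simp] theorem lmat_01 (x : ℝ) : (lmat x).1 0 1 = 0 := rfl
@[simp] theorem lmat_10 (x : ℝ) : (lmat x).1 1 0 = x := rfl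
@[simp] theorem lmat_11 (x : ℝ) : (lmat x).1 1 1 = 1 := rfl
@[simp] theorem amat_00 (x : ℝ) : (amat x).1 0 0 = Real.exp (x/2) := rfl
@[simp] theorem amat_01 (x : ℝ) : (amat x).1 0 1 = 0 := rfl
@[simp] theorem amat_10 (x : ℝ) : (amat x).1 1 0 = 0 := rfl
@[simp] theorem amat_11 (x : ℝ) : (amat x).1 1 1 = Real.exp (-(x/2)) := rfl
@[simp] theorem hmat_00 (x : ℝ) : (hmat x).1 0 0 = Real.cosh (x/2) := rfl
@[simp] theorem hmat_01 (x : ℝ) : (hmat x).1 0 1 = Real.sinh (x/2) := rfl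
@[simp] theorem hmat_10 (x : ℝ) : (hmat x).1 1 0 = Real.sinh (x/2) := rfl
@[simp] theorem hmat_11 (x : ℝ) : (hmat x).1 1 1 = Real.cosh (x/2) := rfl
@[simp] theorem SL2_one_00 : (1 : SL2).1 0 0 = 1 := rfl
@[simp] theorem SL2_one_01 : (1 : SL2).1 0 1 = 0 := rfl
@[simp] theorem SL2_one_10 : (1 : SL2).1 1 0 = 0 := rfl
@[simp] theorem SL2_one_11 : (1 : SL2).1 1 1 = 1 := rfl
theorem SL2_inv_00 (g : SL2) : (g⁻¹).1 0 0 = g.1 1 1 := by rw [SL2_inv_val]; rfl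
theorem SL2_inv_01 (g : SL2) : (g⁻¹).1 0 1 = -g.1 0 1 := by rw [SL2_inv_val]; rfl
theorem SL2_inv_10 (g : SL2) : (g⁻¹).1 1 0 = -g.1 1 0 := by rw [SL2_inv_val]; rfl
theorem SL2_inv_11 (g : SL2) : (g⁻¹).1 1 1 = g.1 0 0 := by rw [SL2_inv_val]; rfl

theorem continuous_nmat : Continuous nmat := by
  refine continuous_SL2_of_entries fun i j => ?_
  fin_cases i <;> fin_cases j <;> simp <;> fun_prop

theorem continuous_lmat : Continuous lmat := by
  refine continuous_SL2_of_entries fun i j => ?_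
  fin_cases i <;> fin_cases j <;> simp <;> fun_prop

theorem continuous_amat : Continuous amat := by
  refine continuous_SL2_of_entries fun i j => ?_
  fin_cases i <;> fin_cases j <;> simp <;> fun_prop

@[simp] theorem nmat_zero : nmat 0 = 1 := by apply SL2_ext <;> simp
@[simp] theorem lmat_zero : lmat 0 = 1 := by apply SL2_ext <;> simp
@[simp] theorem amat_zero : amat 0 = 1 := by apply SL2_ext <;> simp

theorem nmat_add (x y : ℝ) : nmat (x + y) = nmat x * nmat y := by
  apply SL2_ext <;> simp [SL2_mul_apply, add_comm]

theorem amat_add (x y : ℝ) : amat (x + y) = amat x * amat y := by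
  apply SL2_ext <;> simp [SL2_mul_apply, ← Real.exp_add] <;> ring_nf

theorem amat_mul_nmat (t x : ℝ) : amat t * nmat x = nmat (Real.exp t * x) * amat t := by
  apply SL2_ext <;> simp [SL2_mul_apply]
  have : Real.exp t * Real.exp (-(t/2)) = Real.exp (t/2) := by rw [← Real.exp_add]; ring_nf
  rw [mul_right_comm, this]

theorem nmat_mul_amat (t x : ℝ) : nmat x * amat t = amat t * nmat (Real.exp (-t) * x) := by
  rw [amat_mul_nmat, ← mul_assoc, ← Real.exp_add]; simp

theorem lmat_mul_amat (t x : ℝ) : lmat x * amat t = amat t * lmat (Real.exp t * x) := by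
  apply SL2_ext <;> simp [SL2_mul_apply]
  have : Real.exp (-(t/2)) * Real.exp t = Real.exp (t/2) := by rw [← Real.exp_add]; ring_nf
  rw [← mul_assoc, this, mul_comm]

theorem SL2_eq_nal (g : SL2) (h : 0 < g.1 1 1) :
    g = nmat (g.1 0 1 / g.1 1 1) * amat (-2 * Real.log (g.1 1 1)) *
      lmat (g.1 1 0 / g.1 1 1) := by
  have e1 : Real.exp (-2 * Real.log (g.1 1 1) / 2) = (g.1 1 1)⁻¹ := by
    rw [show -2 * Real.log (g.1 1 1) / 2 = - Real.log (g.1 1 1) by ring, Real.exp_neg,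
      Real.exp_log h]
  have e2 : Real.exp (-(-2 * Real.log (g.1 1 1) / 2)) = (g.1 1 1) := by
    rw [show -(-2 * Real.log (g.1 1 1) / 2) = Real.log (g.1 1 1) by ring, Real.exp_log h]
  have hd := SL2_det g
  have hne := h.ne'
  apply SL2_ext <;> simp only [SL2_mul_apply, nmat_00, nmat_01, nmat_10, nmat_11, amat_00, amat_01,
    amat_10, amat_11, lmat_00, lmat_01, lmat_10, lmat_11, e1, e2] <;> field_simp <;> linarith

theorem lmat_mul_nmat (s u : ℝ) (h : 0 < 1 + s * u) :
    lmat s * nmat u =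
      nmat (u / (1 + s * u)) * amat (-2 * Real.log (1 + s * u)) * lmat (s / (1 + s * u)) := by
  have h11 : (lmat s * nmat u).1 1 1 = 1 + s * u := by simp [SL2_mul_apply]; ring
  have h01 : (lmat s * nmat u).1 0 1 = u := by simp [SL2_mul_apply]
  have h10 : (lmat s * nmat u).1 1 0 = s := by simp [SL2_mul_apply]
  have := SL2_eq_nal (lmat s * nmat u) (by rw [h11]; exact h)
  rwa [h11, h01, h10] at this

/-- the entrywise `ℓ¹` norm -/
def nrm (A : Matrix (Fin 2) (Fin 2) ℝ) : ℝ := |A 0 0| + |A 0 1| + |A 1 0| + |A 1 1|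

theorem nrm_nonneg (A : Matrix (Fin 2) (Fin 2) ℝ) : 0 ≤ nrm A := by
  unfold nrm; positivity

theorem nrm_neg (A : Matrix (Fin 2) (Fin 2) ℝ) : nrm (-A) = nrm A := by simp [nrm]

theorem nrm_add_le (A B : Matrix (Fin 2) (Fin 2) ℝ) : nrm (A + B) ≤ nrm A + nrm B := by
  simp only [nrm, Matrix.add_apply]
  linarith [abs_add_le (A 0 0) (B 0 0), abs_add_le (A 0 1) (B 0 1), abs_add_le (A 1 0) (B 1 0),
    abs_add_le (A 1 1) (B 1 1)]

theorem nrm_sub_le (A B : Matrix (Fin 2) (Fin 2) ℝ) : nrm (A - B) ≤ nrm A + nrm B := by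
  rw [sub_eq_add_neg, ← nrm_neg B]; exact nrm_add_le _ _

theorem nrm_mul_le (A B : Matrix (Fin 2) (Fin 2) ℝ) : nrm (A * B) ≤ nrm A * nrm B := by
  have key : ∀ i j, |(A * B) i j| ≤ |A i 0| * |B 0 j| + |A i 1| * |B 1 j| := by
    intro i j
    rw [Matrix.mul_apply, Fin.sum_univ_two, ← abs_mul, ← abs_mul]
    exact abs_add_le _ _
  have h00 := key 0 0
  have h01 := key 0 1
  have h10 := key 1 0
  have h11 := key 1 1
  simp only [nrm]
  have p : ∀ i j k l, 0 ≤ |A i j| * |B k l| := fun i j k l => by positivity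
  nlinarith [p 0 0 1 0, p 0 0 1 1, p 1 0 1 0, p 1 0 1 1, p 0 1 0 0, p 0 1 0 1, p 1 1 0 0, p 1 1 0 1]

theorem nrm_eq_zero {A : Matrix (Fin 2) (Fin 2) ℝ} (h : nrm A = 0) : A = 0 := by
  simp only [nrm] at h
  have h1 := abs_nonneg (A 0 0)
  have h2 := abs_nonneg (A 0 1)
  have h3 := abs_nonneg (A 1 0)
  have h4 := abs_nonneg (A 1 1)
  ext i j
  fin_cases i <;> fin_cases j <;> simp <;> rw [← abs_eq_zero] <;> linarith

theorem nrm_inv (g : SL2) : nrm (g⁻¹).1 = nrm g.1 := by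
  simp only [nrm, SL2_inv_00, SL2_inv_01, SL2_inv_10, SL2_inv_11, abs_neg]; ring

theorem nrm_SL2_mul_le (g h : SL2) : nrm (g * h).1 ≤ nrm g.1 * nrm h.1 := nrm_mul_le _ _

theorem one_le_nrm (g : SL2) : 1 ≤ nrm g.1 := by
  by_contra! h
  have hd := SL2_det g
  have h1 := abs_nonneg (g.1 0 0)
  have h2 := abs_nonneg (g.1 0 1)
  have h3 := abs_nonneg (g.1 1 0)
  have h4 := abs_nonneg (g.1 1 1)
  unfold nrm at h
  have a1 : g.1 0 0 * g.1 1 1 ≤ |g.1 0 0| * |g.1 1 1| := by rw [← abs_mul]; exact le_abs_self _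
  have a2 : -(g.1 0 1 * g.1 1 0) ≤ |g.1 0 1| * |g.1 1 0| := by
    rw [← abs_mul]; exact neg_le_abs _
  nlinarith

theorem nrm_nmat (x : ℝ) : nrm (nmat x).1 = 2 + |x| := by simp [nrm]; ring

theorem nrm_amat_le (t : ℝ) : nrm (amat t).1 ≤ 2 * Real.exp (|t| / 2) := by
  simp only [nrm, amat_00, amat_01, amat_10, amat_11, abs_zero, Real.abs_exp]
  have h1 : Real.exp (t/2) ≤ Real.exp (|t|/2) := Real.exp_le_exp.2 (by linarith [le_abs_self t])
  have h2 : Real.exp (-(t/2)) ≤ Real.exp (|t|/2) :=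
    Real.exp_le_exp.2 (by linarith [neg_le_abs t])
  linarith

theorem continuous_nrm : Continuous fun g : SL2 => nrm g.1 := by
  unfold nrm
  have := continuous_entry
  fun_prop

/-! ### The right action on the quotient -/

section Quotient

variable (Γ : Subgroup SL2)

theorem rmul_qmk (g h : SL2) : rmul Γ (qmk Γ g) h = qmk Γ (g * h) := rfl

theorem qmk_surjective : Function.Surjective (qmk Γ) := Quotient.mk_surjective

theorem qmk_eq_iff {g h : SL2} : qmk Γ g = qmk Γ h ↔ h * g⁻¹ ∈ Γ := by
  refine (Quotient.eq (r := QuotientGroup.rightRel Γ)).trans ?_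
  rw [QuotientGroup.rightRel_apply]

theorem qmk_mul_left {γ : SL2} (hγ : γ ∈ Γ) (g : SL2) : qmk Γ (γ * g) = qmk Γ g := by
  rw [eq_comm, qmk_eq_iff]; simpa using hγ

theorem rmul_rmul (x : XQuot Γ) (g h : SL2) : rmul Γ (rmul Γ x g) h = rmul Γ x (g * h) := by
  obtain ⟨k, rfl⟩ := qmk_surjective Γ x
  simp only [rmul_qmk, mul_assoc]

@[simp] theorem rmul_one (x : XQuot Γ) : rmul Γ x 1 = x := by
  obtain ⟨k, rfl⟩ := qmk_surjective Γ x
  simp only [rmul_qmk, mul_one]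

theorem exists_rmul_eq (x y : XQuot Γ) : ∃ g, rmul Γ x g = y := by
  obtain ⟨k, rfl⟩ := qmk_surjective Γ x
  obtain ⟨l, rfl⟩ := qmk_surjective Γ y
  exact ⟨k⁻¹ * l, by rw [rmul_qmk]; simp⟩

theorem isOpenQuotientMap_qmk : IsOpenQuotientMap (qmk Γ) := by
  refine ⟨qmk_surjective Γ, continuous_quotient_mk', ?_⟩
  intro U hU
  have : IsOpen (qmk Γ ⁻¹' (qmk Γ '' U)) := by
    have e : qmk Γ ⁻¹' (qmk Γ '' U) = ⋃ γ : Γ, (fun g => (γ : SL2) * g) ⁻¹' U := by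
      ext g
      simp only [Set.mem_preimage, Set.mem_image, Set.mem_iUnion]
      constructor
      · rintro ⟨h, hh, he⟩
        rw [eq_comm, qmk_eq_iff] at he
        exact ⟨⟨_, he⟩, by simpa using hh⟩
      · rintro ⟨γ, hγ⟩
        exact ⟨_, hγ, qmk_mul_left Γ γ.2 g⟩
    rw [e]
    exact isOpen_iUnion fun γ => hU.preimage (continuous_const_mul _)
  exact this

theorem continuous_qmk : Continuous (qmk Γ) := (isOpenQuotientMap_qmk Γ).continuous

theorem continuous_rmul : Continuous fun p : XQuot Γ × SL2 => rmul Γ p.1 p.2 := by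
  have h := (isOpenQuotientMap_qmk Γ).prodMap (IsOpenQuotientMap.id (X := SL2))
  rw [h.isQuotientMap.continuous_iff]
  exact (continuous_qmk Γ).comp continuous_mul

instance : SecondCountableTopology (XQuot Γ) :=
  (isOpenQuotientMap_qmk Γ).isQuotientMap.secondCountableTopology (isOpenQuotientMap_qmk Γ).isOpenMap

theorem rmul_image_mem_nhds (x : XQuot Γ) {U : Set SL2} (hU : U ∈ 𝓝 (1 : SL2)) :
    (fun g => rmul Γ x g) '' U ∈ 𝓝 x := by
  obtain ⟨k, rfl⟩ := qmk_surjective Γ x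
  have h1 : (fun g => k * g) '' U ∈ 𝓝 k := by
    have := (Homeomorph.mulLeft k).isOpenMap.image_mem_nhds hU
    simpa using this
  have h2 := (isOpenQuotientMap_qmk Γ).isOpenMap.image_mem_nhds h1
  rw [Set.image_image] at h2
  exact h2

end Quotient

/-! ### Markov operators on continuous functions -/

/-- A positive linear operator on continuous functions that fixes the constants. -/
structure IsMarkovOp {X : Type*} [TopologicalSpace X] (P : (X → ℝ) → X → ℝ) : Prop where
  cont : ∀ {f}, Continuous f → Continuous (P f)
  add : ∀ {f g}, Continuous f → Continuous g → ∀ x, P (fun y => f y + g y) x = P f x + P g x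
  smul : ∀ {f}, Continuous f → ∀ (c : ℝ) x, P (fun y => c * f y) x = c * P f x
  const : ∀ (c : ℝ) x, P (fun _ => c) x = c
  mono : ∀ {f g}, Continuous f → Continuous g → (∀ x, f x ≤ g x) → ∀ x, P f x ≤ P g x

namespace IsMarkovOp

variable {X : Type*} [TopologicalSpace X] {P Q : (X → ℝ) → X → ℝ}

theorem id : IsMarkovOp (fun f : X → ℝ => f) where
  cont hf := hf
  add _ _ _ := rfl
  smul _ _ _ := rfl
  const _ _ := rfl
  mono _ _ h := h

theorem comp (hP : IsMarkovOp P) (hQ : IsMarkovOp Q) : IsMarkovOp (fun f => P (Q f)) where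
  cont hf := hP.cont (hQ.cont hf)
  add {f g} hf hg x := by
    rw [← hP.add (hQ.cont hf) (hQ.cont hg)]
    congr 1; funext y; exact hQ.add hf hg y
  smul {f} hf c x := by
    rw [← hP.smul (hQ.cont hf)]
    congr 1; funext y; exact hQ.smul hf c y
  const c x := by
    have : Q (fun _ => c) = fun _ => c := funext (hQ.const c)
    rw [this, hP.const]
  mono hf hg h x := hP.mono (hQ.cont hf) (hQ.cont hg) (hQ.mono hf hg h) x

theorem iterate (hP : IsMarkovOp P) (n : ℕ) : IsMarkovOp (P^[n]) := by
  induction n with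
  | zero => exact IsMarkovOp.id
  | succ n ih =>
    have h : P^[n+1] = fun f => P^[n] (P f) := by funext f; rw [Function.iterate_succ_apply]
    rw [h]
    exact ih.comp hP

theorem affine (hP : IsMarkovOp P) {f : X → ℝ} (hf : Continuous f) (a c : ℝ) (x : X) :
    P (fun y => a + c * f y) x = a + c * P f x := by
  rw [hP.add continuous_const (hf.const_mul c), hP.const, hP.smul hf]

theorem le_affine (hP : IsMarkovOp P) {f g : X → ℝ} (hf : Continuous f) (hg : Continuous g)
    {a c : ℝ} (h : ∀ y, f y ≤ a + c * g y) (x : X) : P f x ≤ a + c * P g x := by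
  rw [← hP.affine hg]
  exact hP.mono hf (by fun_prop) h x

theorem sub_const (hP : IsMarkovOp P) {f : X → ℝ} (hf : Continuous f) (c : ℝ) (x : X) :
    P (fun y => f y - c) x = P f x - c := by
  have := hP.affine hf (-c) 1 x
  rw [one_mul, neg_add_eq_sub] at this
  rw [← this]; congr 1; funext y; ring

theorem sub (hP : IsMarkovOp P) {f g : X → ℝ} (hf : Continuous f) (hg : Continuous g) (x : X) :
    P (fun y => f y - g y) x = P f x - P g x := by
  have := hP.add hf (hg.const_mul (-1)) x
  rw [hP.smul hg, neg_one_mul, ← sub_eq_add_neg] at this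
  rw [← this]; congr 1; funext y; ring

theorem abs_le_affine (hP : IsMarkovOp P) {f g : X → ℝ} (hf : Continuous f) (hg : Continuous g)
    {a c : ℝ} (h : ∀ y, |f y| ≤ a + c * g y) (x : X) : |P f x| ≤ a + c * P g x := by
  rw [abs_le]
  constructor
  · have := hP.le_affine (f := fun y => -1 * f y) (by fun_prop) hg
      (show ∀ y, -1 * f y ≤ a + c * g y from
        fun y => by linarith [neg_le_abs (f y), h y]) x
    rw [hP.smul hf] at this
    linarith
  · exact hP.le_affine hf hg (fun y => (le_abs_self _).trans (h y)) x

theorem abs_le_const (hP : IsMarkovOp P) {f : X → ℝ} (hf : Continuous f) {a : ℝ}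
    (h : ∀ y, |f y| ≤ a) (x : X) : |P f x| ≤ a := by
  have := hP.abs_le_affine (c := 0) hf hf (fun y => by simpa using h y) x
  simpa using this

/-- Oscillation bounds relative to a weight are transported by a Markov operator. -/
theorem abs_sub_le (hP : IsMarkovOp P) {f g : X → ℝ} (hf : Continuous f) (hg : Continuous g)
    {a c : ℝ} (h : ∀ y z, |f y - f z| ≤ a + c * g y + c * g z) (x x' : X) :
    |P f x - P f x'| ≤ a + c * P g x + c * P g x' := by
  have key : ∀ x x', P f x - P f x' ≤ a + c * P g x + c * P g x' := by
    intro x x'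
    have h1 : ∀ z, P f x ≤ (f z + a + c * g z) + c * P g x := fun z =>
      hP.le_affine hf hg (fun y => by linarith [le_abs_self (f y - f z), h y z]) x
    have h2 := hP.le_affine (f := fun z => (P f x - a - c * P g x) + (-1) * f z) (by fun_prop) hg
      (a := 0) (c := c) (fun z => by linarith [h1 z]) x'
    rw [hP.affine hf] at h2
    linarith
  rw [abs_le]
  exact ⟨by linarith [key x' x], key x x'⟩

end IsMarkovOp

/-! ### The random walk by upper triangular matrices -/

section Walk

variable (Γ : Subgroup SL2)

/-- Average of `f` over the steps `x ↦ x n(u) a(-τ - v)` with `u`, `v` uniform in `[0,1]`. -/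
def avgOp (τ : ℝ) (f : XQuot Γ → ℝ) (x : XQuot Γ) : ℝ :=
  ∫ v in (0:ℝ)..1, ∫ u in (0:ℝ)..1, f (rmul Γ x (nmat u * amat (-τ - v)))

variable {Γ}

theorem continuous_rmul_right (x : XQuot Γ) : Continuous fun g => rmul Γ x g :=
  (continuous_rmul Γ).comp (by fun_prop : Continuous fun g : SL2 => (x, g))

theorem continuous_rmul_left (g : SL2) : Continuous fun x => rmul Γ x g :=
  (continuous_rmul Γ).comp (by fun_prop : Continuous fun x : XQuot Γ => (x, g))

theorem continuous_na : Continuous fun p : ℝ × ℝ => nmat p.1 * amat p.2 :=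
  (continuous_nmat.comp continuous_fst).mul (continuous_amat.comp continuous_snd)

theorem continuous_rmul_na {Y : Type*} [TopologicalSpace Y] {f : XQuot Γ → ℝ} (hf : Continuous f)
    {a : Y → XQuot Γ} {b c : Y → ℝ} (ha : Continuous a) (hb : Continuous b) (hc : Continuous c) :
    Continuous fun y => f (rmul Γ (a y) (nmat (b y) * amat (c y))) :=
  hf.comp ((continuous_rmul Γ).comp (ha.prodMk (continuous_na.comp (hb.prodMk hc))))

theorem continuous_inner_avg {f : XQuot Γ → ℝ} (hf : Continuous f) {Y : Type*}
    [TopologicalSpace Y] {a : Y → XQuot Γ} {c : Y → ℝ} (ha : Continuous a) (hc : Continuous c) :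
    Continuous fun y => ∫ u in (0:ℝ)..1, f (rmul Γ (a y) (nmat u * amat (c y))) := by
  have h : Continuous fun q : (XQuot Γ × ℝ) × ℝ => f (rmul Γ q.1.1 (nmat q.2 * amat q.1.2)) :=
    continuous_rmul_na (a := fun q : (XQuot Γ × ℝ) × ℝ => q.1.1) (b := fun q => q.2)
      (c := fun q => q.1.2) hf (continuous_fst.comp continuous_fst) continuous_snd
      (continuous_snd.comp continuous_fst)
  have h2 := intervalIntegral.continuous_parametric_intervalIntegral_of_continuous' (μ := volume)
    (f := fun (p : XQuot Γ × ℝ) u => f (rmul Γ p.1 (nmat u * amat p.2))) h 0 1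
  exact Continuous.comp (f := fun y => (a y, c y)) h2 (ha.prodMk hc)

theorem isMarkovOp_avgOp (τ : ℝ) : IsMarkovOp (avgOp Γ τ) := by
  have c1 : ∀ {f : XQuot Γ → ℝ}, Continuous f → ∀ x,
      Continuous fun v : ℝ => ∫ u in (0:ℝ)..1, f (rmul Γ x (nmat u * amat (-τ - v))) :=
    fun hf x => continuous_inner_avg hf continuous_const (continuous_const.sub continuous_id)
  have c2 : ∀ {f : XQuot Γ → ℝ}, Continuous f → ∀ x (v : ℝ),
      Continuous fun u : ℝ => f (rmul Γ x (nmat u * amat (-τ - v))) :=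
    fun hf x v => continuous_rmul_na hf continuous_const continuous_id continuous_const
  refine ⟨fun {f} hf => ?_, fun {f g} hf hg x => ?_, fun {f} hf c x => ?_, fun c x => ?_,
    fun {f g} hf hg h x => ?_⟩
  · have h : Continuous fun p : XQuot Γ × ℝ =>
        ∫ u in (0:ℝ)..1, f (rmul Γ p.1 (nmat u * amat (-τ - p.2))) :=
      continuous_inner_avg hf continuous_fst (continuous_const.sub continuous_snd)
    exact intervalIntegral.continuous_parametric_intervalIntegral_of_continuous' (μ := volume)
      (f := fun (x : XQuot Γ) v => ∫ u in (0:ℝ)..1, f (rmul Γ x (nmat u * amat (-τ - v)))) h 0 1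
  · unfold avgOp
    rw [← intervalIntegral.integral_add ((c1 hf x).intervalIntegrable _ _)
      ((c1 hg x).intervalIntegrable _ _)]
    congr 1; funext v
    rw [← intervalIntegral.integral_add ((c2 hf x v).intervalIntegrable _ _)
      ((c2 hg x v).intervalIntegrable _ _)]
  · unfold avgOp
    simp only [intervalIntegral.integral_const_mul]
  · unfold avgOp
    simp
  · refine intervalIntegral.integral_mono_on zero_le_one ((c1 hf x).intervalIntegrable _ _)
      ((c1 hg x).intervalIntegrable _ _) fun v _ => ?_
    exact intervalIntegral.integral_mono_on zero_le_one ((c2 hf x v).intervalIntegrable _ _)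
      ((c2 hg x v).intervalIntegrable _ _) fun u _ => h _

/-- A weight on `Γ\G` that is proper, slowly varying, and contracted on average by the walk. -/
structure IsHeight (τ κ b : ℝ) (V : XQuot Γ → ℝ) : Prop where
  cont : Continuous V
  one_le : ∀ x, 1 ≤ V x
  growth : ∀ x (g : SL2), nrm g.1 ≤ Real.exp τ → V (rmul Γ x g) ≤ 2 * V x
  step : ∀ x, ∀ v ∈ Set.Icc (0:ℝ) 1,
    ∫ u in (0:ℝ)..1, V (rmul Γ x (nmat u * amat (-τ - v))) ≤ κ * V x + b
  compact : ∀ R, IsCompact {x | V x ≤ R}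

theorem nrm_na_le {τ w t : ℝ} (hτ : 10 ≤ τ) (hw : |w| ≤ 2) (ht : |t| ≤ τ + 3) :
    nrm (nmat w * amat t).1 ≤ Real.exp τ := by
  have h1 : nrm (nmat w * amat t).1 ≤ (2 + |w|) * (2 * Real.exp (|t| / 2)) := by
    refine (nrm_SL2_mul_le _ _).trans ?_
    rw [nrm_nmat]
    exact mul_le_mul_of_nonneg_left (nrm_amat_le t) (by positivity)
  have h2 : Real.exp (|t| / 2) ≤ Real.exp (τ - 3) * Real.exp (-(1/2)) := by
    rw [← Real.exp_add]
    exact Real.exp_le_exp.2 (by linarith)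
  have h3 : (8:ℝ) * Real.exp (-3) ≤ 1 := by
    have h4 : (8:ℝ) ≤ Real.exp 3 := by
      have := Real.add_one_le_exp (1:ℝ)
      have e : Real.exp 3 = Real.exp 1 ^ 3 := by rw [← Real.exp_nat_mul]; norm_num
      rw [e]
      nlinarith [sq_nonneg (Real.exp 1 - 2)]
    rw [Real.exp_neg]
    have := Real.exp_pos 3
    rw [mul_inv_le_iff₀ this]; linarith
  have h5 : Real.exp (-(1/2:ℝ)) ≤ 1 := Real.exp_le_one_iff.2 (by norm_num)
  have h6 : Real.exp (τ - 3) = Real.exp τ * Real.exp (-3) := by rw [← Real.exp_add]; ring_nf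
  have h7 := Real.exp_pos τ
  have h8 := Real.exp_pos (τ - 3)
  have h9 := Real.exp_pos (|t|/2)
  have h10 : Real.exp (|t| / 2) ≤ Real.exp (τ - 3) := h2.trans (mul_le_of_le_one_right h8.le h5)
  calc nrm (nmat w * amat t).1 ≤ (2 + |w|) * (2 * Real.exp (|t| / 2)) := h1
    _ ≤ (2 + 2) * (2 * Real.exp (|t| / 2)) := by gcongr
    _ ≤ 8 * Real.exp (τ - 3) := by linarith
    _ = Real.exp τ * (8 * Real.exp (-3)) := by rw [h6]; ring
    _ ≤ Real.exp τ := mul_le_of_le_one_right h7.le h3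

theorem nrm_nmat_le {τ s : ℝ} (hτ : 10 ≤ τ) (hs : |s| ≤ 1) : nrm (nmat s).1 ≤ Real.exp τ := by
  rw [nrm_nmat]
  linarith [Real.add_one_le_exp τ]

/-- Weighted Lipschitz condition along the three one-parameter subgroups. -/
structure IsLip (V : XQuot Γ → ℝ) (L : ℝ) (f : XQuot Γ → ℝ) : Prop where
  n : ∀ x s, |s| ≤ 1/2 → |f (rmul Γ x (nmat s)) - f x| ≤ L * |s| * V x
  a : ∀ x s, |s| ≤ 1/2 → |f (rmul Γ x (amat s)) - f x| ≤ L * |s| * V x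
  l : ∀ x s, |s| ≤ 1/2 → |f (rmul Γ x (lmat s)) - f x| ≤ L * |s| * V x

theorem integral_shift_sub_le {h : ℝ → ℝ} (hc : Continuous h) {s D : ℝ}
    (hD : ∀ w, |w| ≤ |s| → |h (1 + w) - h w| ≤ D) :
    |(∫ u in (0:ℝ)..1, h (u + s)) - ∫ u in (0:ℝ)..1, h u| ≤ D * |s| := by
  have hi : ∀ a b, IntervalIntegrable h volume a b := fun a b => hc.intervalIntegrable a b
  have e1 : (∫ u in (0:ℝ)..1, h (u + s)) = ∫ u in s..(1+s), h u := by
    rw [intervalIntegral.integral_comp_add_right]; simp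
  have e2 : (∫ u in (0:ℝ)..s, h (1 + u)) = ∫ u in (1:ℝ)..(1+s), h u := by
    rw [intervalIntegral.integral_comp_add_left]; simp
  have e3 : (∫ u in (0:ℝ)..1, h (u + s)) - ∫ u in (0:ℝ)..1, h u
      = ∫ u in (0:ℝ)..s, (h (1 + u) - h u) := by
    rw [intervalIntegral.integral_sub ((by fun_prop : Continuous fun u => h (1 + u)).intervalIntegrable _ _)
      (hi _ _), e2, e1]
    have h1 := intervalIntegral.integral_add_adjacent_intervals (hi 0 s) (hi s (1+s))
    have h2 := intervalIntegral.integral_add_adjacent_intervals (hi 0 1) (hi 1 (1+s))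
    linarith
  rw [e3]
  have := intervalIntegral.norm_integral_le_of_norm_le_const (a := 0) (b := s) (C := D)
    (f := fun u => h (1 + u) - h u) (fun u hu => ?_)
  · simpa using this
  · refine hD u ?_
    rcases Set.mem_uIoc.1 hu with h | h
    · rw [abs_of_pos h.1]; exact h.2.trans (le_abs_self s)
    · rw [abs_of_nonpos h.2]; exact (neg_le_neg h.1.le).trans (neg_le_abs s)

theorem integral_reparam_sub_le {h θ θ' : ℝ → ℝ} (hc : Continuous h)
    (hθ : ∀ u ∈ Set.Icc (0:ℝ) 1, HasDerivAt θ (θ' u) u) (hθ' : ContinuousOn θ' (Set.Icc 0 1))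
    (h0 : θ 0 = 0) (hm : ∀ u ∈ Set.Icc (0:ℝ) 1, θ u ∈ Set.Icc (0:ℝ) 2) {D k k' : ℝ} (hD0 : 0 ≤ D)
    (hD : ∀ w ∈ Set.Icc (0:ℝ) 2, |h w - h 0| ≤ D) (hk : |θ 1 - 1| ≤ k)
    (hk' : ∀ u ∈ Set.Icc (0:ℝ) 1, |θ' u - 1| ≤ k') :
    |(∫ u in (0:ℝ)..1, h (θ u)) - ∫ u in (0:ℝ)..1, h u| ≤ D * (k + k') := by
  have hu : Set.uIcc (0:ℝ) 1 = Set.Icc 0 1 := Set.uIcc_of_le zero_le_one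
  set g : ℝ → ℝ := fun w => h w - h 0 with hg
  have hgc : Continuous g := by fun_prop
  have hgi : ∀ a b, IntervalIntegrable g volume a b := fun a b => hgc.intervalIntegrable a b
  have hθc : ContinuousOn θ (Set.Icc 0 1) := fun u hu => (hθ u hu).continuousAt.continuousWithinAt
  have hgθ : ContinuousOn (fun u => g (θ u)) (Set.uIcc 0 1) := by
    rw [hu]; exact hgc.comp_continuousOn hθc
  have hhθ : ContinuousOn (fun u => h (θ u)) (Set.uIcc 0 1) := by
    rw [hu]; exact hc.comp_continuousOn hθc
  have s1 := intervalIntegral.integral_comp_mul_deriv (a := 0) (b := 1) (f := θ) (f' := θ') (g := g)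
    (by rwa [hu]) (by rwa [hu]) hgc
  rw [h0] at s1
  have s2 : (∫ u in (0:ℝ)..1, h (θ u)) - ∫ u in (0:ℝ)..1, h u
      = (∫ u in (0:ℝ)..1, g (θ u)) - ∫ u in (0:ℝ)..1, g u := by
    simp only [hg]
    rw [intervalIntegral.integral_sub hhθ.intervalIntegrable (by simp),
      intervalIntegral.integral_sub (hc.intervalIntegrable _ _) (by simp)]
    ring
  have s3 : (∫ u in (0:ℝ)..1, g (θ u)) =
      (∫ u in (0:ℝ)..1, (g ∘ θ) u * θ' u) - ∫ u in (0:ℝ)..1, g (θ u) * (θ' u - 1) := by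
    rw [← intervalIntegral.integral_sub]
    · congr 1; funext u; simp only [Function.comp]; ring
    · exact (hgθ.mul (by rwa [hu])).intervalIntegrable
    · exact (hgθ.mul ((by rwa [hu] : ContinuousOn θ' (Set.uIcc 0 1)).sub
        continuousOn_const)).intervalIntegrable
  have s4 : (∫ u in (0:ℝ)..(θ 1), g u) - ∫ u in (0:ℝ)..1, g u = ∫ u in (1:ℝ)..(θ 1), g u := by
    have := intervalIntegral.integral_add_adjacent_intervals (hgi 0 1) (hgi 1 (θ 1))
    linarith
  have s5 : |∫ u in (1:ℝ)..(θ 1), g u| ≤ D * |θ 1 - 1| := by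
    have h1 := hm 1 ⟨zero_le_one, le_rfl⟩
    refine intervalIntegral.norm_integral_le_of_norm_le_const (f := g) (C := D) fun u hu => ?_
    refine hD u ?_
    rcases Set.mem_uIoc.1 hu with h | h
    · exact ⟨by linarith [h.1], by linarith [h.2, h1.2]⟩
    · exact ⟨by linarith [h.1, h1.1], by linarith [h.2]⟩
  have s6 : |∫ u in (0:ℝ)..1, g (θ u) * (θ' u - 1)| ≤ D * k' := by
    have := intervalIntegral.norm_integral_le_of_norm_le_const (a := 0) (b := 1) (C := D * k')
      (f := fun u => g (θ u) * (θ' u - 1)) (fun u hu => ?_)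
    · simpa using this
    · rw [Set.uIoc_of_le zero_le_one] at hu
      have hu' : u ∈ Set.Icc (0:ℝ) 1 := ⟨hu.1.le, hu.2⟩
      rw [Real.norm_eq_abs, abs_mul]
      exact mul_le_mul (hD _ (hm u hu')) (hk' u hu') (abs_nonneg _) hD0
  rw [s2, s3, s1]
  have s7 : D * |θ 1 - 1| ≤ D * k := mul_le_mul_of_nonneg_left hk hD0
  have : (∫ u in (0:ℝ)..(θ 1), g u) - (∫ u in (0:ℝ)..1, g (θ u) * (θ' u - 1)) - ∫ u in (0:ℝ)..1, g u
    = (∫ u in (1:ℝ)..(θ 1), g u) - ∫ u in (0:ℝ)..1, g (θ u) * (θ' u - 1) := by rw [← s4]; ring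
  rw [this]
  refine (abs_sub _ _).trans ?_
  linarith

end Walk

theorem integral_swap_unit {G : ℝ → ℝ → ℝ} (hG : Continuous (Function.uncurry G)) :
    (∫ v in (0:ℝ)..1, ∫ u in (0:ℝ)..1, G u v) = ∫ u in (0:ℝ)..1, ∫ v in (0:ℝ)..1, G u v := by
  simp only [intervalIntegral.integral_of_le (zero_le_one (α := ℝ))]
  symm
  refine integral_integral_swap ?_
  rw [Measure.prod_restrict]
  exact (hG.continuousOn.integrableOn_compact (isCompact_Icc.prod isCompact_Icc)).mono_set
    (Set.prod_mono Set.Ioc_subset_Icc_self Set.Ioc_subset_Icc_self)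

theorem abs_integral_sub_le_unit {p q : ℝ → ℝ} (hp : Continuous p) (hq : Continuous q) {K : ℝ}
    (h : ∀ v ∈ Set.Icc (0:ℝ) 1, |p v - q v| ≤ K) :
    |(∫ v in (0:ℝ)..1, p v) - ∫ v in (0:ℝ)..1, q v| ≤ K := by
  rw [← intervalIntegral.integral_sub (hp.intervalIntegrable _ _) (hq.intervalIntegrable _ _)]
  have := intervalIntegral.norm_integral_le_of_norm_le_const (a := 0) (b := 1) (C := K)
    (f := fun v => p v - q v) (fun v hv => ?_)
  · simpa using this
  · rw [Set.uIoc_of_le zero_le_one] at hv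
    exact h v ⟨hv.1.le, hv.2⟩

theorem continuous_integral_unit {Y : Type*} [TopologicalSpace Y] {G : Y → ℝ → ℝ}
    (hG : Continuous fun p : Y × ℝ => G p.1 p.2) : Continuous fun y => ∫ u in (0:ℝ)..1, G y u :=
  intervalIntegral.continuous_parametric_intervalIntegral_of_continuous' (μ := volume) (f := G) hG 0 1

section Real

variable {F : ℝ → ℝ → ℝ} {τ D : ℝ}

theorem avg_shift_first (hF : Continuous fun p : ℝ × ℝ => F p.1 p.2)
    (hD : ∀ w w' t t', |w| ≤ 2 → |w'| ≤ 2 → |t| ≤ τ + 3 → |t'| ≤ τ + 3 → |F w t - F w' t'| ≤ D)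
    (hτ : 0 ≤ τ) {s : ℝ} (hs : |s| ≤ 1/2) :
    |(∫ v in (0:ℝ)..1, ∫ u in (0:ℝ)..1, F (u + s) (-τ - v)) -
      ∫ v in (0:ℝ)..1, ∫ u in (0:ℝ)..1, F u (-τ - v)| ≤ D * |s| := by
  refine abs_integral_sub_le_unit (continuous_integral_unit (by fun_prop))
    (continuous_integral_unit (by fun_prop)) fun v hv => ?_
  refine integral_shift_sub_le (h := fun u => F u (-τ - v)) (by fun_prop) fun w hw => ?_
  have := abs_le.1 hs
  have h2 := abs_le.1 (hw.trans hs)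
  have hv' : |-τ - v| ≤ τ + 3 := abs_le.2 ⟨by linarith [hv.2], by linarith [hv.1]⟩
  exact hD _ _ _ _ (abs_le.2 ⟨by linarith, by linarith⟩) (abs_le.2 ⟨by linarith, by linarith⟩) hv' hv'

theorem avg_scale_first (hF : Continuous fun p : ℝ × ℝ => F p.1 p.2)
    (hD : ∀ w w' t t', |w| ≤ 2 → |w'| ≤ 2 → |t| ≤ τ + 3 → |t'| ≤ τ + 3 → |F w t - F w' t'| ≤ D)
    (hτ : 0 ≤ τ) (hD0 : 0 ≤ D) {s : ℝ} (hs : |s| ≤ 1/2) :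
    |(∫ v in (0:ℝ)..1, ∫ u in (0:ℝ)..1, F (Real.exp s * u) (s + (-τ - v))) -
      ∫ v in (0:ℝ)..1, ∫ u in (0:ℝ)..1, F u (-τ - v)| ≤ 5 * D * |s| := by
  have hs' := abs_le.1 hs
  have he := Real.abs_exp_sub_one_le (hs.trans (by norm_num))
  have he' := abs_le.1 he
  have he2 : Real.exp s ≤ 2 := by linarith
  have h1 : |(∫ v in (0:ℝ)..1, ∫ u in (0:ℝ)..1, F (Real.exp s * u) (s + (-τ - v))) -
      ∫ v in (0:ℝ)..1, ∫ u in (0:ℝ)..1, F u (s + (-τ - v))| ≤ 4 * D * |s| := by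
    refine abs_integral_sub_le_unit (continuous_integral_unit (by fun_prop))
      (continuous_integral_unit (by fun_prop)) fun v hv => ?_
    have hv' : |s + (-τ - v)| ≤ τ + 3 := abs_le.2 ⟨by linarith [hv.2], by linarith [hv.1]⟩
    have hmem : ∀ w ∈ Set.Icc (0:ℝ) 2, |w| ≤ 2 := fun w hw => by
      rw [abs_of_nonneg hw.1]; exact hw.2
    refine (integral_reparam_sub_le (h := fun u => F u (s + (-τ - v)))
      (θ := fun u => Real.exp s * u) (θ' := fun _ => Real.exp s) (D := D) (k := 2 * |s|)
      (k' := 2 * |s|) (by fun_prop) (fun u _ => ?_) continuousOn_const (by simp) (fun u hu => ?_) hD0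
      (fun w hw => hD _ _ _ _ (hmem w hw) (by simp) hv' hv') (by simpa using he)
      (fun _ _ => he)).trans (le_of_eq (by ring))
    · simpa using (hasDerivAt_id u).const_mul (Real.exp s)
    · exact ⟨mul_nonneg (Real.exp_pos s).le hu.1,
        by nlinarith [hu.1, hu.2, Real.exp_pos s]⟩
  have h2 : |(∫ v in (0:ℝ)..1, ∫ u in (0:ℝ)..1, F u (s + (-τ - v))) -
      ∫ v in (0:ℝ)..1, ∫ u in (0:ℝ)..1, F u (-τ - v)| ≤ D * |s| := by
    have := integral_shift_sub_le (h := fun v => ∫ u in (0:ℝ)..1, F u (-τ - v)) (s := -s) (D := D)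
      (continuous_integral_unit (by fun_prop)) (fun w hw => ?_)
    · rw [abs_neg] at this
      refine le_trans (le_of_eq ?_) this
      congr 3
      funext v; congr 1; funext u; congr 1; ring
    · rw [abs_neg] at hw
      have h3 := abs_le.1 (hw.trans hs)
      refine abs_integral_sub_le_unit (by fun_prop) (by fun_prop) fun u hu => ?_
      have hu2 : |u| ≤ 2 := by rw [abs_of_nonneg hu.1]; linarith [hu.2]
      exact hD _ _ _ _ hu2 hu2 (abs_le.2 ⟨by linarith, by linarith⟩)
        (abs_le.2 ⟨by linarith, by linarith⟩)
  have h3 := abs_sub_le (∫ v in (0:ℝ)..1, ∫ u in (0:ℝ)..1, F (Real.exp s * u) (s + (-τ - v)))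
    (∫ v in (0:ℝ)..1, ∫ u in (0:ℝ)..1, F u (s + (-τ - v)))
    (∫ v in (0:ℝ)..1, ∫ u in (0:ℝ)..1, F u (-τ - v))
  linarith

theorem avg_mobius_first (hF : Continuous fun p : ℝ × ℝ => F p.1 p.2)
    (hD : ∀ w w' t t', |w| ≤ 2 → |w'| ≤ 2 → |t| ≤ τ + 3 → |t'| ≤ τ + 3 → |F w t - F w' t'| ≤ D)
    (hτ : 0 ≤ τ) (hD0 : 0 ≤ D) {s : ℝ} (hs : |s| ≤ 1/2) {m : ℝ → ℝ} (hm : Continuous m)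
    (hm1 : ∀ u, 1/4 ≤ m u) (hm2 : ∀ u ∈ Set.Icc (0:ℝ) 1, m u = 1 + s * u) :
    |(∫ v in (0:ℝ)..1, ∫ u in (0:ℝ)..1, F (u / m u) (-τ - v - 2 * Real.log (m u))) -
      ∫ v in (0:ℝ)..1, ∫ u in (0:ℝ)..1, F u (-τ - v)| ≤ 16 * D * |s| := by
  have hs' := abs_le.1 hs
  have hm0 : ∀ u, m u ≠ 0 := fun u => by linarith [hm1 u]
  have hlog : Continuous fun u => Real.log (m u) := hm.log hm0
  have hdiv : Continuous fun u => u / m u := continuous_id.div hm hm0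
  have c1 : ∀ {d e : ℝ → ℝ}, Continuous d → Continuous e →
      Continuous fun p : ℝ × ℝ => F (d p.1) (-τ - p.2 - 2 * e p.1) := fun hd he => by fun_prop
  have c2 : ∀ {d : ℝ → ℝ}, Continuous d → Continuous fun p : ℝ × ℝ => F (d p.1) (-τ - p.2) :=
    fun hd => by fun_prop
  have hsu : ∀ u ∈ Set.Icc (0:ℝ) 1, |s * u| ≤ |s| := fun u hu => by
    rw [abs_mul, abs_of_nonneg hu.1]; exact mul_le_of_le_one_right (abs_nonneg s) hu.2
  have hmhalf : ∀ u ∈ Set.Icc (0:ℝ) 1, 1/2 ≤ 1 + s * u := fun u hu => by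
    linarith [(abs_le.1 ((hsu u hu).trans hs)).1]
  have hdm : ∀ u ∈ Set.Icc (0:ℝ) 1, |u / (1 + s * u)| ≤ 2 := fun u hu => by
    have := hmhalf u hu
    rw [abs_of_nonneg (div_nonneg hu.1 (by linarith)), div_le_iff₀ (by linarith)]
    linarith [hu.2]
  have hl : ∀ u ∈ Set.Icc (0:ℝ) 1, |2 * Real.log (1 + s * u)| ≤ 4 * |s| := fun u hu => by
    have h1 := hmhalf u hu
    have h2 := hsu u hu
    have h2' := abs_le.1 h2
    have h3 := Real.log_le_sub_one_of_pos (show 0 < 1 + s * u by linarith)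
    have h4 := Real.log_le_sub_one_of_pos (show 0 < (1 + s * u)⁻¹ by positivity)
    rw [Real.log_inv] at h4
    have h5 : (1 + s * u)⁻¹ - 1 ≤ 2 * |s| := by
      rw [sub_le_iff_le_add, inv_le_iff_one_le_mul₀ (by linarith)]
      nlinarith [abs_nonneg s]
    rw [abs_le]
    constructor <;> linarith [abs_nonneg s]
  have h1 : |(∫ u in (0:ℝ)..1, ∫ v in (0:ℝ)..1, F (u / m u) (-τ - v - 2 * Real.log (m u))) -
      ∫ u in (0:ℝ)..1, ∫ v in (0:ℝ)..1, F (u / m u) (-τ - v)| ≤ 4 * D * |s| := by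
    refine abs_integral_sub_le_unit (continuous_integral_unit (c1 hdiv hlog))
      (continuous_integral_unit (c2 hdiv)) fun u hu => ?_
    have hl' : |2 * Real.log (m u)| ≤ 4 * |s| := by rw [hm2 u hu]; exact hl u hu
    have h3 : |u / m u| ≤ 2 := by rw [hm2 u hu]; exact hdm u hu
    have := integral_shift_sub_le (h := fun v => F (u / m u) (-τ - v)) (s := 2 * Real.log (m u))
      (D := D) (by fun_prop) (fun w hw => by
        have h4 := abs_le.1 ((hw.trans hl').trans (show 4 * |s| ≤ 2 by linarith))
        exact hD _ _ _ _ h3 h3 (abs_le.2 ⟨by linarith, by linarith⟩)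
          (abs_le.2 ⟨by linarith, by linarith⟩))
    refine (le_trans (le_of_eq ?_) this).trans (by nlinarith)
    congr 3; funext v; congr 1; ring
  have h2 : |(∫ u in (0:ℝ)..1, ∫ v in (0:ℝ)..1, F (u / m u) (-τ - v)) -
      ∫ u in (0:ℝ)..1, ∫ v in (0:ℝ)..1, F u (-τ - v)| ≤ 12 * D * |s| := by
    have e : (∫ u in (0:ℝ)..1, ∫ v in (0:ℝ)..1, F (u / m u) (-τ - v)) =
        ∫ u in (0:ℝ)..1, ∫ v in (0:ℝ)..1, F (u / (1 + s * u)) (-τ - v) := by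
      refine intervalIntegral.integral_congr fun u hu => ?_
      rw [Set.uIcc_of_le zero_le_one] at hu
      simp only [hm2 u hu]
    rw [e]
    refine (integral_reparam_sub_le (h := fun w => ∫ v in (0:ℝ)..1, F w (-τ - v))
      (θ := fun u => u / (1 + s * u)) (θ' := fun u => 1 / (1 + s * u) ^ 2) (D := D) (k := 2 * |s|)
      (k' := 10 * |s|) (continuous_integral_unit (by fun_prop)) (fun u hu => ?_) (fun u hu => ?_)
      (by simp) (fun u hu => ?_) hD0 (fun w hw => ?_) ?_ (fun u hu => ?_)).trans
      (le_of_eq (by ring))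
    · have h0 : 1 + s * u ≠ 0 := by linarith [hmhalf u hu]
      have hd : HasDerivAt (fun u => 1 + s * u) s u := by
        simpa using ((hasDerivAt_id u).const_mul s).const_add 1
      have := (hasDerivAt_id u).div hd h0
      refine this.congr_deriv ?_
      simp only [id]
      congr 1; ring
    · have h0 : (1 + s * u) ^ 2 ≠ 0 := pow_ne_zero _ (by linarith [hmhalf u hu])
      exact ContinuousAt.continuousWithinAt (by fun_prop (disch := assumption))
    · have := hdm u hu
      exact ⟨div_nonneg hu.1 (by linarith [hmhalf u hu]), (abs_le.1 this).2⟩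
    · refine abs_integral_sub_le_unit (by fun_prop) (by fun_prop) fun v hv => ?_
      have hv' : |-τ - v| ≤ τ + 3 := abs_le.2 ⟨by linarith [hv.2], by linarith [hv.1]⟩
      exact hD _ _ _ _ (by rw [abs_of_nonneg hw.1]; exact hw.2) (by simp) hv' hv'
    · have h0 := hmhalf 1 ⟨zero_le_one, le_rfl⟩
      have : (1:ℝ) / (1 + s * 1) - 1 = -s / (1 + s * 1) := by
        have h0' : 1 + s * 1 ≠ 0 := by linarith
        rw [div_sub_one h0']; congr 1; ring
      rw [this, abs_div, abs_neg, abs_of_pos (show 0 < 1 + s * 1 by linarith),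
        div_le_iff₀ (by linarith)]
      nlinarith [abs_nonneg s]
    · have h0 := hmhalf u hu
      have : (1:ℝ) / (1 + s * u) ^ 2 - 1 = -(s * u) * (2 + s * u) / (1 + s * u) ^ 2 := by
        have : 1 + s * u ≠ 0 := by linarith
        field_simp; ring
      have h3 := hsu u hu
      have h4 := abs_le.1 (h3.trans hs)
      rw [this, abs_div, abs_mul, abs_neg, abs_of_nonneg (sq_nonneg (1 + s * u)),
        div_le_iff₀ (by positivity), abs_of_pos (show 0 < 2 + s * u by linarith)]
      have h5 : |s * u| * (2 + s * u) ≤ |s| * (5/2) :=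
        mul_le_mul h3 (by linarith) (by linarith) (abs_nonneg s)
      have h6 : (1/4 : ℝ) ≤ (1 + s * u) ^ 2 := by nlinarith
      have h7 : 10 * |s| * (1/4) ≤ 10 * |s| * (1 + s * u) ^ 2 :=
        mul_le_mul_of_nonneg_left h6 (by positivity)
      linarith
  have h3 := abs_sub_le
    (∫ u in (0:ℝ)..1, ∫ v in (0:ℝ)..1, F (u / m u) (-τ - v - 2 * Real.log (m u)))
    (∫ u in (0:ℝ)..1, ∫ v in (0:ℝ)..1, F (u / m u) (-τ - v))
    (∫ u in (0:ℝ)..1, ∫ v in (0:ℝ)..1, F u (-τ - v))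
  rw [integral_swap_unit (G := fun u v => F (u / m u) (-τ - v - 2 * Real.log (m u))),
    integral_swap_unit (G := fun u v => F u (-τ - v))]
  · linarith
  · exact (by fun_prop : Continuous fun p : ℝ × ℝ => F p.1 (-τ - p.2))
  · exact c1 hdiv hlog

end Real

theorem avgOp_isLip {Γ : Subgroup SL2} {τ κ b : ℝ} {V : XQuot Γ → ℝ} (hV : IsHeight τ κ b V)
    (hτ : 10 ≤ τ) {f : XQuot Γ → ℝ} (hf : Continuous f) {L A : ℝ} (hL : 0 ≤ L) (hA : 0 ≤ A)
    (hlip : IsLip V L f)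
    (hosc : ∀ x (g g' : SL2), nrm g.1 ≤ Real.exp τ → nrm g'.1 ≤ Real.exp τ →
      |f (rmul Γ x g) - f (rmul Γ x g')| ≤ A * V x) :
    IsLip V (L / 4 + 16 * A) (avgOp Γ τ f) := by
  have hτ0 : 0 ≤ τ := by linarith
  have hVp : ∀ x, 0 ≤ V x := fun x => zero_le_one.trans (hV.one_le x)
  have hF : ∀ x, Continuous fun p : ℝ × ℝ => f (rmul Γ x (nmat p.1 * amat p.2)) := fun x =>
    continuous_rmul_na hf continuous_const continuous_fst continuous_snd
  have hD : ∀ x (w w' t t' : ℝ), |w| ≤ 2 → |w'| ≤ 2 → |t| ≤ τ + 3 → |t'| ≤ τ + 3 →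
      |f (rmul Γ x (nmat w * amat t)) - f (rmul Γ x (nmat w' * amat t'))| ≤ A * V x :=
    fun x w w' t t' hw hw' ht ht' => hosc x _ _ (nrm_na_le hτ hw ht) (nrm_na_le hτ hw' ht')
  have hD0 : ∀ x, 0 ≤ A * V x := fun x => mul_nonneg hA (hVp x)
  have fin : ∀ {y : ℝ} (x : XQuot Γ) (s c : ℝ), c ≤ L / 4 + 16 * A → y ≤ c * |s| * V x →
      y ≤ (L / 4 + 16 * A) * |s| * V x := fun x s c hc hy =>
    hy.trans (mul_le_mul_of_nonneg_right (mul_le_mul_of_nonneg_right hc (abs_nonneg s)) (hVp x))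
  refine ⟨fun x s hs => ?_, fun x s hs => ?_, fun x s hs => ?_⟩
  · refine fin x s A (by linarith) ((le_of_eq ?_).trans ((avg_shift_first (hF x) (hD x) hτ0 hs).trans
      (le_of_eq (by ring))))
    unfold avgOp
    simp only [rmul_rmul, ← mul_assoc, ← nmat_add, add_comm s]
  · refine fin x s (5 * A) (by linarith) ((le_of_eq ?_).trans
      ((avg_scale_first (hF x) (hD x) hτ0 (hD0 x) hs).trans (le_of_eq (by ring))))
    unfold avgOp
    simp only [rmul_rmul, ← mul_assoc, amat_mul_nmat]
    simp only [mul_assoc, ← amat_add]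
  · have hs' := abs_le.1 hs
    set m : ℝ → ℝ := fun u => max (1 + s * u) (1/4) with hm
    have hmc : Continuous m := by fun_prop
    have hm1 : ∀ u, 1/4 ≤ m u := fun u => le_max_right _ _
    have hmhalf : ∀ u ∈ Set.Icc (0:ℝ) 1, 1/2 ≤ 1 + s * u := fun u hu => by
      nlinarith [hu.1, hu.2]
    have hm2 : ∀ u ∈ Set.Icc (0:ℝ) 1, m u = 1 + s * u := fun u hu =>
      max_eq_left (by linarith [hmhalf u hu])
    have hm0 : ∀ u, m u ≠ 0 := fun u => by linarith [hm1 u]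
    have hlog : Continuous fun u => Real.log (m u) := hmc.log hm0
    have hdiv : Continuous fun u => u / m u := continuous_id.div hmc hm0
    have main := avg_mobius_first (hF x) (hD x) hτ0 (hD0 x) hs hmc hm1 hm2
    have c1 : Continuous fun p : ℝ × ℝ => f (rmul Γ (rmul Γ x (lmat s)) (nmat p.2 * amat (-τ - p.1))) :=
      continuous_rmul_na hf continuous_const continuous_snd (by fun_prop)
    have c2 : Continuous fun p : ℝ × ℝ => f (rmul Γ x (nmat (p.2 / m p.2) *
        amat (-τ - p.1 - 2 * Real.log (m p.2)))) :=
      continuous_rmul_na hf continuous_const (hdiv.comp continuous_snd)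
        ((by fun_prop : Continuous fun p : ℝ × ℝ => -τ - p.1).sub
          (continuous_const.mul (hlog.comp continuous_snd)))
    have first : |avgOp Γ τ f (rmul Γ x (lmat s)) - ∫ v in (0:ℝ)..1, ∫ u in (0:ℝ)..1,
        f (rmul Γ x (nmat (u / m u) * amat (-τ - v - 2 * Real.log (m u))))| ≤ L / 4 * |s| * V x := by
      refine abs_integral_sub_le_unit (continuous_integral_unit c1) (continuous_integral_unit c2)
        fun v hv => abs_integral_sub_le_unit (c1.comp (by fun_prop : Continuous fun u : ℝ => (v, u)))
          (c2.comp (by fun_prop : Continuous fun u : ℝ => (v, u))) fun u hu => ?_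
      have h1 := hmhalf u hu
      simp only [Function.comp]
      rw [hm2 u hu, rmul_rmul, ← mul_assoc, lmat_mul_nmat s u (by linarith), mul_assoc, lmat_mul_amat,
        ← mul_assoc, mul_assoc (nmat _), ← amat_add,
        show -2 * Real.log (1 + s * u) + (-τ - v) = -τ - v - 2 * Real.log (1 + s * u) by ring,
        ← rmul_rmul]
      set g := nmat (u / (1 + s * u)) * amat (-τ - v - 2 * Real.log (1 + s * u)) with hg
      have hlog1 := Real.log_le_sub_one_of_pos (show 0 < 1 + s * u by linarith)
      have hlog2 := Real.log_le_sub_one_of_pos (show 0 < (1 + s * u)⁻¹ by positivity)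
      rw [Real.log_inv] at hlog2
      have hinv : (1 + s * u)⁻¹ ≤ 2 := by
        rw [inv_le_comm₀ (by linarith) (by norm_num)]; linarith
      have hgn : nrm g.1 ≤ Real.exp τ := by
        refine nrm_na_le hτ ?_ (abs_le.2 ⟨?_, ?_⟩)
        · rw [abs_of_nonneg (div_nonneg hu.1 (by linarith)), div_le_iff₀ (by linarith)]
          linarith [hu.2]
        · nlinarith [hv.1, hv.2, hu.1, hu.2]
        · nlinarith [hv.1, hv.2, hu.1, hu.2]
      have hexp : Real.exp (-τ - v) ≤ 1 / 16 := by
        have e1 : Real.exp (-τ - v) ≤ Real.exp (-10) := Real.exp_le_exp.2 (by linarith [hv.1])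
        have e2 : (2:ℝ) ^ 10 ≤ Real.exp 10 := by
          have := Real.add_one_le_exp (1:ℝ)
          have e : Real.exp 10 = Real.exp 1 ^ 10 := by rw [← Real.exp_nat_mul]; norm_num
          rw [e]
          exact pow_le_pow_left₀ (by norm_num) (by linarith) _
        refine e1.trans ?_
        rw [Real.exp_neg, inv_le_comm₀ (Real.exp_pos _) (by norm_num)]
        norm_num at e2 ⊢
        linarith
      have hsm : |Real.exp (-τ - v) * (s / (1 + s * u))| ≤ 1/8 * |s| := by
        rw [abs_mul, abs_of_pos (Real.exp_pos _), div_eq_mul_inv, abs_mul,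
          abs_of_pos (show 0 < (1 + s * u)⁻¹ by positivity)]
        calc Real.exp (-τ - v) * (|s| * (1 + s * u)⁻¹) ≤ 1/16 * (|s| * 2) := by gcongr
          _ = 1/8 * |s| := by ring
      refine (hlip.l (rmul Γ x g) _ (by linarith)).trans ?_
      calc L * |Real.exp (-τ - v) * (s / (1 + s * u))| * V (rmul Γ x g)
          ≤ L * (1/8 * |s|) * (2 * V x) := by
            gcongr
            · exact hVp _
            · exact hV.growth x g hgn
        _ = L / 4 * |s| * V x := by ring
    have := abs_sub_le (avgOp Γ τ f (rmul Γ x (lmat s))) (∫ v in (0:ℝ)..1, ∫ u in (0:ℝ)..1,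
        f (rmul Γ x (nmat (u / m u) * amat (-τ - v - 2 * Real.log (m u))))) (avgOp Γ τ f x)
    refine (this.trans (add_le_add first main)).trans (le_of_eq (by ring))

theorem eventually_eq_nal {δ : ℝ} (hδ : 0 < δ) :
    ∀ᶠ g : SL2 in 𝓝 1, ∃ s t r : ℝ, |s| < δ ∧ |t| < δ ∧ |r| < δ ∧ g = nmat s * amat t * lmat r := by
  have c : ∀ i j, ContinuousAt (fun g : SL2 => g.1 i j) 1 := fun i j => (continuous_entry i j).continuousAt
  have h11 : ∀ᶠ g : SL2 in 𝓝 1, 0 < g.1 1 1 :=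
    (c 1 1).eventually (lt_mem_nhds (by simp))
  have a1 : ContinuousAt (fun g : SL2 => g.1 0 1 / g.1 1 1) 1 := (c 0 1).div (c 1 1) (by simp)
  have a2 : ContinuousAt (fun g : SL2 => -2 * Real.log (g.1 1 1)) 1 :=
    continuousAt_const.mul ((c 1 1).log (by simp))
  have a3 : ContinuousAt (fun g : SL2 => g.1 1 0 / g.1 1 1) 1 := (c 1 0).div (c 1 1) (by simp)
  have l1 := a1.abs.eventually (gt_mem_nhds (show |_| < δ by simpa using hδ))
  have l2 := a2.abs.eventually (gt_mem_nhds (show |_| < δ by simpa using hδ))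
  have l3 := a3.abs.eventually (gt_mem_nhds (show |_| < δ by simpa using hδ))
  filter_upwards [h11, l1, l2, l3] with g h0 h1 h2 h3
  exact ⟨_, _, _, h1, h2, h3, SL2_eq_nal g h0⟩

section Walk

variable {Γ : Subgroup SL2} {τ κ b : ℝ} {V : XQuot Γ → ℝ}

theorem IsLip.abs_sub_le_nal (hV : IsHeight τ κ b V) (hτ : 10 ≤ τ) {L : ℝ} (hL : 0 ≤ L)
    {f : XQuot Γ → ℝ} (hf : IsLip V L f) (x : XQuot Γ) {s t r δ : ℝ} (hδ : δ ≤ 1/2) (hs : |s| ≤ δ)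
    (ht : |t| ≤ δ) (hr : |r| ≤ δ) :
    |f (rmul Γ x (nmat s * amat t * lmat r)) - f x| ≤ 5 * L * δ * V x := by
  have hV0 : ∀ x, 0 ≤ V x := fun x => zero_le_one.trans (hV.one_le x)
  have h1 := hf.n x s (hs.trans hδ)
  have h2 := hf.a (rmul Γ x (nmat s)) t (ht.trans hδ)
  have h3 := hf.l (rmul Γ x (nmat s * amat t)) r (hr.trans hδ)
  rw [rmul_rmul] at h2 h3
  have g1 := hV.growth x (nmat s) (nrm_nmat_le hτ (by linarith))
  have g2 := hV.growth x (nmat s * amat t) (nrm_na_le hτ (by linarith) (by linarith))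
  have k1 : L * |s| * V x ≤ L * δ * V x := by gcongr; exact hV0 _
  have k2 : L * |t| * V (rmul Γ x (nmat s)) ≤ L * δ * (2 * V x) := by
    gcongr
    · exact hV0 _
    · exact mul_nonneg hL ((abs_nonneg s).trans hs)
  have k3 : L * |r| * V (rmul Γ x (nmat s * amat t)) ≤ L * δ * (2 * V x) := by
    gcongr
    · exact hV0 _
    · exact mul_nonneg hL ((abs_nonneg s).trans hs)
  have e1 := abs_sub_le (f (rmul Γ x (nmat s * amat t * lmat r))) (f (rmul Γ x (nmat s * amat t))) (f x)
  have e2 := abs_sub_le (f (rmul Γ x (nmat s * amat t))) (f (rmul Γ x (nmat s))) (f x)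
  linarith

theorem eventually_forall_isLip (hV : IsHeight τ κ b V) (hτ : 10 ≤ τ) {L : ℝ} (hL : 0 ≤ L)
    (x : XQuot Γ) {ε : ℝ} (hε : 0 < ε) :
    ∀ᶠ y in 𝓝 x, ∀ f, IsLip V L f → |f y - f x| < ε := by
  have hV0 : 0 < V x := zero_lt_one.trans_le (hV.one_le x)
  set δ := min (1/2) (ε / (10 * (L + 1) * V x)) with hδ
  have hδ0 : 0 < δ := lt_min (by norm_num) (by positivity)
  filter_upwards [rmul_image_mem_nhds Γ x (eventually_eq_nal hδ0)] with y hy f hf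
  obtain ⟨g, ⟨s, t, r, hs, ht, hr, rfl⟩, rfl⟩ := hy
  refine (hf.abs_sub_le_nal hV hτ hL x (min_le_left _ _) hs.le ht.le hr.le).trans_lt ?_
  calc 5 * L * δ * V x ≤ 5 * (L + 1) * (ε / (10 * (L + 1) * V x)) * V x := by
        gcongr
        · linarith
        · exact min_le_right _ _
    _ = ε / 2 := by field_simp; ring
    _ < ε := by linarith

theorem IsLip.continuous (hV : IsHeight τ κ b V) (hτ : 10 ≤ τ) {L : ℝ} (hL : 0 ≤ L)
    {f : XQuot Γ → ℝ} (hf : IsLip V L f) : Continuous f := by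
  rw [continuous_iff_continuousAt]
  intro x
  rw [ContinuousAt, Metric.tendsto_nhds]
  intro ε hε
  filter_upwards [eventually_forall_isLip hV hτ hL x hε] with y hy
  exact hy f hf

theorem IsLip.of_tendsto {ι : Type*} {l : Filter ι} [l.NeBot] {L : ℝ} {h : ι → XQuot Γ → ℝ}
    {φ : XQuot Γ → ℝ} (hh : ∀ i, IsLip V L (h i)) (hφ : ∀ x, Tendsto (fun i => h i x) l (𝓝 (φ x))) :
    IsLip V L φ :=
  ⟨fun x s hs => le_of_tendsto ((hφ _).sub (hφ _)).abs (Eventually.of_forall fun i => (hh i).n x s hs),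
   fun x s hs => le_of_tendsto ((hφ _).sub (hφ _)).abs (Eventually.of_forall fun i => (hh i).a x s hs),
   fun x s hs => le_of_tendsto ((hφ _).sub (hφ _)).abs (Eventually.of_forall fun i => (hh i).l x s hs)⟩

theorem tendsto_uniformly_on_compact (hV : IsHeight τ κ b V) (hτ : 10 ≤ τ) {ι : Type*} {l : Filter ι}
    [l.NeBot] {L : ℝ} (hL : 0 ≤ L) {h : ι → XQuot Γ → ℝ}
    {φ : XQuot Γ → ℝ} (hh : ∀ i, IsLip V L (h i)) (hφ : ∀ x, Tendsto (fun i => h i x) l (𝓝 (φ x)))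
    {K : Set (XQuot Γ)} (hK : IsCompact K) {η : ℝ} (hη : 0 < η) :
    ∀ᶠ i in l, ∀ x ∈ K, |h i x - φ x| ≤ η := by
  refine hK.induction_on (p := fun s => ∀ᶠ i in l, ∀ x ∈ s, |h i x - φ x| ≤ η) ?_ ?_ ?_ ?_
  · simp
  · intro s t hst ht
    filter_upwards [ht] with i hi x hx using hi x (hst hx)
  · intro s t hs ht
    filter_upwards [hs, ht] with i h1 h2 x hx
    exact hx.elim (h1 x) (h2 x)
  · intro x _
    refine ⟨_, mem_nhdsWithin_of_mem_nhds
      (eventually_forall_isLip hV hτ hL x (show 0 < η / 3 by linarith)), ?_⟩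
    filter_upwards [(Metric.tendsto_nhds.1 (hφ x)) (η / 3) (by linarith)] with i hi y hy
    have h1 := hy _ (hh i)
    have h2 := hy _ (IsLip.of_tendsto hh hφ)
    rw [Real.dist_eq] at hi
    rw [abs_lt] at h1 h2 hi
    rw [abs_le]
    constructor <;> linarith [h1.1, h1.2, h2.1, h2.2, hi.1, hi.2]

theorem avgOp_height_le (hV : IsHeight τ κ b V) (x : XQuot Γ) : avgOp Γ τ V x ≤ κ * V x + b := by
  have hc : Continuous fun v : ℝ => ∫ u in (0:ℝ)..1, V (rmul Γ x (nmat u * amat (-τ - v))) :=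
    continuous_inner_avg hV.cont continuous_const (by fun_prop)
  have := intervalIntegral.integral_mono_on zero_le_one (hc.intervalIntegrable _ _)
    (intervalIntegrable_const (μ := volume) (c := κ * V x + b)) (fun v hv => hV.step x v hv)
  simpa [avgOp] using this

theorem avgOp_iterate_height_le (hV : IsHeight τ κ b V) (hκ0 : 0 ≤ κ) (hκ1 : κ < 1) (hb : 0 ≤ b)
    (k : ℕ) (x : XQuot Γ) : (avgOp Γ τ)^[k] V x ≤ κ ^ k * V x + b / (1 - κ) := by
  have h1 : 0 < 1 - κ := by linarith
  induction k generalizing x with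
  | zero => simp only [Function.iterate_zero, id, pow_zero, one_mul]; linarith [div_nonneg hb h1.le]
  | succ k ih =>
    rw [Function.iterate_succ_apply]
    have hR := isMarkovOp_avgOp (Γ := Γ) τ
    have h2 := (hR.iterate k).le_affine (hR.cont hV.cont) hV.cont (a := b) (c := κ)
      (fun y => by linarith [avgOp_height_le hV y]) x
    have h3 := mul_le_mul_of_nonneg_left (ih x) hκ0
    have h4 : κ * (b / (1 - κ)) + b = b / (1 - κ) := by field_simp; ring
    rw [pow_succ]
    linarith

end Walk

section Invariant

variable {Γ : Subgroup SL2} {τ : ℝ} {μ : Measure (XQuot Γ)}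

theorem integral_comp_rmul (hinv : ∀ g : SL2, Measure.map (fun x => rmul Γ x g) μ = μ)
    {f : XQuot Γ → ℝ} (hf : Continuous f) (g : SL2) : ∫ x, f (rmul Γ x g) ∂μ = ∫ x, f x ∂μ := by
  conv_rhs => rw [← hinv g]
  rw [integral_map (continuous_rmul_left g).aemeasurable hf.aestronglyMeasurable]

variable [IsProbabilityMeasure μ]

theorem integrable_of_continuous_bdd {f : XQuot Γ → ℝ} (hf : Continuous f) {B : ℝ}
    (hB : ∀ x, |f x| ≤ B) : Integrable f μ :=
  Integrable.of_bound hf.aestronglyMeasurable B (Eventually.of_forall hB)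

theorem isOpenPosMeasure_of_invariant (hinv : ∀ g : SL2, Measure.map (fun x => rmul Γ x g) μ = μ) :
    μ.IsOpenPosMeasure := by
  refine ⟨fun U hU hne h0 => ?_⟩
  obtain ⟨u, hu⟩ := hne
  have ho : ∀ g : SL2, IsOpen ((fun x => rmul Γ x g) ⁻¹' U) := fun g =>
    hU.preimage (continuous_rmul_left g)
  obtain ⟨T, hT, hTU⟩ := TopologicalSpace.isOpen_iUnion_countable _ ho
  have hz : ∀ g : SL2, μ ((fun x => rmul Γ x g) ⁻¹' U) = 0 := fun g => by
    rw [← Measure.map_apply (continuous_rmul_left g).measurable hU.measurableSet, hinv, h0]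
  have hall : (⋃ g : SL2, (fun x => rmul Γ x g) ⁻¹' U) = Set.univ := by
    refine Set.eq_univ_of_forall fun x => ?_
    obtain ⟨g, hg⟩ := exists_rmul_eq Γ x u
    exact Set.mem_iUnion.2 ⟨g, by simpa [hg] using hu⟩
  have h1 : μ Set.univ = 0 := by
    rw [← hall, ← hTU, measure_biUnion_null_iff hT]
    exact fun g _ => hz g
  simp at h1

theorem integral_integral_unit_swap {G : XQuot Γ → ℝ → ℝ}
    (hG : Continuous fun p : XQuot Γ × ℝ => G p.1 p.2) {B : ℝ} (hB : ∀ x u, |G x u| ≤ B) :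
    ∫ x, (∫ u in (0:ℝ)..1, G x u) ∂μ = ∫ u in (0:ℝ)..1, ∫ x, G x u ∂μ := by
  simp only [intervalIntegral.integral_of_le (zero_le_one (α := ℝ))]
  refine integral_integral_swap ?_
  exact Integrable.of_bound hG.aestronglyMeasurable B (Eventually.of_forall fun p => hB p.1 p.2)

theorem integral_avgOp (hinv : ∀ g : SL2, Measure.map (fun x => rmul Γ x g) μ = μ)
    {f : XQuot Γ → ℝ} (hf : Continuous f) {B : ℝ} (hB : ∀ x, |f x| ≤ B) :
    ∫ x, avgOp Γ τ f x ∂μ = ∫ x, f x ∂μ := by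
  unfold avgOp
  have hb : ∀ x v, |∫ u in (0:ℝ)..1, f (rmul Γ x (nmat u * amat (-τ - v)))| ≤ B := fun x v => by
    have := intervalIntegral.norm_integral_le_of_norm_le_const (a := 0) (b := 1) (C := B)
      (f := fun u => f (rmul Γ x (nmat u * amat (-τ - v)))) (fun u _ => hB _)
    simpa using this
  rw [integral_integral_unit_swap (continuous_inner_avg hf continuous_fst
    (continuous_const.sub continuous_snd)) hb]
  have h1 : ∀ v : ℝ, ∫ x, (∫ u in (0:ℝ)..1, f (rmul Γ x (nmat u * amat (-τ - v)))) ∂μ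
      = ∫ x, f x ∂μ := fun v => by
    rw [integral_integral_unit_swap (continuous_rmul_na hf continuous_fst continuous_snd
      continuous_const) (fun x u => hB _)]
    simp [integral_comp_rmul hinv hf]
  simp [h1]

end Invariant

theorem IsMarkovOp.sq_sub {X : Type*} [TopologicalSpace X] {P : (X → ℝ) → X → ℝ}
    (hP : IsMarkovOp P) {f : X → ℝ} (hf : Continuous f) (x : X) :
    P (fun y => (f y - P f x) ^ 2) x = P (fun y => f y ^ 2) x - P f x ^ 2 := by
  have h1 := hP.add (f := fun y => f y ^ 2) (g := fun y => (P f x) ^ 2 + (-2 * P f x) * f y)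
    (by fun_prop) (by fun_prop) x
  rw [hP.affine hf] at h1
  have h2 : (fun y => (f y - P f x) ^ 2) =
      fun y => f y ^ 2 + ((P f x) ^ 2 + (-2 * P f x) * f y) := by funext y; ring
  rw [h2, h1]; ring

theorem IsMarkovOp.sq_le {X : Type*} [TopologicalSpace X] {P : (X → ℝ) → X → ℝ}
    (hP : IsMarkovOp P) {f : X → ℝ} (hf : Continuous f) (x : X) :
    P f x ^ 2 ≤ P (fun y => f y ^ 2) x := by
  have h := hP.mono continuous_const (by fun_prop : Continuous fun y => (f y - P f x) ^ 2)
    (fun y => sq_nonneg (f y - P f x)) x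
  rw [hP.sq_sub hf, hP.const] at h
  linarith

theorem eq_zero_of_integral_unit_eq_zero {G : ℝ → ℝ} (hG : Continuous G) (h0 : ∀ u, 0 ≤ G u)
    (h : ∫ u in (0:ℝ)..1, G u = 0) : ∀ u ∈ Set.Icc (0:ℝ) 1, G u = 0 := by
  intro u hu
  by_contra hne
  have := intervalIntegral.integral_pos zero_lt_one hG.continuousOn (fun x _ => h0 x)
    ⟨u, hu, lt_of_le_of_ne (h0 u) (Ne.symm hne)⟩
  linarith

section Rigidity

variable {Γ : Subgroup SL2} {τ : ℝ} {μ : Measure (XQuot Γ)} [IsProbabilityMeasure μ]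

theorem eq_of_avgOp_sq_eq (hinv : ∀ g : SL2, Measure.map (fun x => rmul Γ x g) μ = μ)
    {φ : XQuot Γ → ℝ} (hφ : Continuous φ) {B : ℝ} (hB : ∀ x, |φ x| ≤ B)
    (hE : ∫ x, avgOp Γ τ φ x ^ 2 ∂μ = ∫ x, φ x ^ 2 ∂μ) (x : XQuot Γ) {u v : ℝ}
    (hu : u ∈ Set.Icc (0:ℝ) 1) (hv : v ∈ Set.Icc (0:ℝ) 1) :
    φ (rmul Γ x (nmat u * amat (-τ - v))) = avgOp Γ τ φ x := by
  have hR := isMarkovOp_avgOp (Γ := Γ) τ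
  have := isOpenPosMeasure_of_invariant hinv
  have hsq : Continuous fun y => φ y ^ 2 := by fun_prop
  have hRc := hR.cont hφ
  have hRsq := hR.cont hsq
  have hB2 : ∀ x, |φ x ^ 2| ≤ B ^ 2 := fun x => by
    rw [abs_pow]; exact pow_le_pow_left₀ (abs_nonneg _) (hB x) 2
  have hRB := hR.abs_le_const hφ hB
  have hRB2 : ∀ x, |avgOp Γ τ φ x ^ 2| ≤ B ^ 2 := fun x => by
    rw [abs_pow]; exact pow_le_pow_left₀ (abs_nonneg _) (hRB x) 2
  set D : XQuot Γ → ℝ := fun x => avgOp Γ τ (fun y => φ y ^ 2) x - avgOp Γ τ φ x ^ 2 with hD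
  have hDc : Continuous D := by fun_prop
  have hD0 : 0 ≤ D := fun x => sub_nonneg.2 (hR.sq_le hφ x)
  have i1 := integrable_of_continuous_bdd (μ := μ) hRsq (hR.abs_le_const hsq hB2)
  have i2 := integrable_of_continuous_bdd (μ := μ) (by fun_prop : Continuous fun x => avgOp Γ τ φ x ^ 2) hRB2
  have hDint : ∫ x, D x ∂μ = 0 := by
    rw [hD, integral_sub i1 i2, integral_avgOp hinv hsq hB2, hE, sub_self]
  have hae := (integral_eq_zero_iff_of_nonneg hD0 (i1.sub i2)).1 hDint
  have hDz : D = 0 := (hDc.ae_eq_iff_eq μ continuous_const).1 hae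
  have hz : avgOp Γ τ (fun y => (φ y - avgOp Γ τ φ x) ^ 2) x = 0 := by
    rw [hR.sq_sub hφ]; exact congrFun hDz x
  set c := avgOp Γ τ φ x
  have hψ : Continuous fun y => (φ y - c) ^ 2 := by fun_prop
  have h1 := eq_zero_of_integral_unit_eq_zero (continuous_inner_avg hψ continuous_const
    (by fun_prop)) (fun v => intervalIntegral.integral_nonneg zero_le_one fun u _ => sq_nonneg _) hz v hv
  have h2 := eq_zero_of_integral_unit_eq_zero (continuous_rmul_na hψ continuous_const
    continuous_id continuous_const) (fun u => sq_nonneg _) h1 u hu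
  exact sub_eq_zero.1 (pow_eq_zero_iff two_ne_zero |>.1 h2)

end Rigidity

theorem oneParam_mem {S : Subgroup SL2} {p : ℝ → SL2} (h0 : p 0 = 1)
    (hadd : ∀ x y, p (x + y) = p x * p y) {c : ℝ} (hc : 0 < c) (h : ∀ v ∈ Set.Icc 0 c, p v ∈ S)
    (t : ℝ) : p t ∈ S := by
  have hpos : ∀ t, 0 ≤ t → p t ∈ S := by
    intro t ht
    obtain ⟨n, hn⟩ := exists_nat_gt (t / c)
    have hn0 : (0:ℝ) < n := lt_of_le_of_lt (div_nonneg ht hc.le) hn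
    have hpow : ∀ k : ℕ, p (k * (t / n)) = p (t / n) ^ k := by
      intro k
      induction k with
      | zero => simp [h0]
      | succ k ih => rw [pow_succ, ← ih, ← hadd]; push_cast; ring_nf
    have h1 : p t = p (t / n) ^ n := by rw [← hpow n]; congr 1; field_simp
    rw [h1]
    refine S.pow_mem (h _ ⟨by positivity, ?_⟩) n
    rw [div_lt_iff₀ hc] at hn
    rw [div_le_iff₀ hn0]; linarith
  rcases le_total 0 t with ht | ht
  · exact hpos t ht
  · have h1 : p t * p (-t) = 1 := by rw [← hadd, add_neg_cancel, h0]
    rw [eq_inv_of_mul_eq_one_left h1]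
    exact S.inv_mem (hpos _ (by linarith))

theorem subgroup_eq_top_of_nal {S : Subgroup SL2} (hn : ∀ s, nmat s ∈ S) (ha : ∀ s, amat s ∈ S)
    (hl : ∀ s, lmat s ∈ S) : S = ⊤ := by
  have hpos : ∀ g : SL2, 0 < g.1 1 1 → g ∈ S := fun g hg => by
    rw [SL2_eq_nal g hg]
    exact S.mul_mem (S.mul_mem (hn _) (ha _)) (hl _)
  have hc : ∀ g : SL2, g.1 1 0 ≠ 0 → g ∈ S := fun g hg => by
    have h1 : (g * nmat ((1 - g.1 1 1) / g.1 1 0)).1 1 1 = 1 := by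
      simp only [SL2_mul_apply, nmat_01, nmat_11]; field_simp; ring
    have h2 := hpos (g * nmat ((1 - g.1 1 1) / g.1 1 0)) (by rw [h1]; norm_num)
    exact (S.mul_mem_cancel_right (hn _)).1 h2
  refine (Subgroup.eq_top_iff' S).2 fun g => ?_
  by_cases hg : g.1 1 0 = 0
  · have hd : g.1 1 1 ≠ 0 := by
      intro h
      have := SL2_det g
      rw [hg, h] at this
      simp at this
    have h1 : (g * lmat 1).1 1 0 ≠ 0 := by
      simpa [SL2_mul_apply, hg] using hd
    exact (S.mul_mem_cancel_right (hl _)).1 (hc _ h1)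
  · exact hc g hg

/-- The elements whose right translation leaves a function invariant. -/
def stabilizerOf {Γ : Subgroup SL2} (φ : XQuot Γ → ℝ) : Subgroup SL2 where
  carrier := {g | ∀ x, φ (rmul Γ x g) = φ x}
  mul_mem' {g h} hg hh x := by rw [← rmul_rmul, hh, hg]
  one_mem' x := by rw [rmul_one]
  inv_mem' {g} hg x := by
    have := hg (rmul Γ x g⁻¹)
    rw [rmul_rmul, inv_mul_cancel, rmul_one] at this
    exact this.symm

section Rigidity

variable {Γ : Subgroup SL2} {τ : ℝ} {μ : Measure (XQuot Γ)} [IsProbabilityMeasure μ]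

/-- The Mautner phenomenon for the diagonal group. -/
theorem lmat_mem_stabilizerOf (hinv : ∀ g : SL2, Measure.map (fun x => rmul Γ x g) μ = μ)
    {φ : XQuot Γ → ℝ} (hφ : Continuous φ) {B : ℝ} (hB : ∀ x, |φ x| ≤ B)
    (ha : ∀ t, amat t ∈ stabilizerOf φ) (s : ℝ) : lmat s ∈ stabilizerOf φ := by
  have := isOpenPosMeasure_of_invariant hinv
  set D : ℝ → ℝ := fun s => ∫ x, |φ (rmul Γ x (lmat s)) - φ x| ∂μ with hD
  have hc : ∀ s, Continuous fun x => |φ (rmul Γ x (lmat s)) - φ x| := fun s =>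
    ((hφ.comp (continuous_rmul_left _)).sub hφ).abs
  have hb : ∀ s x, |φ (rmul Γ x (lmat s)) - φ x| ≤ 2 * B := fun s x => by
    have := abs_sub (φ (rmul Γ x (lmat s))) (φ x)
    linarith [hB (rmul Γ x (lmat s)), hB x]
  have hscale : ∀ t s, D (Real.exp (-t) * s) = D s := by
    intro t s
    simp only [hD]
    rw [← integral_comp_rmul hinv (hc s) (amat t)]
    congr 1; funext x
    have h1 : φ (rmul Γ (rmul Γ x (amat t)) (lmat s)) =
        φ (rmul Γ x (lmat (Real.exp (-t) * s))) := by
      rw [rmul_rmul]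
      have : amat t * lmat s = lmat (Real.exp (-t) * s) * amat t := by
        rw [lmat_mul_amat, ← mul_assoc (Real.exp t), ← Real.exp_add]; simp
      rw [this, ← rmul_rmul]
      exact ha t _
    rw [h1, show φ (rmul Γ x (amat t)) = φ x from ha t x]
  have hlim : Tendsto (fun n : ℕ => D (Real.exp (-(n:ℝ)) * s)) atTop (𝓝 0) := by
    have h0 : (0:ℝ) = ∫ _x, (0:ℝ) ∂μ := by simp
    rw [h0]
    refine tendsto_integral_of_dominated_convergence (fun _ => 2 * B)
      (fun n => (hc _).aestronglyMeasurable) (integrable_const _)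
      (fun n => Eventually.of_forall fun x => ?_) (Eventually.of_forall fun x => ?_)
    · rw [Real.norm_eq_abs, abs_abs]; exact hb _ x
    · have hcont : Continuous fun r : ℝ => |φ (rmul Γ x (lmat r)) - φ x| :=
        ((hφ.comp ((continuous_rmul_right x).comp continuous_lmat)).sub continuous_const).abs
      have h1 : Tendsto (fun n : ℕ => Real.exp (-(n:ℝ)) * s) atTop (𝓝 0) := by
        have := (Real.tendsto_exp_neg_atTop_nhds_zero.comp
          (tendsto_natCast_atTop_atTop (R := ℝ))).mul_const s
        simpa using this
      have := (hcont.tendsto 0).comp h1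
      simpa [Function.comp_def] using this
  have hz : D s = 0 := by
    have h1 : (fun n : ℕ => D (Real.exp (-(n:ℝ)) * s)) = fun _ => D s := by
      funext n; exact hscale _ _
    rw [h1] at hlim
    exact tendsto_nhds_unique tendsto_const_nhds hlim
  have hae := (integral_eq_zero_iff_of_nonneg (fun x => abs_nonneg _)
    (integrable_of_continuous_bdd (hc s) (fun x => by rw [abs_abs]; exact hb s x))).1 hz
  have hall := ((hc s).ae_eq_iff_eq μ continuous_const).1 hae
  intro x
  exact sub_eq_zero.1 (abs_eq_zero.1 (congrFun hall x))

theorem eq_of_avgOp_energy_eq (hinv : ∀ g : SL2, Measure.map (fun x => rmul Γ x g) μ = μ)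
    {φ : XQuot Γ → ℝ} (hφ : Continuous φ) {B : ℝ} (hB : ∀ x, |φ x| ≤ B)
    (hE : ∫ x, avgOp Γ τ φ x ^ 2 ∂μ = ∫ x, φ x ^ 2 ∂μ) (x y : XQuot Γ) : φ x = φ y := by
  have key : ∀ x, ∀ u ∈ Set.Icc (0:ℝ) 1, ∀ v ∈ Set.Icc (0:ℝ) 1,
      φ (rmul Γ x (nmat (Real.exp τ * u) * amat (-v))) = avgOp Γ τ φ (rmul Γ x (amat τ)) := by
    intro x u hu v hv
    rw [← eq_of_avgOp_sq_eq hinv hφ hB hE (rmul Γ x (amat τ)) hu hv, rmul_rmul, ← mul_assoc,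
      amat_mul_nmat, mul_assoc (nmat _), ← amat_add]
    congr 5; ring
  have h00 : ∀ x, φ x = avgOp Γ τ φ (rmul Γ x (amat τ)) := fun x => by
    simpa using key x 0 ⟨le_rfl, zero_le_one⟩ 0 ⟨le_rfl, zero_le_one⟩
  have ha : ∀ t, amat t ∈ stabilizerOf φ := by
    intro t
    have := oneParam_mem (S := stabilizerOf φ) (p := fun t => amat (-t)) (by simp)
      (fun x y => by rw [← amat_add]; congr 1; ring) zero_lt_one (fun v hv x => by
        rw [h00 x, ← key x 0 ⟨le_rfl, zero_le_one⟩ v hv]; simp) (-t)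
    simpa using this
  have hn : ∀ t, nmat t ∈ stabilizerOf φ := by
    refine oneParam_mem nmat_zero nmat_add (Real.exp_pos τ) fun w hw x => ?_
    have h1 : w / Real.exp τ ∈ Set.Icc (0:ℝ) 1 :=
      ⟨div_nonneg hw.1 (Real.exp_pos τ).le, (div_le_one (Real.exp_pos τ)).2 hw.2⟩
    have := key x _ h1 0 ⟨le_rfl, zero_le_one⟩
    rw [mul_div_cancel₀ _ (Real.exp_pos τ).ne', neg_zero, amat_zero, mul_one, ← h00] at this
    exact this
  have htop := subgroup_eq_top_of_nal hn ha (lmat_mem_stabilizerOf hinv hφ hB ha)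
  obtain ⟨g, rfl⟩ := exists_rmul_eq Γ x y
  have hg : g ∈ stabilizerOf φ := by rw [htop]; trivial
  exact (hg x).symm

/-- Along iterates, some step loses little energy. -/
theorem exists_small_energy
    {f : XQuot Γ → ℝ} (hf : Continuous f) (hB : ∀ x, |f x| ≤ 2) {N : ℕ} (hN : 0 < N) :
    ∃ n < N, ∫ x, ((avgOp Γ τ)^[n] f x) ^ 2 ∂μ - ∫ x, ((avgOp Γ τ)^[n + 1] f x) ^ 2 ∂μ ≤ 4 / N := by
  by_contra! h
  set e : ℕ → ℝ := fun n => ∫ x, ((avgOp Γ τ)^[n] f x) ^ 2 ∂μ with he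
  have h1 : ∑ n ∈ Finset.range N, (4 / (N:ℝ)) < ∑ n ∈ Finset.range N, (e n - e (n+1)) :=
    Finset.sum_lt_sum_of_nonempty (Finset.nonempty_range_iff.2 hN.ne')
      fun n hn => h n (Finset.mem_range.1 hn)
  rw [Finset.sum_range_sub', Finset.sum_const, Finset.card_range, nsmul_eq_mul,
    mul_div_cancel₀ _ (by positivity)] at h1
  have h2 : 0 ≤ e N := integral_nonneg fun x => sq_nonneg _
  have h3 : e 0 ≤ 4 := by
    have := integral_mono (μ := μ) (f := fun x => f x ^ 2) (g := fun _ => (4:ℝ))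
      (integrable_of_continuous_bdd (B := 4) (by fun_prop) fun x => ?_) (integrable_const _)
      fun x => ?_
    · simpa [he] using this
    · rw [abs_pow]; nlinarith [hB x, abs_nonneg (f x)]
    · have := abs_le.1 (hB x)
      simp only; nlinarith
  linarith

end Rigidity

section SoftContraction

variable {Γ : Subgroup SL2} {τ κ b : ℝ} {V : XQuot Γ → ℝ}

theorem IsLip.mono (hV : IsHeight τ κ b V) {L L' : ℝ} (h : L ≤ L') {f : XQuot Γ → ℝ}
    (hf : IsLip V L f) : IsLip V L' f := by
  have key : ∀ (x : XQuot Γ) (s : ℝ), L * |s| * V x ≤ L' * |s| * V x := fun x s => by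
    have := hV.one_le x
    gcongr
  exact ⟨fun x s hs => (hf.n x s hs).trans (key x s), fun x s hs => (hf.a x s hs).trans (key x s),
    fun x s hs => (hf.l x s hs).trans (key x s)⟩

theorem IsLip.iterate (hV : IsHeight τ κ b V) (hτ : 10 ≤ τ) {L : ℝ} (hL : 100 ≤ L)
    {f : XQuot Γ → ℝ} (hf : IsLip V L f) (hB : ∀ x, |f x| ≤ 2) (n : ℕ) :
    IsLip V L ((avgOp Γ τ)^[n] f) := by
  have hc : Continuous f := hf.continuous hV hτ (by linarith)
  induction n with
  | zero => exact hf
  | succ n ih =>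
    rw [Function.iterate_succ_apply']
    refine (avgOp_isLip hV hτ (((isMarkovOp_avgOp τ).iterate n).cont hc) (A := 4) (by linarith)
      (by norm_num) ih fun x g g' _ _ => ?_).mono hV (by linarith)
    have := ((isMarkovOp_avgOp (Γ := Γ) τ).iterate n).abs_le_const hc hB
    have h1 := abs_sub ((avgOp Γ τ)^[n] f (rmul Γ x g)) ((avgOp Γ τ)^[n] f (rmul Γ x g'))
    linarith [this (rmul Γ x g), this (rmul Γ x g'), hV.one_le x]

variable {μ : Measure (XQuot Γ)} [IsProbabilityMeasure μ]

theorem tendsto_integral_min_height (hV : IsHeight τ κ b V) :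
    Tendsto (fun k : ℕ => ∫ x, min 1 (V x / k) ∂μ) atTop (𝓝 0) := by
  have h0 : (0:ℝ) = ∫ _x, (0:ℝ) ∂μ := by simp
  rw [h0]
  refine tendsto_integral_of_dominated_convergence (fun _ => 1)
    (fun n => (continuous_const.min (hV.cont.div_const _)).aestronglyMeasurable)
    (integrable_const _) (fun n => Eventually.of_forall fun x => ?_)
    (Eventually.of_forall fun x => ?_)
  · have : 0 ≤ V x / n := div_nonneg (zero_le_one.trans (hV.one_le x)) n.cast_nonneg
    rw [Real.norm_eq_abs, abs_of_nonneg (le_min zero_le_one this)]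
    exact min_le_left _ _
  · have h1 : Tendsto (fun k : ℕ => V x / k) atTop (𝓝 0) := tendsto_const_div_atTop_nhds_zero_nat _
    simpa using (tendsto_const_nhds (x := (1:ℝ))).min h1

theorem energy_le_of_close (hinv : ∀ g : SL2, Measure.map (fun x => rmul Γ x g) μ = μ)
    {h φ : XQuot Γ → ℝ} (hh : Continuous h) (hφ : Continuous φ) (hB : ∀ x, |h x| ≤ 2)
    (hB' : ∀ x, |φ x| ≤ 2) {e d : ℝ} (he : ∫ x, h x ^ 2 ∂μ - ∫ x, avgOp Γ τ h x ^ 2 ∂μ ≤ e)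
    (hd : ∫ x, |h x - φ x| ∂μ ≤ d) :
    ∫ x, φ x ^ 2 ∂μ - ∫ x, avgOp Γ τ φ x ^ 2 ∂μ ≤ e + 8 * d := by
  have hR := isMarkovOp_avgOp (Γ := Γ) τ
  have hsq : ∀ a c : ℝ, |a| ≤ 2 → |c| ≤ 2 → a ^ 2 ≤ c ^ 2 + 4 * |a - c| := by
    intro a c ha hc
    have h1 : a ^ 2 - c ^ 2 ≤ |a - c| * |a + c| := by
      rw [← abs_mul]; exact (le_of_eq (by ring)).trans (le_abs_self _)
    have h2 := abs_add_le a c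
    nlinarith [abs_nonneg (a - c)]
  have i2 : ∀ f : XQuot Γ → ℝ, Continuous f → (∀ x, |f x| ≤ 2) → Integrable (fun x => f x ^ 2) μ :=
    fun f hf hb => integrable_of_continuous_bdd (hf.pow 2) (B := 4) fun x => by
      rw [abs_pow]; nlinarith [hb x, abs_nonneg (f x)]
  have cd : Continuous fun x => |h x - φ x| := (hh.sub hφ).abs
  have bd : ∀ x, |(|h x - φ x|)| ≤ 4 := fun x => by
    rw [abs_abs]; have := abs_sub (h x) (φ x); linarith [hB x, hB' x]
  have id := integrable_of_continuous_bdd (μ := μ) cd bd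
  have bR : ∀ x, |avgOp Γ τ (fun x => |h x - φ x|) x| ≤ 4 := hR.abs_le_const cd bd
  have iR := integrable_of_continuous_bdd (μ := μ) (hR.cont cd) bR
  have e1 : ∫ x, φ x ^ 2 ∂μ ≤ ∫ x, (h x ^ 2 + 4 * |h x - φ x|) ∂μ :=
    integral_mono (i2 φ hφ hB') ((i2 h hh hB).add (id.const_mul 4)) fun x => by
      have := hsq (φ x) (h x) (hB' x) (hB x)
      rwa [abs_sub_comm] at this
  have e2 : ∫ x, avgOp Γ τ h x ^ 2 ∂μ ≤
      ∫ x, (avgOp Γ τ φ x ^ 2 + 4 * avgOp Γ τ (fun x => |h x - φ x|) x) ∂μ :=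
    integral_mono (i2 _ (hR.cont hh) (hR.abs_le_const hh hB))
      ((i2 _ (hR.cont hφ) (hR.abs_le_const hφ hB')).add (iR.const_mul 4)) fun x => by
      have h1 := hsq _ _ (hR.abs_le_const hh hB x) (hR.abs_le_const hφ hB' x)
      have h2 : |avgOp Γ τ h x - avgOp Γ τ φ x| ≤ avgOp Γ τ (fun x => |h x - φ x|) x := by
        rw [← hR.sub hh hφ x]
        have := hR.abs_le_affine (a := 0) (c := 1) 
          (f := fun y => h y - φ y) (hh.sub hφ) cd (fun y => by simp) x
        rwa [zero_add, one_mul] at this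
      simp only
      linarith
  rw [integral_add (i2 h hh hB) (id.const_mul 4), integral_const_mul] at e1
  rw [integral_add (i2 _ (hR.cont hφ) (hR.abs_le_const hφ hB')) (iR.const_mul 4),
    integral_const_mul, integral_avgOp hinv cd bd] at e2
  linarith

theorem exists_const_limit (hinv : ∀ g : SL2, Measure.map (fun x => rmul Γ x g) μ = μ)
    (hV : IsHeight τ κ b V) (hτ : 10 ≤ τ) {L : ℝ} (hL : 0 ≤ L) {h : ℕ → XQuot Γ → ℝ}
    (hlip : ∀ n, IsLip V L (h n)) (hB : ∀ n x, |h n x| ≤ 2)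
    (hE : ∀ n : ℕ, ∫ x, h n x ^ 2 ∂μ - ∫ x, avgOp Γ τ (h n) x ^ 2 ∂μ ≤ 4 / ((n + 1 : ℕ) : ℝ)) :
    ∃ c : ℝ, |c| ≤ 2 ∧ ∀ R η : ℝ, 0 < η → ∃ n, ∀ x, V x ≤ R → |h n x - c| ≤ η := by
  have hlim : ∀ x, ∃ c ∈ Set.Icc (-2:ℝ) 2, Tendsto (fun n => h n x) (hyperfilter ℕ : Filter ℕ) (𝓝 c) := by
    intro x
    have := (isCompact_Icc (a := (-2:ℝ)) (b := 2)).ultrafilter_le_nhds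
      ((hyperfilter ℕ).map fun n => h n x) (by
        rw [Ultrafilter.coe_map, le_principal_iff]
        exact Filter.mem_map.2 (Filter.univ_mem' fun n => abs_le.1 (hB n x)))
    exact this
  choose φ hφm hφ using hlim
  have hφ2 : ∀ x, |φ x| ≤ 2 := fun x => abs_le.2 (hφm x)
  have hφl : IsLip V L φ := IsLip.of_tendsto hlip hφ
  have hφc := hφl.continuous hV hτ hL
  have hhc := fun n => (hlip n).continuous hV hτ hL
  have hR := isMarkovOp_avgOp (Γ := Γ) τ
  have hunif := fun (R η : ℝ) (hη : 0 < η) =>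
    tendsto_uniformly_on_compact hV hτ hL hlip hφ (hV.compact R) hη
  have hup : ∀ ε > 0, ∫ x, φ x ^ 2 ∂μ - ∫ x, avgOp Γ τ φ x ^ 2 ∂μ ≤ ε := by
    intro ε hε
    obtain ⟨k, hk, hk1⟩ := (((tendsto_integral_min_height (μ := μ) hV).eventually
      (gt_mem_nhds (show 0 < ε / 128 by positivity))).and (eventually_ge_atTop 1)).exists
    have hbig : ∀ᶠ n : ℕ in (hyperfilter ℕ : Filter ℕ), 4 / ((n + 1 : ℕ) : ℝ) < ε / 2 := by
      apply Nat.hyperfilter_le_atTop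
      exact ((tendsto_add_atTop_iff_nat 1).2 (tendsto_const_div_atTop_nhds_zero_nat 4)).eventually
        (gt_mem_nhds (show 0 < ε / 2 by positivity))
    obtain ⟨n, hn1, hn2⟩ := ((hunif k (ε / 32) (by positivity)).and hbig).exists
    have hk0 : (0:ℝ) < k := by exact_mod_cast hk1
    have hmc : Continuous fun x => min 1 (V x / k) := continuous_const.min (hV.cont.div_const _)
    have hm0 : ∀ x, 0 ≤ min 1 (V x / k) := fun x =>
      le_min zero_le_one (div_nonneg (zero_le_one.trans (hV.one_le x)) hk0.le)
    have hmi : Integrable (fun x => min 1 (V x / k)) μ :=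
      integrable_of_continuous_bdd hmc (B := 1) fun x => by
        rw [abs_of_nonneg (hm0 x)]; exact min_le_left _ _
    have hd : ∫ x, |h n x - φ x| ∂μ ≤ ε / 16 := by
      have h4 : ∀ x, |h n x - φ x| ≤ 4 := fun x => by
        have := abs_sub (h n x) (φ x); linarith [hB n x, hφ2 x]
      have := integral_mono (μ := μ) (f := fun x => |h n x - φ x|)
        (g := fun x => ε / 32 + 4 * min 1 (V x / k))
        (integrable_of_continuous_bdd (B := 4) ((hhc n).sub hφc).abs fun x => by
          rw [abs_abs]; exact h4 x) ((integrable_const _).add (hmi.const_mul 4)) fun x => ?_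
      · rw [integral_add (integrable_const _) (hmi.const_mul 4), integral_const_mul] at this
        simp only [integral_const, probReal_univ, smul_eq_mul, one_mul] at this
        linarith
      · simp only
        rcases le_total (V x) k with h1 | h1
        · linarith [hn1 x h1, hm0 x]
        · rw [min_eq_left ((one_le_div hk0).2 h1)]
          linarith [h4 x]
    have := energy_le_of_close hinv (hhc n) hφc (hB n) hφ2 (hE n) hd
    linarith
  have hlow : ∫ x, avgOp Γ τ φ x ^ 2 ∂μ ≤ ∫ x, φ x ^ 2 ∂μ := by
    have b4 : ∀ x, |φ x ^ 2| ≤ 4 := fun x => by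
      rw [abs_pow]; nlinarith [hφ2 x, abs_nonneg (φ x)]
    have c2 : Continuous fun x => φ x ^ 2 := hφc.pow 2
    rw [← integral_avgOp (τ := τ) hinv c2 b4]
    refine integral_mono (integrable_of_continuous_bdd (B := 4) ((hR.cont hφc).pow 2) fun x => ?_)
      (integrable_of_continuous_bdd (hR.cont c2) (hR.abs_le_const c2 b4))
      fun x => hR.sq_le hφc x
    rw [abs_pow]; nlinarith [hR.abs_le_const hφc hφ2 x, abs_nonneg (avgOp Γ τ φ x)]
  have hEq : ∫ x, avgOp Γ τ φ x ^ 2 ∂μ = ∫ x, φ x ^ 2 ∂μ :=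
    le_antisymm hlow (by
      have := le_of_forall_pos_le_add (a := ∫ x, φ x ^ 2 ∂μ) (b := ∫ x, avgOp Γ τ φ x ^ 2 ∂μ)
        fun ε hε => by linarith [hup ε hε]
      exact this)
  have hconst := eq_of_avgOp_energy_eq hinv hφc hφ2 hEq
  obtain ⟨x₀⟩ : Nonempty (XQuot Γ) := ⟨qmk Γ 1⟩
  refine ⟨φ x₀, hφ2 x₀, fun R η hη => ?_⟩
  obtain ⟨n, hn⟩ := (hunif R η hη).exists
  exact ⟨n, fun x hx => by rw [hconst x₀ x]; exact hn x hx⟩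

theorem exists_contracting_time (hinv : ∀ g : SL2, Measure.map (fun x => rmul Γ x g) μ = μ)
    (hV : IsHeight τ κ b V) (hτ : 10 ≤ τ) (hκ0 : 0 ≤ κ) (hκ1 : κ < 1) (hb : 0 ≤ b)
    {L : ℝ} (hL : 100 ≤ L) (R₀ : ℝ) :
    ∃ N : ℕ, 1 ≤ N ∧ ∀ f : XQuot Γ → ℝ, (∀ x, |f x| ≤ 2) → IsLip V L f → ∀ x y, V x ≤ R₀ → V y ≤ R₀ →
      |(avgOp Γ τ)^[N] f x - (avgOp Γ τ)^[N] f y| ≤ 1 / 4 := by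
  by_contra! hcon
  have hcon' : ∀ N : ℕ, ∃ f : XQuot Γ → ℝ, (∀ x, |f x| ≤ 2) ∧ IsLip V L f ∧ ∃ x y, V x ≤ R₀ ∧ V y ≤ R₀ ∧
      1 / 4 < |(avgOp Γ τ)^[N + 1] f x - (avgOp Γ τ)^[N + 1] f y| := by
    intro N
    obtain ⟨f, h1, h2, x, y, h3, h4, h5⟩ := hcon (N + 1) (by omega)
    exact ⟨f, h1, h2, x, y, h3, h4, h5⟩
  choose f hf2 hfl x y hx hy hgt using hcon'
  have hL0 : 0 ≤ L := by linarith
  have hfc := fun n => (hfl n).continuous hV hτ hL0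
  have hR := isMarkovOp_avgOp (Γ := Γ) τ
  have hn := fun N : ℕ => exists_small_energy (τ := τ) (μ := μ) (hfc N) (hf2 N) (Nat.succ_pos N)
  choose n hnN hnE using hn
  obtain ⟨c, hc2, hc⟩ := exists_const_limit (h := fun N => (avgOp Γ τ)^[n N] (f N)) hinv hV hτ hL0
    (fun N => (hfl N).iterate hV hτ hL (hf2 N) _)
    (fun N => (hR.iterate _).abs_le_const (hfc N) (hf2 N))
    (fun N => by simpa only [Function.iterate_succ_apply'] using hnE N)
  set S : ℝ := |R₀| + b / (1 - κ) + 1 with hS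
  have hb' : 0 ≤ b / (1 - κ) := div_nonneg hb (by linarith)
  have hS0 : 0 < S := by positivity
  obtain ⟨N, hN⟩ := hc (64 * S) (1 / 16) (by norm_num)
  have hcont := ((hR.iterate (n N)).cont (hfc N))
  have hsub : ∀ z, |(avgOp Γ τ)^[n N] (f N) z - c| ≤ 1 / 16 + (1 / (16 * S)) * V z := by
    intro z
    have hVz := hV.one_le z
    rcases le_total (V z) (64 * S) with h1 | h1
    · have : 0 ≤ 1 / (16 * S) * V z := by positivity
      linarith [hN z h1]
    · have h2 : 4 ≤ 1 / (16 * S) * V z := by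
        rw [div_mul_eq_mul_div, one_mul, le_div_iff₀ (by positivity)]; linarith
      have h3 := abs_sub ((avgOp Γ τ)^[n N] (f N) z) c
      have h4 := (hR.iterate (n N)).abs_le_const (hfc N) (hf2 N) z
      linarith
  obtain ⟨m, hm⟩ : ∃ m, N + 1 = m + n N := ⟨N + 1 - n N, by have := hnN N; omega⟩
  have hfin : ∀ z, V z ≤ R₀ → |(avgOp Γ τ)^[N + 1] (f N) z - c| ≤ 1 / 8 := by
    intro z hz
    rw [hm, Function.iterate_add_apply, ← (hR.iterate m).sub_const hcont c z]
    refine ((hR.iterate m).abs_le_affine (hcont.sub continuous_const) hV.cont hsub z).trans ?_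
    have h1 := avgOp_iterate_height_le hV hκ0 hκ1 hb m z
    have h2 : κ ^ m * V z ≤ V z := by
      have := pow_le_one₀ (n := m) hκ0 hκ1.le
      nlinarith [hV.one_le z]
    have h3 : (avgOp Γ τ)^[m] V z ≤ S := by
      have := le_abs_self R₀
      linarith
    have h4 : 1 / (16 * S) * (avgOp Γ τ)^[m] V z ≤ 1 / 16 := by
      rw [div_mul_eq_mul_div, one_mul, div_le_iff₀ (by positivity)]; linarith
    linarith
  have h1 := abs_sub_le ((avgOp Γ τ)^[N + 1] (f N) (x N)) c ((avgOp Γ τ)^[N + 1] (f N) (y N))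
  have h2 := hfin _ (hx N)
  have h3 := hfin _ (hy N)
  rw [abs_sub_comm] at h3
  linarith [hgt N]

end SoftContraction

section Contraction

variable {Γ : Subgroup SL2} {τ κ b : ℝ} {V : XQuot Γ → ℝ}

/-- Functions of controlled oscillation and regularity, relative to a height function. -/
structure IsTame (V : XQuot Γ → ℝ) (L β K : ℝ) (f : XQuot Γ → ℝ) : Prop where
  osc : ∀ x y, |f x - f y| ≤ K * (1 + β * V x + β * V y)
  lip : IsLip V (K * L) f

theorem IsTame.smul {L β K c : ℝ} (hc : 0 ≤ c) {f : XQuot Γ → ℝ} (hf : IsTame V L β K f) :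
    IsTame V L β (c * K) (fun x => c * f x) := by
  have key : ∀ p q d v : ℝ, |p - q| ≤ K * L * d * v → |c * p - c * q| ≤ c * K * L * d * v := by
    intro p q d v h
    rw [← mul_sub, abs_mul, abs_of_nonneg hc]
    calc c * |p - q| ≤ c * (K * L * d * v) := by gcongr
      _ = _ := by ring
  refine ⟨fun x y => ?_, fun x s hs => key _ _ _ _ (hf.lip.n x s hs),
    fun x s hs => key _ _ _ _ (hf.lip.a x s hs), fun x s hs => key _ _ _ _ (hf.lip.l x s hs)⟩
  rw [← mul_sub, abs_mul, abs_of_nonneg hc, mul_assoc]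
  exact mul_le_mul_of_nonneg_left (hf.osc x y) hc

theorem iterate_osc (hV : IsHeight τ κ b V) (hκ0 : 0 ≤ κ) (hκ1 : κ < 1) (hb : 0 ≤ b) {β K : ℝ}
    (hβ : 0 ≤ β) (hK : 0 ≤ K) {f : XQuot Γ → ℝ} (hfc : Continuous f)
    (hf : ∀ x y, |f x - f y| ≤ K * (1 + β * V x + β * V y)) (k : ℕ) (x y : XQuot Γ) :
    |(avgOp Γ τ)^[k] f x - (avgOp Γ τ)^[k] f y| ≤
      K * (1 + β * (κ ^ k * V x + b / (1 - κ)) + β * (κ ^ k * V y + b / (1 - κ))) := by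
  have h := ((isMarkovOp_avgOp (Γ := Γ) τ).iterate k).abs_sub_le hfc hV.cont
    (a := K) (c := K * β) (fun y z => (hf y z).trans_eq (by ring)) x y
  have h1 := avgOp_iterate_height_le hV hκ0 hκ1 hb k x
  have h2 := avgOp_iterate_height_le hV hκ0 hκ1 hb k y
  have h3 := mul_le_mul_of_nonneg_left h1 (mul_nonneg hK hβ)
  have h4 := mul_le_mul_of_nonneg_left h2 (mul_nonneg hK hβ)
  linarith

theorem abs_clamp_sub_le (a c : ℝ) :
    |max (-2) (min 2 a) - max (-2) (min 2 c)| ≤ |a - c| := by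
  have h1 := abs_max_sub_max_le_max (-2) (min 2 a) (-2) (min 2 c)
  have h2 := abs_min_sub_min_le_max 2 a 2 c
  simp only [sub_self, abs_zero, abs_nonneg, max_eq_right] at h1 h2
  exact h1.trans h2

variable {μ : Measure (XQuot Γ)} [IsProbabilityMeasure μ]

theorem exists_contraction_of_unit (hinv : ∀ g : SL2, Measure.map (fun x => rmul Γ x g) μ = μ)
    (hV : IsHeight τ κ b V) (hτ : 10 ≤ τ) (hκ0 : 0 ≤ κ) (hκ1 : κ < 1) (hb : 0 ≤ b) :
    ∃ N : ℕ, 1 ≤ N ∧ ∃ β ρ : ℝ, 0 < β ∧ β ≤ 1 ∧ 2 * β * (b / (1 - κ)) ≤ 1 ∧ 0 < ρ ∧ ρ < 1 ∧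
      ∀ f : XQuot Γ → ℝ, IsTame V 400 β 1 f → IsTame V 400 β ρ ((avgOp Γ τ)^[N] f) := by
  have hκ : 0 < 1 - κ := by linarith
  set b' : ℝ := b / (1 - κ) with hb'
  have hb0 : 0 ≤ b' := div_nonneg hb hκ.le
  set R₀ : ℝ := 8 * b' / (1 - κ) + 1 with hR₀
  have hR0 : 1 ≤ R₀ := by have : 0 ≤ 8 * b' / (1 - κ) := by positivity
                          linarith
  obtain ⟨N, hN1, hN⟩ := exists_contracting_time hinv hV hτ hκ0 hκ1 hb (L := 400) (by norm_num) R₀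
  set β : ℝ := 1 / (8 * (R₀ + b' + 1)) with hβ
  have hβ0 : 0 < β := by positivity
  have hβ8 : 8 * (β * R₀) + 8 * (β * b') + 8 * β = 1 := by rw [hβ]; field_simp
  have hβR : 0 ≤ β * R₀ := by positivity
  have hβb : 0 ≤ β * b' := by positivity
  have hβk : β * (1 - κ) ≤ 1 := by nlinarith
  have hβk0 : 0 < β * (1 - κ) := by positivity
  have hR := isMarkovOp_avgOp (Γ := Γ) τ
  refine ⟨N, hN1, β, 1 - β * (1 - κ) / 4, hβ0, by linarith, by linarith, by linarith, by linarith,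
    fun f hf => ?_⟩
  have hlip : IsLip V 400 f := by simpa using hf.lip
  have hfc : Continuous f := hlip.continuous hV hτ (by norm_num)
  have hosc := iterate_osc hV hκ0 hκ1 hb hβ0.le zero_le_one hfc hf.osc
  rw [← hb'] at hosc
  have hκk : ∀ k : ℕ, ∀ x, κ ^ k * V x ≤ V x := fun k x => by
    have := pow_le_one₀ (n := k) hκ0 hκ1.le
    nlinarith [hV.one_le x]
  constructor
  · intro x y
    have hx := hV.one_le x
    have hy := hV.one_le y
    rcases le_total R₀ (V x + V y) with hS | hS
    · refine (hosc N x y).trans ?_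
      have hκN : κ ^ N ≤ κ := by
        calc κ ^ N ≤ κ ^ 1 := pow_le_pow_of_le_one hκ0 hκ1.le hN1
          _ = κ := pow_one κ
      have h1 : β * (κ ^ N * V x) ≤ β * (κ * V x) := by gcongr
      have h2 : β * (κ ^ N * V y) ≤ β * (κ * V y) := by gcongr
      have h3 : R₀ * (1 - κ) = 8 * b' + (1 - κ) := by rw [hR₀]; field_simp
      have h4 : β * (8 * b' + (1 - κ)) ≤ β * ((V x + V y) * (1 - κ)) := by
        rw [← h3]; gcongr
      have h5 : β * (1 - κ) * (β * (V x + V y)) ≤ 1 * (β * (V x + V y)) := by gcongr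
      have h6 : β * (1 - κ) * (β * (V x + V y)) ≤ 1 * (1 - κ) * (β * (V x + V y)) := by
        gcongr; linarith
      nlinarith
    · have hxR : V x ≤ R₀ := by linarith
      have hyR : V y ≤ R₀ := by linarith
      set g : XQuot Γ → ℝ := fun z => max (-2) (min 2 (f z - f x)) with hg
      have hgc : Continuous g := continuous_const.max (continuous_const.min (hfc.sub continuous_const))
      have hg2 : ∀ z, |g z| ≤ 2 := fun z =>
        abs_le.2 ⟨le_max_left _ _, max_le (by norm_num) (min_le_left _ _)⟩
      have hgl : IsLip V 400 g := by
        have key : ∀ z w, |g z - g w| ≤ |f z - f w| := fun z w =>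
          (abs_clamp_sub_le _ _).trans_eq (by congr 1; ring)
        exact ⟨fun z s hs => (key _ _).trans (hlip.n z s hs), fun z s hs => (key _ _).trans (hlip.a z s hs),
          fun z s hs => (key _ _).trans (hlip.l z s hs)⟩
      have hclose : ∀ z, |f z - f x - g z| ≤ 0 + β * V z := by
        intro z
        have h1 := hf.osc z x
        have h2 : β * V x ≤ β * R₀ := by gcongr
        have h3 : 0 ≤ β * V z := by have := hV.one_le z; positivity
        have h4 : |f z - f x| ≤ 2 + β * V z := by linarith
        have h5 := abs_le.1 h4
        rw [hg, abs_le]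
        simp only
        rcases le_total (f z - f x) 2 with h6 | h6
        · rw [min_eq_right h6]
          rcases le_total (-2) (f z - f x) with h7 | h7
          · rw [max_eq_right h7]; constructor <;> linarith
          · rw [max_eq_left h7]; constructor <;> linarith
        · rw [min_eq_left h6, max_eq_right (by norm_num)]; constructor <;> linarith
      have hMN := hR.iterate N
      have herr : ∀ z, V z ≤ R₀ → |(avgOp Γ τ)^[N] f z - f x - (avgOp Γ τ)^[N] g z| ≤ 1 / 8 := by
        intro z hz
        have h1 := hMN.abs_le_affine (f := fun z => (f z - f x) - g z)
          ((hfc.sub continuous_const).sub hgc) hV.cont hclose z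
        rw [hMN.sub (f := fun z => f z - f x) (hfc.sub continuous_const) hgc,
          hMN.sub_const hfc] at h1
        have h2 := avgOp_iterate_height_le hV hκ0 hκ1 hb N z
        have h3 : β * (avgOp Γ τ)^[N] V z ≤ β * (R₀ + b') := by
          gcongr; linarith [hκk N z]
        linarith
      have h1 := abs_le.1 (herr x hxR)
      have h2 := abs_le.1 (herr y hyR)
      have h3 := abs_le.1 (hN g hg2 hgl x y hxR hyR)
      have h4 : 0 ≤ (1 - β * (1 - κ) / 4) * (β * V x + β * V y) := by
        apply mul_nonneg (by linarith); positivity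
      have h5 : |(avgOp Γ τ)^[N] f x - (avgOp Γ τ)^[N] f y| ≤ 1 / 2 := by
        rw [abs_le]; constructor <;> linarith
      linarith
  · have hstep : ∀ k, IsLip V 400 ((avgOp Γ τ)^[k] f) → IsLip V 200 ((avgOp Γ τ)^[k + 1] f) := by
      intro k hk
      rw [Function.iterate_succ_apply']
      refine (avgOp_isLip hV hτ ((hR.iterate k).cont hfc) (A := 6) (by norm_num) (by norm_num) hk
        fun x g g' hg hg' => (hosc k _ _).trans ?_).mono hV (by norm_num)
      have h1 := hV.growth x g hg
      have h2 := hV.growth x g' hg'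
      have h3 : β * (κ ^ k * V (rmul Γ x g)) ≤ 1 * V (rmul Γ x g) := by
        have := hκk k (rmul Γ x g)
        have := hV.one_le (rmul Γ x g)
        gcongr; linarith
      have h4 : β * (κ ^ k * V (rmul Γ x g')) ≤ 1 * V (rmul Γ x g') := by
        have := hκk k (rmul Γ x g')
        have := hV.one_le (rmul Γ x g')
        gcongr; linarith
      nlinarith [hV.one_le x]
    have hall : ∀ k, IsLip V 400 ((avgOp Γ τ)^[k] f) := by
      intro k
      induction k with
      | zero => exact hlip
      | succ k ih => exact (hstep k ih).mono hV (by norm_num)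
    obtain ⟨k, rfl⟩ : ∃ k, N = k + 1 := ⟨N - 1, by omega⟩
    exact (hstep k (hall k)).mono hV (by linarith)

theorem iterate_smul (k : ℕ) (c : ℝ) {f : XQuot Γ → ℝ} (hf : Continuous f) :
    (avgOp Γ τ)^[k] (fun x => c * f x) = fun x => c * (avgOp Γ τ)^[k] f x :=
  funext fun x => ((isMarkovOp_avgOp τ).iterate k).smul hf c x

theorem tendsto_iterate_integral (hinv : ∀ g : SL2, Measure.map (fun x => rmul Γ x g) μ = μ)
    {f : XQuot Γ → ℝ} (hf : Continuous f) {B : ℝ} (hB : ∀ x, |f x| ≤ B)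
    (h : ∀ x y, Tendsto (fun k : ℕ => (avgOp Γ τ)^[k] f x - (avgOp Γ τ)^[k] f y) atTop (𝓝 0))
    (x : XQuot Γ) : Tendsto (fun k : ℕ => (avgOp Γ τ)^[k] f x) atTop (𝓝 (∫ y, f y ∂μ)) := by
  have hR := isMarkovOp_avgOp (Γ := Γ) τ
  have hc := fun k : ℕ => (hR.iterate k).cont hf
  have hb := fun k : ℕ => (hR.iterate k).abs_le_const hf hB
  have hmean : ∀ k : ℕ, ∫ y, (avgOp Γ τ)^[k] f y ∂μ = ∫ y, f y ∂μ := by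
    intro k
    induction k with
    | zero => rfl
    | succ k ih => rw [Function.iterate_succ_apply', integral_avgOp hinv (hc k) (hb k), ih]
  have h1 : Tendsto (fun k : ℕ => ∫ y, ((avgOp Γ τ)^[k] f x - (avgOp Γ τ)^[k] f y) ∂μ) atTop
      (𝓝 (∫ _y, (0:ℝ) ∂μ)) := by
    refine tendsto_integral_of_dominated_convergence (fun _ => 2 * B)
      (fun k => (continuous_const.sub (hc k)).aestronglyMeasurable) (integrable_const _)
      (fun k => Eventually.of_forall fun y => ?_) (Eventually.of_forall fun y => h x y)
    have := abs_sub ((avgOp Γ τ)^[k] f x) ((avgOp Γ τ)^[k] f y)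
    rw [Real.norm_eq_abs]
    linarith [hb k x, hb k y]
  rw [integral_zero] at h1
  have h2 : ∀ k : ℕ, ∫ y, ((avgOp Γ τ)^[k] f x - (avgOp Γ τ)^[k] f y) ∂μ =
      (avgOp Γ τ)^[k] f x - ∫ y, f y ∂μ := by
    intro k
    rw [integral_sub (integrable_const _) (integrable_of_continuous_bdd (hc k) (hb k)), hmean]
    simp
  simp only [h2] at h1
  simpa using h1.add_const (∫ y, f y ∂μ)

/-- Exponential mixing of the averaging operator. -/
theorem exists_exp_mixing (hinv : ∀ g : SL2, Measure.map (fun x => rmul Γ x g) μ = μ)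
    (hV : IsHeight τ κ b V) (hτ : 10 ≤ τ) (hκ0 : 0 ≤ κ) (hκ1 : κ < 1) (hb : 0 ≤ b) {B L : ℝ}
    (hB : 0 ≤ B) (hL : 0 ≤ L) :
    ∃ C ϱ : ℝ, 0 ≤ C ∧ 0 < ϱ ∧ ϱ < 1 ∧ ∀ f : XQuot Γ → ℝ, (∀ x, |f x| ≤ B) → IsLip V L f →
      ∀ (k : ℕ) x, |(avgOp Γ τ)^[k] f x - ∫ y, f y ∂μ| ≤ C * ϱ ^ k * V x := by
  obtain ⟨N, hN1, β, ρ, hβ0, hβ1, hβb, hρ0, hρ1, hcon⟩ :=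
    exists_contraction_of_unit hinv hV hτ hκ0 hκ1 hb
  have hR := isMarkovOp_avgOp (Γ := Γ) τ
  have hN0 : N ≠ 0 := by omega
  set b' : ℝ := b / (1 - κ) with hb'
  have hb0 : 0 ≤ b' := div_nonneg hb (by linarith)
  set ϱ : ℝ := ρ ^ ((N:ℝ)⁻¹) with hϱ
  have hϱ0 : 0 < ϱ := Real.rpow_pos_of_pos hρ0 _
  have hϱ1 : ϱ < 1 := Real.rpow_lt_one hρ0.le hρ1 (by positivity)
  have hϱN : ϱ ^ N = ρ := Real.rpow_inv_natCast_pow hρ0.le hN0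
  set K : ℝ := 2 * B + L / 400 + 1 with hK
  have hK0 : 0 < K := by positivity
  have hpow : ∀ k : ℕ, ρ ^ (k / N) ≤ ρ⁻¹ * ϱ ^ k := by
    intro k
    have h1 : ϱ ^ k = ρ ^ (k / N) * ϱ ^ (k % N) := by
      rw [← hϱN, ← pow_mul, ← pow_add, Nat.div_add_mod]
    have h2 : ρ ≤ ϱ ^ (k % N) := by
      rw [← hϱN]
      exact pow_le_pow_of_le_one hϱ0.le hϱ1.le (Nat.mod_lt _ (by omega)).le
    rw [h1, inv_mul_eq_div, le_div_iff₀ hρ0]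
    gcongr
  refine ⟨K * (4 + b') * ρ⁻¹, ϱ, by positivity, hϱ0, hϱ1, fun f hfB hfL => ?_⟩
  have hfc : Continuous f := hfL.continuous hV hτ hL
  have hiter : ∀ j : ℕ, IsTame V 400 β (K * ρ ^ j) ((avgOp Γ τ)^[N * j] f) := by
    intro j
    induction j with
    | zero =>
      refine ⟨fun x y => ?_, hfL.mono hV ?_⟩
      · have h1 := abs_sub (f x) (f y)
        have h2 : 0 ≤ K * (β * V x + β * V y) := by
          have := hV.one_le x
          have := hV.one_le y
          positivity
        simp only [mul_zero, Function.iterate_zero, id_eq, pow_zero, mul_one]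
        have : 0 ≤ L / 400 := by positivity
        linarith [hfB x, hfB y]
      · simp only [pow_zero]; linarith
    | succ j ih =>
      have hc := (hR.iterate (N * j)).cont hfc
      have hpos : 0 < K * ρ ^ j := by positivity
      have h1 := ih.smul (inv_nonneg.2 hpos.le)
      rw [inv_mul_cancel₀ hpos.ne'] at h1
      have h2 := (hcon _ h1).smul hpos.le
      rw [iterate_smul N _ hc] at h2
      convert h2 using 1
      · ring
      · funext x
        rw [mul_inv_cancel_left₀ hpos.ne', mul_add, mul_one, add_comm, Function.iterate_add_apply]
  have hκk : ∀ k : ℕ, ∀ x, κ ^ k * V x ≤ V x := fun k x => by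
    have := pow_le_one₀ (n := k) hκ0 hκ1.le
    nlinarith [hV.one_le x]
  have hosc : ∀ (k : ℕ) x y, |(avgOp Γ τ)^[k] f x - (avgOp Γ τ)^[k] f y| ≤
      K * ρ ^ (k / N) * (2 + V x) + K * ρ ^ (k / N) * V y := by
    intro k x y
    have h := iterate_osc hV hκ0 hκ1 hb hβ0.le (by positivity)
      ((hR.iterate (N * (k / N))).cont hfc) (hiter (k / N)).osc (k % N) x y
    rw [← Function.iterate_add_apply, Nat.mod_add_div] at h
    refine h.trans ?_
    rw [← mul_add]
    refine mul_le_mul_of_nonneg_left ?_ (by positivity)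
    have h1 : β * (κ ^ (k % N) * V x) ≤ 1 * V x := by
      have := hV.one_le x
      gcongr; exact hκk _ x
    have h2 : β * (κ ^ (k % N) * V y) ≤ 1 * V y := by
      have := hV.one_le y
      gcongr; exact hκk _ y
    rw [← hb']
    linarith
  have hρt : Tendsto (fun k : ℕ => ρ⁻¹ * ϱ ^ k) atTop (𝓝 0) := by
    simpa using (tendsto_pow_atTop_nhds_zero_of_lt_one hϱ0.le hϱ1).const_mul ρ⁻¹
  have hlim := tendsto_iterate_integral hinv hfc hfB (τ := τ) fun x y => by
    have h1 : Tendsto (fun k : ℕ => ρ⁻¹ * ϱ ^ k * (K * (2 + V x + V y))) atTop (𝓝 0) := by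
      simpa using hρt.mul_const (K * (2 + V x + V y))
    refine squeeze_zero_norm (fun k => ?_) h1
    rw [Real.norm_eq_abs]
    refine (hosc k x y).trans ?_
    have h3 : 0 ≤ K * (2 + V x + V y) := by
      have := hV.one_le x
      have := hV.one_le y
      positivity
    calc _ = ρ ^ (k / N) * (K * (2 + V x + V y)) := by ring
      _ ≤ _ := mul_le_mul_of_nonneg_right (hpow k) h3
  intro k x
  have hcauchy : ∀ l : ℕ, |(avgOp Γ τ)^[k] f x - (avgOp Γ τ)^[l + k] f x| ≤
      K * (4 + b') * ρ⁻¹ * ϱ ^ k * V x := by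
    intro l
    have hc := (hR.iterate k).cont hfc
    rw [abs_sub_comm, Function.iterate_add_apply, ← (hR.iterate l).sub_const hc]
    refine ((hR.iterate l).abs_le_affine
      (f := fun y => (avgOp Γ τ)^[k] f y - (avgOp Γ τ)^[k] f x) (hc.sub continuous_const) hV.cont
      (fun y => by rw [abs_sub_comm]; exact hosc k x y) x).trans ?_
    have h1 := avgOp_iterate_height_le hV hκ0 hκ1 hb l x
    have h2 := hκk l x
    have hx := hV.one_le x
    calc K * ρ ^ (k / N) * (2 + V x) + K * ρ ^ (k / N) * (avgOp Γ τ)^[l] V x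
        ≤ K * ρ ^ (k / N) * (2 * V x + V x) + K * ρ ^ (k / N) * (V x + b' * V x) := by
          gcongr
          · linarith
          · nlinarith
      _ = ρ ^ (k / N) * (K * (4 + b') * V x) := by ring
      _ ≤ ρ⁻¹ * ϱ ^ k * (K * (4 + b') * V x) :=
          mul_le_mul_of_nonneg_right (hpow k) (by positivity)
      _ = _ := by ring
  have h1 : Tendsto (fun l : ℕ => |(avgOp Γ τ)^[k] f x - (avgOp Γ τ)^[l + k] f x|) atTop
      (𝓝 |(avgOp Γ τ)^[k] f x - ∫ y, f y ∂μ|) :=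
    (tendsto_const_nhds.sub ((tendsto_add_atTop_iff_nat k).2 (hlim x))).abs
  exact le_of_tendsto' h1 hcauchy

end Contraction

/-! ### Displacement of the identity -/

/-- distance of `g` to the identity matrix -/
def dsp (g : SL2) : ℝ := nrm (g.1 - 1)

theorem dsp_nonneg (g : SL2) : 0 ≤ dsp g := nrm_nonneg _

theorem dsp_one : dsp 1 = 0 := by simp [dsp, nrm]

theorem eq_one_of_dsp_eq_zero {g : SL2} (h : dsp g = 0) : g = 1 :=
  Subtype.ext (sub_eq_zero.1 (nrm_eq_zero h))

theorem continuous_dsp : Continuous dsp := by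
  unfold dsp nrm
  simp only [Matrix.sub_apply]
  have := continuous_entry
  have h : ∀ i j, Continuous fun g : SL2 => |g.1 i j - (1 : Matrix (Fin 2) (Fin 2) ℝ) i j| :=
    fun i j => ((continuous_entry i j).sub continuous_const).abs
  exact (((h 0 0).add (h 0 1)).add (h 1 0)).add (h 1 1)

theorem nrm_le_two_add_dsp (g : SL2) : nrm g.1 ≤ 2 + dsp g := by
  have h := nrm_add_le 1 (g.1 - 1)
  have h1 : nrm (1 : Matrix (Fin 2) (Fin 2) ℝ) = 2 := by simp [nrm]; norm_num
  rw [add_sub_cancel, h1] at h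
  exact h

theorem conj_sub_one (b h : SL2) : (b⁻¹ * h * b).1 - 1 = (b⁻¹).1 * (h.1 - 1) * b.1 := by
  have h1 : (b⁻¹).1 * b.1 = 1 := congrArg Subtype.val (inv_mul_cancel b)
  rw [mul_sub, sub_mul, mul_one, h1]
  rfl

theorem dsp_conj_le (b h : SL2) : dsp (b⁻¹ * h * b) ≤ nrm b.1 ^ 2 * dsp h := by
  unfold dsp
  rw [conj_sub_one]
  refine (nrm_mul_le _ _).trans ?_
  have h1 := nrm_mul_le (b⁻¹).1 (h.1 - 1)
  rw [nrm_inv] at h1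
  nlinarith [nrm_nonneg b.1]

theorem dsp_conj_le' (b h : SL2) : dsp (b⁻¹ * h * b) ≤ (1 + 2 * nrm b.1 * dsp b) * dsp h := by
  unfold dsp
  set Y := h.1 - 1 with hY
  have h1 : (b⁻¹ * h * b).1 - 1 = Y + (b⁻¹).1 * (Y * (b.1 - 1) - (b.1 - 1) * Y) := by
    have h1 : (b⁻¹).1 * b.1 = 1 := congrArg Subtype.val (inv_mul_cancel b)
    have h2 : ∀ P Q Z : Matrix (Fin 2) (Fin 2) ℝ, P * Q = 1 →
        P * Z * Q = Z + P * (Z * (Q - 1) - (Q - 1) * Z) := by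
      intro P Q Z hPQ
      have h3 : P * (Z * (Q - 1) - (Q - 1) * Z) = P * Z * Q - P * Q * Z := by noncomm_ring
      rw [h3, hPQ, one_mul]; abel
    rw [conj_sub_one]
    exact h2 _ _ _ h1
  rw [h1]
  refine (nrm_add_le _ _).trans ?_
  have h2 := nrm_mul_le (b⁻¹).1 (Y * (b.1 - 1) - (b.1 - 1) * Y)
  rw [nrm_inv] at h2
  have h3 := nrm_sub_le (Y * (b.1 - 1)) ((b.1 - 1) * Y)
  have h4 := nrm_mul_le Y (b.1 - 1)
  have h5 := nrm_mul_le (b.1 - 1) Y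
  nlinarith [mul_le_mul_of_nonneg_left (show nrm (Y * (b.1 - 1) - (b.1 - 1) * Y) ≤
    2 * (nrm (b.1 - 1) * nrm Y) by linarith) (nrm_nonneg b.1)]

theorem isCompact_dsp_le (R : ℝ) : IsCompact {g : SL2 | dsp g ≤ R} := by
  have hK : IsCompact (Set.univ.pi fun _ : Fin 2 => Set.univ.pi fun _ : Fin 2 =>
      Set.Icc (-(2 + R)) (2 + R)) := isCompact_univ_pi fun _ => isCompact_univ_pi fun _ => isCompact_Icc
  refine (isClosedEmbedding_entries.isCompact_preimage hK).of_isClosed_subset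
    (isClosed_le continuous_dsp continuous_const) fun g hg => ?_
  have h1 := nrm_le_two_add_dsp g
  have h2 : nrm g.1 ≤ 2 + R := by have : dsp g ≤ R := hg
                                  linarith
  unfold nrm at h2
  have h00 := abs_nonneg (g.1 0 0)
  have h01 := abs_nonneg (g.1 0 1)
  have h10 := abs_nonneg (g.1 1 0)
  have h11 := abs_nonneg (g.1 1 1)
  rw [Set.mem_preimage, Set.mem_univ_pi]
  intro i
  rw [Set.mem_univ_pi]
  intro j
  refine abs_le.1 ?_
  fin_cases i <;> fin_cases j <;> simp only [Fin.zero_eta, Fin.mk_one, Fin.isValue] <;> linarith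

theorem finite_dsp_le (Γ : Subgroup SL2) [DiscreteTopology Γ] (g : SL2) (R : ℝ) :
    {γ : SL2 | γ ∈ Γ ∧ dsp (g⁻¹ * γ * g) ≤ R}.Finite := by
  have hc : IsClosed (Γ : Set SL2) := Subgroup.isClosed_of_discrete
  have hK : IsCompact {γ : SL2 | dsp (g⁻¹ * γ * g) ≤ R} := by
    have h := (isCompact_dsp_le R).image
      (show Continuous fun h : SL2 => g * h * g⁻¹ by fun_prop)
    convert h using 1
    ext γ
    simp only [Set.mem_ofPred_eq, Set.mem_image]
    constructor
    · intro h; exact ⟨_, h, by group⟩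
    · rintro ⟨h, hh, rfl⟩
      convert hh using 2
      group
  have hd : IsDiscrete (Γ : Set SL2) := ⟨‹_›⟩
  exact ((hK.inter_left hc).finite (hd.mono Set.inter_subset_left)).subset fun γ h => ⟨h.1, h.2⟩

/-! ### Traceless parts -/

/-- size of the traceless part of a matrix -/
def wgt (A : Matrix (Fin 2) (Fin 2) ℝ) : ℝ := |A 0 1| + |A 1 0| + |A 0 0 - A 1 1|

theorem wgt_nonneg (A : Matrix (Fin 2) (Fin 2) ℝ) : 0 ≤ wgt A := by
  unfold wgt; positivity

theorem wgt_smul_add (c d : ℝ) (A : Matrix (Fin 2) (Fin 2) ℝ) :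
    wgt (c • A + d • 1) = |c| * wgt A := by
  simp only [wgt, Matrix.add_apply, Matrix.smul_apply, smul_eq_mul, Matrix.one_apply_eq, mul_one,
    Matrix.one_apply_ne (show (0 : Fin 2) ≠ 1 by decide),
    Matrix.one_apply_ne (show (1 : Fin 2) ≠ 0 by decide), mul_zero, add_zero, add_sub_add_right_eq_sub,
    ← mul_sub, abs_mul]
  ring

theorem wgt_le_dsp (g : SL2) : wgt g.1 ≤ dsp g := by
  unfold wgt dsp nrm
  simp only [Matrix.sub_apply, Matrix.one_apply_eq,
    Matrix.one_apply_ne (show (0 : Fin 2) ≠ 1 by decide),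
    Matrix.one_apply_ne (show (1 : Fin 2) ≠ 0 by decide), sub_zero]
  have := abs_sub (g.1 0 0 - 1) (g.1 1 1 - 1)
  rw [sub_sub_sub_cancel_right] at this
  linarith

theorem dsp_le_wgt_add_sq (g : SL2) : dsp g ≤ wgt g.1 + dsp g ^ 2 := by
  have hdet := SL2_det g
  unfold wgt dsp nrm
  simp only [Matrix.sub_apply, Matrix.one_apply_eq,
    Matrix.one_apply_ne (show (0 : Fin 2) ≠ 1 by decide),
    Matrix.one_apply_ne (show (1 : Fin 2) ≠ 0 by decide), sub_zero]
  set a := g.1 0 0 - 1 with ha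
  set d := g.1 1 1 - 1 with hd
  set p := g.1 0 1
  set q := g.1 1 0
  have e1 : g.1 0 0 - g.1 1 1 = a - d := by rw [ha, hd]; ring
  have e2 : a + d = p * q - a * d := by rw [ha, hd]; linarith
  rw [e1]
  have h1 : |a + d| ≤ |p| * |q| + |a| * |d| := by
    rw [e2, ← abs_mul, ← abs_mul]; exact abs_sub _ _
  have h2 : |a| + |d| ≤ |a + d| + |a - d| := by
    have h3 := abs_add_le (a + d) (a - d)
    have h4 := abs_sub (a + d) (a - d)
    rw [show a + d + (a - d) = 2 * a by ring, abs_mul, abs_two] at h3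
    rw [show a + d - (a - d) = 2 * d by ring, abs_mul, abs_two] at h4
    linarith
  nlinarith [abs_nonneg a, abs_nonneg d, abs_nonneg p, abs_nonneg q,
    mul_nonneg (abs_nonneg a) (abs_nonneg d), mul_nonneg (abs_nonneg p) (abs_nonneg q),
    sq_nonneg (|a| + |d| + |p| + |q|), mul_nonneg (abs_nonneg a) (abs_nonneg p),
    mul_nonneg (abs_nonneg a) (abs_nonneg q), mul_nonneg (abs_nonneg d) (abs_nonneg p),
    mul_nonneg (abs_nonneg d) (abs_nonneg q), sq_nonneg (|a|), sq_nonneg (|d|), sq_nonneg (|p|),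
    sq_nonneg (|q|)]

theorem exists_affine_of_commute {A B : SL2} (h : A * B = B * A) (hA : wgt A.1 ≠ 0) :
    ∃ c d : ℝ, B.1 = c • A.1 + d • 1 := by
  have e00 : (A * B).1 0 0 = (B * A).1 0 0 := by rw [h]
  have e01 : (A * B).1 0 1 = (B * A).1 0 1 := by rw [h]
  have e10 : (A * B).1 1 0 = (B * A).1 1 0 := by rw [h]
  simp only [SL2_mul_apply] at e00 e01 e10
  have key : ∀ c : ℝ, B.1 0 1 = c * A.1 0 1 → B.1 1 0 = c * A.1 1 0 →
      B.1 0 0 - B.1 1 1 = c * (A.1 0 0 - A.1 1 1) → ∃ c d : ℝ, B.1 = c • A.1 + d • 1 := by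
    intro c h1 h2 h3
    refine ⟨c, B.1 0 0 - c * A.1 0 0, ?_⟩
    ext i j
    fin_cases i <;> fin_cases j <;>
      simp only [Fin.zero_eta, Fin.mk_one, Fin.isValue, Matrix.add_apply, Matrix.smul_apply,
        smul_eq_mul, Matrix.one_apply_eq, Matrix.one_apply_ne (show (0 : Fin 2) ≠ 1 by decide),
        Matrix.one_apply_ne (show (1 : Fin 2) ≠ 0 by decide)] <;> linarith
  by_cases h01 : A.1 0 1 = 0
  · by_cases h10 : A.1 1 0 = 0
    · have h3 : A.1 0 0 - A.1 1 1 ≠ 0 := by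
        intro h3; apply hA; simp [wgt, h01, h10, h3]
      refine key ((B.1 0 0 - B.1 1 1) / (A.1 0 0 - A.1 1 1)) ?_ ?_ (div_mul_cancel₀ _ h3).symm
      · rw [h01, mul_zero]
        refine mul_left_cancel₀ h3 ?_
        rw [h01] at e01; linarith
      · rw [h10, mul_zero]
        refine mul_left_cancel₀ h3 ?_
        rw [h10] at e10; linarith
    · refine key (B.1 1 0 / A.1 1 0) ?_ (div_mul_cancel₀ _ h10).symm ?_
      · rw [div_mul_eq_mul_div, eq_div_iff h10]; linarith
      · rw [div_mul_eq_mul_div, eq_div_iff h10]; linarith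
  · refine key (B.1 0 1 / A.1 0 1) (div_mul_cancel₀ _ h01).symm ?_ ?_
    · rw [div_mul_eq_mul_div, eq_div_iff h01]; linarith
    · rw [div_mul_eq_mul_div, eq_div_iff h01]; linarith

theorem conj_affine {A B : SL2} {c d : ℝ} (h : B.1 = c • A.1 + d • 1) (b : SL2) :
    (b⁻¹ * B * b).1 = c • (b⁻¹ * A * b).1 + d • 1 := by
  have h1 : (b⁻¹).1 * b.1 = 1 := congrArg Subtype.val (inv_mul_cancel b)
  change (b⁻¹).1 * B.1 * b.1 = c • ((b⁻¹).1 * A.1 * b.1) + d • 1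
  rw [h, mul_add, add_mul, mul_smul_comm, smul_mul_assoc, mul_smul_comm, smul_mul_assoc, mul_one, h1]

/-! ### The displacement function of a discrete subgroup -/

open Classical in
/-- truncated displacement of `g` under a group element; the identity is ignored -/
def injTerm (g γ : SL2) : ℝ := if γ = 1 then 1 else min 1 (dsp (g⁻¹ * γ * g))

/-- the smallest displacement of `g` under nontrivial elements of `Γ`, truncated at `1` -/
def inj (Γ : Subgroup SL2) (g : SL2) : ℝ := ⨅ γ : Γ, injTerm g γ

theorem injTerm_nonneg (g γ : SL2) : 0 ≤ injTerm g γ := by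
  unfold injTerm
  split_ifs
  · exact zero_le_one
  · exact le_min zero_le_one (dsp_nonneg _)

theorem injTerm_one (g : SL2) : injTerm g 1 = 1 := if_pos rfl

theorem injTerm_le_mul {b : SL2} {C : ℝ} (hC1 : 1 ≤ C)
    (hC : ∀ h, dsp (b⁻¹ * h * b) ≤ C * dsp h) (g γ : SL2) :
    injTerm (g * b) γ ≤ C * injTerm g γ := by
  unfold injTerm
  split_ifs
  · linarith
  · rw [mul_min_of_nonneg _ _ (by linarith), mul_one]
    refine min_le_min hC1 ?_
    have := hC (g⁻¹ * γ * g)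
    rwa [show (g * b)⁻¹ * γ * (g * b) = b⁻¹ * (g⁻¹ * γ * g) * b by group]

section

variable (Γ : Subgroup SL2)

theorem bddBelow_injTerm (g : SL2) : BddBelow (Set.range fun γ : Γ => injTerm g γ) :=
  ⟨0, by rintro _ ⟨γ, rfl⟩; exact injTerm_nonneg _ _⟩

theorem inj_nonneg (g : SL2) : 0 ≤ inj Γ g := le_ciInf fun _ => injTerm_nonneg _ _

theorem inj_le_one (g : SL2) : inj Γ g ≤ 1 :=
  (ciInf_le (bddBelow_injTerm Γ g) 1).trans_eq (injTerm_one g)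

theorem inj_le_dsp (g : SL2) {γ : SL2} (hγ : γ ∈ Γ) (h1 : γ ≠ 1) : inj Γ g ≤ dsp (g⁻¹ * γ * g) := by
  refine (ciInf_le (bddBelow_injTerm Γ g) ⟨γ, hγ⟩).trans ?_
  simp only [injTerm, if_neg h1]
  exact min_le_right _ _

theorem inj_mul_left {γ : SL2} (hγ : γ ∈ Γ) (g : SL2) : inj Γ (γ * g) = inj Γ g := by
  have key : ∀ γ ∈ Γ, ∀ g, inj Γ g ≤ inj Γ (γ * g) := by
    intro γ hγ g
    refine le_ciInf fun γ' => ?_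
    have hm : γ⁻¹ * γ' * γ ∈ Γ := Γ.mul_mem (Γ.mul_mem (Γ.inv_mem hγ) γ'.2) hγ
    refine (ciInf_le (bddBelow_injTerm Γ g) ⟨_, hm⟩).trans_eq ?_
    unfold injTerm
    have h1 : γ⁻¹ * γ' * γ = 1 ↔ (γ' : SL2) = 1 := by
      constructor
      · intro h
        have : (γ' : SL2) = γ * (γ⁻¹ * γ' * γ) * γ⁻¹ := by group
        rw [this, h]; group
      · intro h; rw [h]; group
    simp only [h1, show (γ * g)⁻¹ * γ' * (γ * g) = g⁻¹ * (γ⁻¹ * γ' * γ) * g by group]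
  refine le_antisymm ?_ (key γ hγ g)
  have := key γ⁻¹ (Γ.inv_mem hγ) (γ * g)
  rwa [inv_mul_cancel_left] at this

theorem inj_mul_le {b : SL2} {C : ℝ} (hC1 : 1 ≤ C)
    (hC : ∀ h, dsp (b⁻¹ * h * b) ≤ C * dsp h) (g : SL2) : inj Γ (g * b) ≤ C * inj Γ g := by
  have hC0 : 0 < C := by linarith
  rw [← div_le_iff₀' hC0]
  refine le_ciInf fun γ => ?_
  rw [div_le_iff₀' hC0]
  exact (ciInf_le (bddBelow_injTerm Γ _) γ).trans (injTerm_le_mul hC1 hC g γ)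

theorem inj_mul_le_sq (g b : SL2) : inj Γ (g * b) ≤ nrm b.1 ^ 2 * inj Γ g :=
  inj_mul_le Γ (one_le_pow₀ (one_le_nrm b)) (dsp_conj_le b) g

theorem inj_le_sq_mul (g b : SL2) : inj Γ g ≤ nrm b.1 ^ 2 * inj Γ (g * b) := by
  have := inj_mul_le_sq Γ (g * b) b⁻¹
  rwa [mul_inv_cancel_right, nrm_inv] at this

theorem continuous_inj : Continuous (inj Γ) := by
  set c : SL2 → ℝ := fun b => 1 + 2 * nrm b.1 * dsp b with hc
  have hcc : Continuous c :=
    continuous_const.add ((continuous_const.mul continuous_nrm).mul continuous_dsp)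
  have hc1 : ∀ b, 1 ≤ c b := fun b => by
    have := nrm_nonneg b.1
    have := dsp_nonneg b
    simp only [hc]
    have : 0 ≤ 2 * nrm b.1 * dsp b := by positivity
    linarith
  have hle : ∀ g b, inj Γ (g * b) ≤ c b * inj Γ g := fun g b =>
    inj_mul_le Γ (hc1 b) (dsp_conj_le' b) g
  rw [continuous_iff_continuousAt]
  intro g
  have hup : Tendsto (fun h => c (g⁻¹ * h) * inj Γ g) (𝓝 g) (𝓝 (inj Γ g)) := by
    have : Continuous fun h => c (g⁻¹ * h) * inj Γ g :=
      (hcc.comp (continuous_const.mul continuous_id)).mul continuous_const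
    have h2 := this.tendsto g
    simpa [hc, dsp_one] using h2
  have hlo : Tendsto (fun h => inj Γ g / c (h⁻¹ * g)) (𝓝 g) (𝓝 (inj Γ g)) := by
    have : Continuous fun h => inj Γ g / c (h⁻¹ * g) :=
      continuous_const.div (hcc.comp (continuous_inv.mul continuous_const))
        fun h => (zero_lt_one.trans_le (hc1 _)).ne'
    have h2 := this.tendsto g
    simpa [hc, dsp_one] using h2
  refine tendsto_of_tendsto_of_tendsto_of_le_of_le hlo hup (fun h => ?_) fun h => ?_
  · simp only
    rw [div_le_iff₀' (zero_lt_one.trans_le (hc1 _))]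
    have := hle h (h⁻¹ * g)
    rwa [mul_inv_cancel_left] at this
  · have := hle g (g⁻¹ * h)
    rwa [mul_inv_cancel_left] at this

variable [DiscreteTopology Γ]

theorem exists_minimizer {g : SL2} (hg : inj Γ g < 1) :
    ∃ γ ∈ Γ, γ ≠ 1 ∧ dsp (g⁻¹ * γ * g) = inj Γ g := by
  obtain ⟨⟨γ₁, hγ₁⟩, h1⟩ := exists_lt_of_ciInf_lt hg
  have h2 : γ₁ ≠ 1 := by
    rintro rfl
    simp [injTerm_one] at h1
  simp only [injTerm, if_neg h2] at h1
  have h3 : dsp (g⁻¹ * γ₁ * g) ≤ 1 := by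
    by_contra! h
    rw [min_eq_left h.le] at h1
    exact lt_irrefl _ h1
  have hfin : {γ : SL2 | (γ ∈ Γ ∧ dsp (g⁻¹ * γ * g) ≤ 1) ∧ γ ≠ 1}.Finite :=
    (finite_dsp_le Γ g 1).subset fun γ h => h.1
  obtain ⟨γ, ⟨⟨hγ, hγ1⟩, hne⟩, hmin⟩ := Set.exists_min_image _ (fun γ => dsp (g⁻¹ * γ * g)) hfin
    ⟨γ₁, ⟨hγ₁, h3⟩, h2⟩
  refine ⟨γ, hγ, hne, le_antisymm (le_ciInf fun γ' => ?_) (inj_le_dsp Γ g hγ hne)⟩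
  unfold injTerm
  split_ifs with h
  · exact hγ1
  · refine le_min hγ1 ?_
    rcases le_total (dsp (g⁻¹ * γ' * g)) 1 with h4 | h4
    · exact hmin _ ⟨⟨γ'.2, h4⟩, h⟩
    · exact hγ1.trans h4

theorem inj_pos (g : SL2) : 0 < inj Γ g := by
  by_contra! h
  have h0 := le_antisymm h (inj_nonneg Γ g)
  obtain ⟨γ, _, hne, hd⟩ := exists_minimizer Γ (g := g) (by rw [h0]; exact zero_lt_one)
  rw [h0] at hd
  apply hne
  have := eq_one_of_dsp_eq_zero hd
  calc γ = g * (g⁻¹ * γ * g) * g⁻¹ := by group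
    _ = 1 := by rw [this]; group

/-- An element of smallest displacement commutes with all elements of small displacement. -/
theorem commute_of_minimizer {g γ γ' : SL2} (hγ : γ ∈ Γ) (hγ' : γ' ∈ Γ) (hg : inj Γ g < 1)
    (h : dsp (g⁻¹ * γ * g) = inj Γ g) (h' : dsp (g⁻¹ * γ' * g) < 1 / 18) : γ' * γ = γ * γ' := by
  by_contra hne
  have hne1 : γ' * γ * γ'⁻¹ * γ⁻¹ ≠ 1 := by
    intro h1
    apply hne
    calc γ' * γ = (γ' * γ * γ'⁻¹ * γ⁻¹) * (γ * γ') := by group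
      _ = _ := by rw [h1, one_mul]
  have hmem : γ' * γ * γ'⁻¹ * γ⁻¹ ∈ Γ :=
    Γ.mul_mem (Γ.mul_mem (Γ.mul_mem hγ' hγ) (Γ.inv_mem hγ')) (Γ.inv_mem hγ)
  have h1 := inj_le_dsp Γ g hmem hne1
  set A := g⁻¹ * γ' * g with hA
  set B := g⁻¹ * γ * g with hB
  have h2 : g⁻¹ * (γ' * γ * γ'⁻¹ * γ⁻¹) * g = A * B * (A⁻¹ * B⁻¹) := by
    rw [hA, hB]; group
  rw [h2] at h1
  have h3 : (A * B * (A⁻¹ * B⁻¹)).1 - 1 =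
      ((A.1 - 1) * (B.1 - 1) - (B.1 - 1) * (A.1 - 1)) * ((A⁻¹).1 * (B⁻¹).1) := by
    have h4 : (B * A * (A⁻¹ * B⁻¹)) = 1 := by group
    have h5 : (A.1 - 1) * (B.1 - 1) - (B.1 - 1) * (A.1 - 1) = (A * B).1 - (B * A).1 := by
      change _ = A.1 * B.1 - B.1 * A.1
      noncomm_ring
    rw [h5, sub_mul]
    change _ = (A * B * (A⁻¹ * B⁻¹)).1 - (B * A * (A⁻¹ * B⁻¹)).1
    rw [h4]; rfl
  unfold dsp at h1
  rw [h3] at h1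
  have n1 := nrm_mul_le ((A.1 - 1) * (B.1 - 1) - (B.1 - 1) * (A.1 - 1)) ((A⁻¹).1 * (B⁻¹).1)
  have n2 := nrm_mul_le (A⁻¹).1 (B⁻¹).1
  have n3 := nrm_sub_le ((A.1 - 1) * (B.1 - 1)) ((B.1 - 1) * (A.1 - 1))
  have n4 := nrm_mul_le (A.1 - 1) (B.1 - 1)
  have n5 := nrm_mul_le (B.1 - 1) (A.1 - 1)
  rw [nrm_inv, nrm_inv] at n2
  have a1 := nrm_le_two_add_dsp A
  have b1 := nrm_le_two_add_dsp B
  have hd : nrm (A.1 - 1) = dsp A := rfl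
  have hd' : nrm (B.1 - 1) = dsp B := rfl
  rw [hd, hd'] at n4 n5
  have hA0 := dsp_nonneg A
  have hB0 : 0 < dsp B := by rw [h]; exact inj_pos Γ g
  have m1 : nrm A.1 * nrm B.1 ≤ (2 + 1 / 18) * 3 :=
    mul_le_mul (by linarith) (by linarith) (nrm_nonneg _) (by norm_num)
  have m2 : nrm ((A.1 - 1) * (B.1 - 1) - (B.1 - 1) * (A.1 - 1)) ≤ 2 * (dsp A * dsp B) := by linarith
  have m3 := mul_le_mul m2 (n2.trans m1) (nrm_nonneg _) (by positivity)
  have m4 : dsp A * dsp B ≤ 1 / 18 * dsp B := mul_le_mul_of_nonneg_right h'.le hB0.le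
  linarith

end

/-! ### The height function on the quotient -/

/-- the smallest displacement as a function on the quotient -/
def injQ (Γ : Subgroup SL2) : XQuot Γ → ℝ :=
  Quotient.lift (inj Γ) fun g h hgh => by
    have hm : h * g⁻¹ ∈ Γ := QuotientGroup.rightRel_apply.1 hgh
    have := inj_mul_left Γ hm g
    rwa [inv_mul_cancel_right, eq_comm] at this

section

variable (Γ : Subgroup SL2)

theorem injQ_qmk (g : SL2) : injQ Γ (qmk Γ g) = inj Γ g := rfl

theorem continuous_injQ : Continuous (injQ Γ) :=
  (isOpenQuotientMap_qmk Γ).isQuotientMap.continuous_iff.2 (continuous_inj Γ)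

theorem injQ_le_one (x : XQuot Γ) : injQ Γ x ≤ 1 := by
  obtain ⟨g, rfl⟩ := qmk_surjective Γ x
  exact inj_le_one Γ g

variable {Γ} in
/-- Mahler's criterion: the part of a finite volume quotient where the displacement is bounded
below is compact. -/
theorem isCompact_le_injQ (hlat : IsLatticeSL2 Γ) {ε : ℝ} (hε : 0 < ε) :
    IsCompact {x | ε ≤ injQ Γ x} := by
  obtain ⟨hdisc, ν, hν, F, hF, hFtop⟩ := hlat
  have hclosed : IsClosed {x | ε ≤ injQ Γ x} := isClosed_le continuous_const (continuous_injQ Γ)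
  set K : Set SL2 := {h | dsp h ≤ 1} with hK
  have hKc : IsCompact K := isCompact_dsp_le 1
  suffices hfin : ∃ s : Finset SL2, {x | ε ≤ injQ Γ x} ⊆ ⋃ g ∈ s, qmk Γ '' ((fun h => g * h) '' K) by
    obtain ⟨s, hs⟩ := hfin
    refine IsCompact.of_isClosed_subset ?_ hclosed hs
    exact s.isCompact_biUnion fun g _ =>
      (hKc.image (continuous_const.mul continuous_id)).image (continuous_qmk Γ)
  by_contra! hcon
  have hW : {h : SL2 | dsp h < min ε 1} ∈ 𝓝 (1 : SL2) :=
    (isOpen_lt continuous_dsp continuous_const).mem_nhds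
      (by rw [Set.mem_ofPred_eq, dsp_one]; exact lt_min hε zero_lt_one)
  obtain ⟨U₀, hU₀, hdiv⟩ := exists_nhds_split_inv hW
  obtain ⟨U, hUU, hUo, h1U⟩ := mem_nhds_iff.1 hU₀
  have hU : ∀ u ∈ U, ∀ u' ∈ U, dsp (u * u'⁻¹) < min ε 1 := fun u hu u' hu' => by
    have := hdiv u (hUU hu) u' (hUU hu')
    rwa [div_eq_mul_inv] at this
  obtain ⟨f, hfP, hfr⟩ := exists_seq_of_forall_finset_exists (fun g => ε ≤ inj Γ g)
    (fun g' g => ∀ γ ∈ Γ, ∀ u ∈ U, ∀ u' ∈ U, g' * u ≠ γ * g * u') (by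
      intro s _
      obtain ⟨x, hx, hxs⟩ := Set.not_subset.1 (hcon s)
      obtain ⟨g, rfl⟩ := qmk_surjective Γ x
      refine ⟨g, hx, fun g' hg' γ hγ u hu u' hu' heq => hxs ?_⟩
      refine Set.mem_biUnion hg' ⟨g' * (u * u'⁻¹), ⟨u * u'⁻¹, ?_, rfl⟩, ?_⟩
      · exact ((hU u hu u' hu').trans_le (min_le_right _ _)).le
      · rw [← mul_assoc, heq, mul_inv_cancel_right, qmk_mul_left Γ hγ])
  have hno : ∀ m n, ∀ γ ∈ Γ, γ ≠ 1 ∨ m ≠ n → ∀ u ∈ U, ∀ u' ∈ U, γ * f m * u ≠ f n * u' := by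
    intro m n γ hγ hne u hu u' hu' heq
    rcases lt_trichotomy m n with h | rfl | h
    · refine hfr m n h γ⁻¹ (Γ.inv_mem hγ) u hu u' hu' ?_
      rw [mul_assoc, ← heq]; group
    · have hγ1 : γ ≠ 1 := hne.resolve_right (by simp)
      have h1 := inj_le_dsp Γ (f m) hγ hγ1
      have h2 : (f m)⁻¹ * γ * f m = u' * u⁻¹ := by
        calc (f m)⁻¹ * γ * f m = (f m)⁻¹ * (γ * f m * u) * u⁻¹ := by group
          _ = u' * u⁻¹ := by rw [heq]; group
      rw [h2] at h1
      exact absurd ((hfP m).trans h1) (not_le.2 ((hU u' hu' u hu).trans_le (min_le_left _ _)))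
    · exact hfr n m h γ hγ u' hu' u hu heq.symm
  have hUpos : 0 < ν U := hUo.measure_pos ν ⟨1, h1U⟩
  set A : ℕ → Set SL2 := fun n => (fun h => (f n)⁻¹ * h) ⁻¹' U with hA
  have hAm : ∀ n, MeasurableSet (A n) := fun n =>
    (hUo.preimage (continuous_const.mul continuous_id)).measurableSet
  have hAd : Pairwise (Function.onFun Disjoint A) := by
    intro m n hmn
    refine Set.disjoint_left.2 ?_
    intro x hx hx'
    refine hno m n 1 Γ.one_mem (Or.inr hmn) _ hx _ hx' ?_
    group
  have hinf : ν (⋃ n, A n) = ⊤ := by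
    rw [measure_iUnion hAd hAm]
    simp only [hA, measure_preimage_mul]
    exact ENNReal.tsum_const_eq_top_of_ne_zero hUpos.ne'
  have : Countable Γ := countable_of_Lindelof_of_discrete
  have hle : ν (⋃ n, A n) ≤ ν F := by
    refine hF.measure_le_of_pairwise_disjoint (MeasurableSet.iUnion hAm).nullMeasurableSet ?_
    intro γ γ' hne
    refine Disjoint.aedisjoint (Set.disjoint_left.2 ?_)
    rintro x ⟨⟨y, hy, rfl⟩, -⟩ ⟨⟨y', hy', h⟩, -⟩
    obtain ⟨m, hu⟩ := Set.mem_iUnion.1 hy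
    obtain ⟨n, hu'⟩ := Set.mem_iUnion.1 hy'
    have h' : (γ' : SL2) * y' = γ * y := h
    refine hno m n ((γ' : SL2)⁻¹ * γ) (Γ.mul_mem (Γ.inv_mem γ'.2) γ.2)
      (Or.inl fun h1 => hne ?_) _ hu _ hu' ?_
    · exact Subtype.ext (inv_mul_eq_one.1 h1).symm
    · calc (γ' : SL2)⁻¹ * γ * f m * ((f m)⁻¹ * y) = (γ' : SL2)⁻¹ * (γ * y) := by group
        _ = f n * ((f n)⁻¹ * y') := by rw [← h']; group
  rw [hinf] at hle
  exact hFtop (top_le_iff.1 hle)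

end

/-! ### The height function and its contraction -/

/-- A quadratic polynomial that is small at three separated points of the unit interval vanishes. -/
theorem quadratic_three_points {α β γ e u₁ u₂ u₃ : ℝ} (h1 : 0 ≤ u₁) (h12 : u₁ + 1 / 64 < u₂)
    (h23 : u₂ + 1 / 64 < u₃) (h3 : u₃ ≤ 1) (q1 : |α + β * u₁ - γ * u₁ ^ 2| ≤ e)
    (q2 : |α + β * u₂ - γ * u₂ ^ 2| ≤ e) (q3 : |α + β * u₃ - γ * u₃ ^ 2| ≤ e) :
    |α| + |β| + |γ| ≤ 49409 * e := by
  have he : 0 ≤ e := (abs_nonneg _).trans q1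
  have d12 : |β - γ * (u₁ + u₂)| ≤ 128 * e := by
    have : |(u₂ - u₁) * (β - γ * (u₁ + u₂))| ≤ 2 * e := by
      rw [show (u₂ - u₁) * (β - γ * (u₁ + u₂)) =
        (α + β * u₂ - γ * u₂ ^ 2) - (α + β * u₁ - γ * u₁ ^ 2) by ring]
      exact (abs_sub _ _).trans (by linarith)
    rw [abs_mul, abs_of_pos (by linarith)] at this
    have h0 := abs_nonneg (β - γ * (u₁ + u₂))
    nlinarith
  have d23 : |β - γ * (u₂ + u₃)| ≤ 128 * e := by
    have : |(u₃ - u₂) * (β - γ * (u₂ + u₃))| ≤ 2 * e := by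
      rw [show (u₃ - u₂) * (β - γ * (u₂ + u₃)) =
        (α + β * u₃ - γ * u₃ ^ 2) - (α + β * u₂ - γ * u₂ ^ 2) by ring]
      exact (abs_sub _ _).trans (by linarith)
    rw [abs_mul, abs_of_pos (by linarith)] at this
    have h0 := abs_nonneg (β - γ * (u₂ + u₃))
    nlinarith
  have hγ : |γ| ≤ 8192 * e := by
    have : |(u₃ - u₁) * γ| ≤ 256 * e := by
      rw [show (u₃ - u₁) * γ = (β - γ * (u₁ + u₂)) - (β - γ * (u₂ + u₃)) by ring]
      exact (abs_sub _ _).trans (by linarith)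
    rw [abs_mul, abs_of_pos (by linarith)] at this
    have h0 := abs_nonneg γ
    nlinarith
  have hβ : |β| ≤ 128 * e + 2 * |γ| := by
    have : |β| ≤ |β - γ * (u₁ + u₂)| + |γ * (u₁ + u₂)| := by
      simpa using abs_add_le (β - γ * (u₁ + u₂)) (γ * (u₁ + u₂))
    rw [abs_mul, abs_of_pos (by linarith : 0 < u₁ + u₂)] at this
    have := mul_le_mul_of_nonneg_left (by linarith : u₁ + u₂ ≤ 2) (abs_nonneg γ)
    linarith
  have hα : |α| ≤ e + |β| + |γ| := by
    have h4 : |α| ≤ |α + β * u₁ - γ * u₁ ^ 2| + |β * u₁| + |γ * u₁ ^ 2| := by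
      have := abs_add_three (α + β * u₁ - γ * u₁ ^ 2) (-(β * u₁)) (γ * u₁ ^ 2)
      rw [abs_neg] at this
      rwa [show α + β * u₁ - γ * u₁ ^ 2 + -(β * u₁) + γ * u₁ ^ 2 = α by ring] at this
    rw [abs_mul, abs_mul, abs_of_nonneg h1, abs_of_nonneg (sq_nonneg u₁)] at h4
    have := mul_le_mul_of_nonneg_left (by linarith : u₁ ≤ 1) (abs_nonneg β)
    have := mul_le_mul_of_nonneg_left (by nlinarith : u₁ ^ 2 ≤ 1) (abs_nonneg γ)
    linarith
  linarith

/-- The set where a quadratic polynomial is small is covered by two short intervals. -/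
theorem quadratic_sublevel {α β γ : ℝ} (hw : 0 < |α| + |β| + |γ|) :
    ∃ p r : ℝ, ∀ u ∈ Set.Icc (0:ℝ) 1,
      |α + β * u - γ * u ^ 2| < (|α| + |β| + |γ|) / 50000 →
        u ∈ Set.Icc p (p + 1 / 64) ∪ Set.Icc (r - 1 / 64) r := by
  set w := |α| + |β| + |γ| with hwdef
  set B := {u : ℝ | u ∈ Set.Icc (0:ℝ) 1 ∧ |α + β * u - γ * u ^ 2| < w / 50000} with hB
  rcases B.eq_empty_or_nonempty with h | hne
  · refine ⟨0, 0, fun u hu hq => ?_⟩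
    have : u ∈ B := ⟨hu, hq⟩
    rw [h] at this
    exact this.elim
  have hbb : BddBelow B := ⟨0, fun u hu => hu.1.1⟩
  have hba : BddAbove B := ⟨1, fun u hu => hu.1.2⟩
  refine ⟨sInf B, sSup B, fun u hu hq => ?_⟩
  have huB : u ∈ B := ⟨hu, hq⟩
  have h1 := csInf_le hbb huB
  have h2 := le_csSup hba huB
  by_contra hn
  rw [Set.mem_union, not_or] at hn
  have h3 : sInf B < u - 1 / 64 := by
    by_contra! h
    exact hn.1 ⟨h1, by linarith⟩
  have h4 : u + 1 / 64 < sSup B := by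
    by_contra! h
    exact hn.2 ⟨by linarith, h2⟩
  obtain ⟨u₁, hu₁, hlt₁⟩ := exists_lt_of_csInf_lt hne h3
  obtain ⟨u₃, hu₃, hlt₃⟩ := exists_lt_of_lt_csSup hne h4
  have := quadratic_three_points hu₁.1.1 (by linarith) hlt₃ hu₃.1.2 hu₁.2.le hq.le hu₃.2.le
  linarith

theorem integral_le_of_exceptional {h : ℝ → ℝ} (hc : Continuous h) {m M p r : ℝ} (hM : 0 ≤ M)
    (hh : ∀ u ∈ Set.Icc (0:ℝ) 1, h u ≤ m + M)
    (hm : ∀ u ∈ Set.Icc (0:ℝ) 1, u ∉ Set.Icc p (p + 1 / 64) ∪ Set.Icc (r - 1 / 64) r → h u ≤ m) :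
    ∫ u in (0:ℝ)..1, h u ≤ m + M / 32 := by
  set E := Set.Icc p (p + 1 / 64) ∪ Set.Icc (r - 1 / 64) r with hE
  have hEm : MeasurableSet E := measurableSet_Icc.union measurableSet_Icc
  have hEv : volume E ≤ ENNReal.ofReal (1 / 32) := by
    refine (measure_union_le _ _).trans ?_
    rw [Real.volume_Icc, Real.volume_Icc, ← ENNReal.ofReal_add (by linarith) (by linarith)]
    exact ENNReal.ofReal_le_ofReal (by linarith)
  have hEi : IntervalIntegrable (fun u => m + E.indicator (fun _ => M) u) volume 0 1 := by
    refine intervalIntegrable_const.add ?_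
    rw [intervalIntegrable_iff]
    exact (integrable_indicator_iff hEm).2
      (integrableOn_const (by
        rw [Measure.restrict_apply hEm]
        exact ((measure_mono Set.inter_subset_left).trans_lt
          (hEv.trans_lt ENNReal.ofReal_lt_top)).ne))
  calc ∫ u in (0:ℝ)..1, h u ≤ ∫ u in (0:ℝ)..1, (m + E.indicator (fun _ => M) u) := by
        refine intervalIntegral.integral_mono_on zero_le_one (hc.intervalIntegrable _ _) hEi ?_
        intro u hu
        by_cases hue : u ∈ E
        · rw [Set.indicator_of_mem hue]; exact hh u hu
        · rw [Set.indicator_of_notMem hue, add_zero]; exact hm u hu hue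
    _ = m + ∫ u in (0:ℝ)..1, E.indicator (fun _ => M) u := by
        have h2 : IntervalIntegrable (fun u => E.indicator (fun _ => M) u) volume 0 1 := by
          have := hEi.sub (intervalIntegrable_const (c := m))
          simpa using this
        rw [intervalIntegral.integral_add intervalIntegrable_const h2]
        simp
    _ ≤ m + M / 32 := by
        rw [intervalIntegral.integral_of_le zero_le_one, integral_indicator hEm,
          setIntegral_const, smul_eq_mul]
        have : (volume.restrict (Set.Ioc (0:ℝ) 1)).real E ≤ 1 / 32 := by
          refine ENNReal.toReal_le_of_le_ofReal (by norm_num) ?_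
          exact (Measure.restrict_apply_le _ _).trans hEv
        have := mul_le_mul_of_nonneg_right this hM
        linarith

/-- the exponent of the height function -/
def heightExp : ℝ := Real.log (11 / 10) / 15

theorem heightExp_pos : 0 < heightExp := div_pos (Real.log_pos (by norm_num)) (by norm_num)

/-- a proper function on the quotient, growing slowly in the cusps -/
def height (Γ : Subgroup SL2) (x : XQuot Γ) : ℝ := injQ Γ x ^ (-heightExp)

/-- the additive constant in the contraction inequality -/
def heightConst : ℝ := (Real.exp (-60) / 18) ^ (-heightExp)

theorem heightConst_nonneg : 0 ≤ heightConst := by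
  unfold heightConst; positivity

theorem conj_na_entry (Y : SL2) (u t : ℝ) :
    ((nmat u * amat (-t))⁻¹ * Y * (nmat u * amat (-t))).1 0 1 =
      Real.exp t * (Y.1 0 1 + (Y.1 0 0 - Y.1 1 1) * u - Y.1 1 0 * u ^ 2) := by
  have h : Real.exp t = Real.exp (t / 2) * Real.exp (t / 2) := by rw [← Real.exp_add]; congr 1; ring
  rw [_root_.mul_inv_rev]
  simp only [SL2_mul_apply, SL2_inv_00, SL2_inv_01, SL2_inv_10, SL2_inv_11]
  simp [nmat, amat, neg_div]
  rw [h]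
  ring

theorem exp_thirty_ge : 200000 * Real.exp 15 ≤ Real.exp 30 := by
  have h1 : (2.7 : ℝ) ^ 15 ≤ Real.exp 15 := by
    have : Real.exp 15 = Real.exp 1 ^ 15 := by rw [← Real.exp_nat_mul]; norm_num
    rw [this]
    exact pow_le_pow_left₀ (by norm_num) (by linarith [Real.exp_one_gt_d9]) 15
  have h2 : Real.exp 30 = Real.exp 15 * Real.exp 15 := by rw [← Real.exp_add]; norm_num
  rw [h2]
  refine mul_le_mul_of_nonneg_right (le_trans (by norm_num) h1) (Real.exp_pos _).le

section

variable (Γ : Subgroup SL2)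

theorem height_qmk (g : SL2) : height Γ (qmk Γ g) = inj Γ g ^ (-heightExp) := rfl

theorem height_le_const {g : SL2} (h : Real.exp (-60) / 18 ≤ inj Γ g) :
    height Γ (qmk Γ g) ≤ heightConst :=
  Real.rpow_le_rpow_of_nonpos (by positivity) h (neg_nonpos.2 heightExp_pos.le)

variable [DiscreteTopology Γ]

theorem injQ_pos (x : XQuot Γ) : 0 < injQ Γ x := by
  obtain ⟨g, rfl⟩ := qmk_surjective Γ x
  exact inj_pos Γ g

theorem continuous_height : Continuous (height Γ) :=
  (continuous_injQ Γ).rpow_const fun x => Or.inl (injQ_pos Γ x).ne'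

theorem one_le_height (x : XQuot Γ) : 1 ≤ height Γ x :=
  Real.one_le_rpow_of_pos_of_le_one_of_nonpos (injQ_pos Γ x) (injQ_le_one Γ x)
    (neg_nonpos.2 heightExp_pos.le)

theorem height_le_mul {g g' : SL2} {c : ℝ} (hc : 0 < c) (h : c * inj Γ g ≤ inj Γ g') :
    height Γ (qmk Γ g') ≤ c ^ (-heightExp) * height Γ (qmk Γ g) := by
  rw [height_qmk, height_qmk, ← Real.mul_rpow hc.le (inj_nonneg Γ g)]
  exact Real.rpow_le_rpow_of_nonpos (mul_pos hc (inj_pos Γ g)) h (neg_nonpos.2 heightExp_pos.le)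

theorem exp_rpow_neg_heightExp (k : ℝ) :
    Real.exp (15 * k) ^ (-heightExp) = (11 / 10 : ℝ) ^ (-k) := by
  rw [← Real.exp_mul, Real.rpow_def_of_pos (by norm_num)]
  congr 1
  unfold heightExp
  ring

theorem height_growth {b : SL2} (hb : nrm b.1 ≤ Real.exp 30) (g : SL2) :
    height Γ (qmk Γ (g * b)) ≤ (11 / 10) ^ 4 * height Γ (qmk Γ g) := by
  have h1 : Real.exp (-60) * inj Γ g ≤ inj Γ (g * b) := by
    have h2 := inj_le_sq_mul Γ g b
    have h3 : nrm b.1 ^ 2 ≤ Real.exp 60 := by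
      calc nrm b.1 ^ 2 ≤ Real.exp 30 ^ 2 := pow_le_pow_left₀ (nrm_nonneg _) hb 2
        _ = Real.exp 60 := by rw [← Real.exp_nat_mul]; norm_num
    have h4 := h2.trans (mul_le_mul_of_nonneg_right h3 (inj_nonneg Γ _))
    calc Real.exp (-60) * inj Γ g ≤ Real.exp (-60) * (Real.exp 60 * inj Γ (g * b)) :=
          mul_le_mul_of_nonneg_left h4 (Real.exp_pos _).le
      _ = inj Γ (g * b) := by rw [← mul_assoc, ← Real.exp_add]; simp
  have h5 := height_le_mul Γ (Real.exp_pos _) h1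
  rw [show (-60 : ℝ) = 15 * (-4) by norm_num, exp_rpow_neg_heightExp] at h5
  norm_num at h5 ⊢
  exact h5

/-- Away from an exceptional set of directions, expanding translates leave the cusp. -/
theorem height_expand {g γ : SL2} (hγ : γ ∈ Γ) (hg : inj Γ g < 1 / 18)
    (hd : dsp (g⁻¹ * γ * g) = inj Γ g) {u t : ℝ} (hb : nrm (nmat u * amat (-t)).1 ≤ Real.exp 30)
    (ht : 30 ≤ t)
    (hu : wgt (g⁻¹ * γ * g).1 / 50000 ≤ |(g⁻¹ * γ * g).1 0 1 +
      ((g⁻¹ * γ * g).1 0 0 - (g⁻¹ * γ * g).1 1 1) * u - (g⁻¹ * γ * g).1 1 0 * u ^ 2|) :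
    height Γ (qmk Γ (g * (nmat u * amat (-t)))) ≤
      heightConst + 10 / 11 * height Γ (qmk Γ g) := by
  set b := nmat u * amat (-t) with hbdef
  set Y := g⁻¹ * γ * g with hY
  have hV0 : 0 ≤ height Γ (qmk Γ g) := zero_le_one.trans (one_le_height Γ _)
  have hε := inj_pos Γ g
  rcases le_or_gt (Real.exp (-60) / 18) (inj Γ (g * b)) with h | h
  · have := height_le_const Γ h
    linarith
  have he : Real.exp (-60) ≤ 1 := Real.exp_le_one_iff.2 (by norm_num)
  obtain ⟨γ', hγ', hne', hd'⟩ := exists_minimizer Γ (g := g * b) (by linarith)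
  set Y' := g⁻¹ * γ' * g with hY'
  have hgb : (g * b)⁻¹ * γ' * (g * b) = b⁻¹ * Y' * b := by rw [hY']; group
  rw [hgb] at hd'
  have hsmall : dsp Y' < 1 / 18 := by
    have h1 := dsp_conj_le b⁻¹ (b⁻¹ * Y' * b)
    rw [show (b⁻¹)⁻¹ * (b⁻¹ * Y' * b) * b⁻¹ = Y' by group, nrm_inv, hd'] at h1
    have h3 : nrm b.1 ^ 2 ≤ Real.exp 60 := by
      calc nrm b.1 ^ 2 ≤ Real.exp 30 ^ 2 := pow_le_pow_left₀ (nrm_nonneg _) hb 2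
        _ = Real.exp 60 := by rw [← Real.exp_nat_mul]; norm_num
    calc dsp Y' ≤ Real.exp 60 * inj Γ (g * b) :=
          h1.trans (mul_le_mul_of_nonneg_right h3 (inj_nonneg Γ _))
      _ < Real.exp 60 * (Real.exp (-60) / 18) := mul_lt_mul_of_pos_left h (Real.exp_pos _)
      _ = 1 / 18 := by rw [← mul_div_assoc, ← Real.exp_add]; simp
  have hcomm := commute_of_minimizer Γ hγ hγ' (by linarith) hd hsmall
  have hcommY : Y * Y' = Y' * Y := by
    calc Y * Y' = g⁻¹ * (γ * γ') * g := by rw [hY, hY']; group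
      _ = Y' * Y := by rw [← hcomm, hY, hY']; group
  have hwY : inj Γ g / 2 ≤ wgt Y.1 := by
    have := dsp_le_wgt_add_sq Y
    rw [hd] at this
    nlinarith
  obtain ⟨c, d, hcd⟩ := exists_affine_of_commute hcommY (by linarith)
  have hc : 1 / 2 ≤ |c| := by
    have h1 : wgt Y'.1 = |c| * wgt Y.1 := by rw [hcd, wgt_smul_add]
    have h2 := dsp_le_wgt_add_sq Y'
    have h3 := inj_le_dsp Γ g hγ' hne'
    have h4 := wgt_le_dsp Y
    rw [hd] at h4
    have h5 : dsp Y' ^ 2 ≤ 1 / 18 * dsp Y' := by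
      rw [sq]; exact mul_le_mul_of_nonneg_right hsmall.le (dsp_nonneg _)
    have h6 : 17 / 18 * inj Γ g ≤ |c| * wgt Y.1 := by
      rw [← h1]
      have : inj Γ g ≤ dsp Y' := h3
      linarith
    by_contra! hc
    have h7 : |c| * wgt Y.1 ≤ 1 / 2 * inj Γ g :=
      mul_le_mul hc.le h4 (wgt_nonneg _) (by norm_num)
    linarith
  have hlow : Real.exp 15 * inj Γ g ≤ inj Γ (g * b) := by
    have h1 := wgt_le_dsp (b⁻¹ * Y' * b)
    rw [conj_affine hcd b, wgt_smul_add, hd'] at h1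
    have h2 : |(b⁻¹ * Y * b).1 0 1| ≤ wgt (b⁻¹ * Y * b).1 := by
      unfold wgt
      have := abs_nonneg ((b⁻¹ * Y * b).1 1 0)
      have := abs_nonneg ((b⁻¹ * Y * b).1 0 0 - (b⁻¹ * Y * b).1 1 1)
      linarith
    rw [conj_na_entry, abs_mul, abs_of_pos (Real.exp_pos _)] at h2
    have h3 : Real.exp 30 * (inj Γ g / 2 / 50000) ≤ wgt (b⁻¹ * Y * b).1 := by
      refine le_trans ?_ h2
      refine mul_le_mul (Real.exp_le_exp.2 ht) (le_trans ?_ hu) (by positivity) (Real.exp_pos _).le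
      linarith
    have h4 : 1 / 2 * (Real.exp 30 * (inj Γ g / 2 / 50000)) ≤ |c| * wgt (b⁻¹ * Y * b).1 :=
      mul_le_mul hc h3 (by positivity) (abs_nonneg _)
    have h5 := mul_le_mul_of_nonneg_right exp_thirty_ge hε.le
    linarith
  have h6 := height_le_mul Γ (Real.exp_pos _) hlow
  rw [show (15 : ℝ) = 15 * 1 by norm_num, exp_rpow_neg_heightExp, Real.rpow_neg_one] at h6
  have := heightConst_nonneg
  norm_num at h6
  linarith

theorem isHeight_height (hlat : IsLatticeSL2 Γ) : IsHeight 30 (24 / 25) heightConst (height Γ) where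
  cont := continuous_height Γ
  one_le := one_le_height Γ
  growth := by
    intro x b hb
    obtain ⟨g, rfl⟩ := qmk_surjective Γ x
    rw [rmul_qmk]
    have h1 := height_growth Γ hb g
    have h2 := one_le_height Γ (qmk Γ g)
    norm_num at h1
    linarith
  step := by
    intro x v hv
    obtain ⟨g, rfl⟩ := qmk_surjective Γ x
    have hVg := one_le_height Γ (qmk Γ g)
    have hcont : Continuous fun u : ℝ =>
        height Γ (rmul Γ (qmk Γ g) (nmat u * amat (-30 - v))) :=
      (continuous_height Γ).comp ((continuous_rmul_right (qmk Γ g)).comp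
        (continuous_nmat.mul continuous_const))
    have hb : ∀ u ∈ Set.Icc (0:ℝ) 1, nrm (nmat u * amat (-30 - v)).1 ≤ Real.exp 30 := by
      intro u hu
      refine nrm_na_le (by norm_num) (abs_le.2 ⟨?_, ?_⟩) (abs_le.2 ⟨?_, ?_⟩) <;>
        linarith [hu.1, hu.2, hv.1, hv.2]
    have hgrow : ∀ u ∈ Set.Icc (0:ℝ) 1,
        height Γ (rmul Γ (qmk Γ g) (nmat u * amat (-30 - v))) ≤
          (11 / 10) ^ 4 * height Γ (qmk Γ g) := fun u hu => height_growth Γ (hb u hu) g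
    have hK := heightConst_nonneg
    rcases lt_or_ge (inj Γ g) (1 / 18) with hε | hε
    · obtain ⟨γ, hγ, -, hd⟩ := exists_minimizer Γ (g := g) (by linarith)
      set Y := g⁻¹ * γ * g with hY
      have hwpos : 0 < |Y.1 0 1| + |Y.1 0 0 - Y.1 1 1| + |Y.1 1 0| := by
        have h1 := dsp_le_wgt_add_sq Y
        have h2 := inj_pos Γ g
        rw [hd] at h1
        unfold wgt at h1
        nlinarith
      obtain ⟨p, r, hpr⟩ := quadratic_sublevel hwpos
      have := integral_le_of_exceptional hcont (m := heightConst + 10 / 11 * height Γ (qmk Γ g))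
        (M := (11 / 10) ^ 4 * height Γ (qmk Γ g)) (p := p) (r := r) (by positivity)
        (fun u hu => (hgrow u hu).trans (by linarith)) (fun u hu hnot => ?_)
      · norm_num at this ⊢
        linarith
      · rw [rmul_qmk, show -30 - v = -(30 + v) by ring]
        have hb' := hb u hu
        rw [show -30 - v = -(30 + v) by ring] at hb'
        refine height_expand Γ hγ hε hd hb' (by linarith [hv.1]) ?_
        rw [← hY]
        by_contra! hlt
        refine hnot (hpr u hu (lt_of_lt_of_eq hlt ?_))
        unfold wgt
        ring
    · have := integral_le_of_exceptional hcont (m := heightConst) (M := 0) (p := 0) (r := 0) le_rfl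
        (fun u hu => ?_) (fun u hu _ => ?_)
      · refine this.trans ?_
        norm_num
        linarith
      all_goals
        have h4 : Real.exp (-60) / 18 ≤ inj Γ (g * (nmat u * amat (-30 - v))) := by
          have h1 := inj_le_sq_mul Γ g (nmat u * amat (-30 - v))
          have h3 : nrm (nmat u * amat (-30 - v)).1 ^ 2 ≤ Real.exp 60 := by
            calc nrm (nmat u * amat (-30 - v)).1 ^ 2 ≤ Real.exp 30 ^ 2 :=
                  pow_le_pow_left₀ (nrm_nonneg _) (hb u hu) 2
              _ = Real.exp 60 := by rw [← Real.exp_nat_mul]; norm_num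
          have h5 := h1.trans (mul_le_mul_of_nonneg_right h3 (inj_nonneg Γ _))
          calc Real.exp (-60) / 18 ≤ Real.exp (-60) *
                (Real.exp 60 * inj Γ (g * (nmat u * amat (-30 - v)))) := by
                rw [div_eq_mul_one_div]
                exact mul_le_mul_of_nonneg_left (hε.trans h5) (Real.exp_pos _).le
            _ = _ := by rw [← mul_assoc, ← Real.exp_add]; simp
        have := height_le_const Γ h4
        rw [rmul_qmk]
        linarith
  compact := by
    intro R
    rcases le_or_gt R 0 with hR | hR
    · convert isCompact_empty
      ext x
      have := one_le_height Γ x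
      simp only [Set.mem_ofPred_eq, Set.mem_empty_iff_false, iff_false]
      linarith
    · refine (isCompact_le_injQ hlat (ε := R ^ (-heightExp⁻¹)) (by positivity)).of_isClosed_subset
        (isClosed_le (continuous_height Γ) continuous_const) fun x hx => ?_
      rw [Set.mem_ofPred_eq] at hx ⊢
      have h1 := Real.rpow_le_rpow_of_nonpos
        (zero_lt_one.trans_le (one_le_height Γ x)) hx
        (neg_nonpos.2 (inv_pos.2 heightExp_pos).le)
      refine h1.trans_eq ?_
      unfold height
      rw [← Real.rpow_mul (injQ_pos Γ x).le, neg_mul_neg, mul_inv_cancel₀ heightExp_pos.ne',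
        Real.rpow_one]

end

/-! ### Divergent rays end in a cusp -/

theorem dsp_le_wgt_of_trace_nonneg {A : SL2} (h : 0 ≤ A.1 0 0 + A.1 1 1) :
    dsp A ≤ wgt A.1 + wgt A.1 ^ 2 / 2 := by
  have hdet := SL2_det A
  unfold wgt dsp nrm
  simp only [Matrix.sub_apply, Matrix.one_apply_eq,
    Matrix.one_apply_ne (show (0 : Fin 2) ≠ 1 by decide),
    Matrix.one_apply_ne (show (1 : Fin 2) ≠ 0 by decide), sub_zero]
  generalize A.1 0 0 = a at *
  generalize A.1 0 1 = b at *
  generalize A.1 1 0 = c at *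
  generalize A.1 1 1 = d at *
  have hb := abs_nonneg b
  have hc := abs_nonneg c
  have ha := abs_nonneg (a - d)
  have htr : |a + d - 2| ≤ (|b| + |c| + |a - d|) ^ 2 / 2 := by
    have h1 : |a + d - 2| * (a + d + 2) = |(a - d) ^ 2 + 4 * (b * c)| := by
      rw [← abs_of_nonneg (by linarith : 0 ≤ a + d + 2), ← abs_mul]
      congr 1
      linear_combination 4 * hdet
    have h2 : |(a - d) ^ 2 + 4 * (b * c)| ≤ (|b| + |c| + |a - d|) ^ 2 := by
      refine (abs_add_le _ _).trans ?_
      rw [abs_mul, abs_mul, abs_pow, abs_of_pos (by norm_num : (0:ℝ) < 4)]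
      nlinarith [sq_nonneg (|b| - |c|), mul_nonneg hb ha, mul_nonneg hc ha]
    have h3 := abs_nonneg (a + d - 2)
    nlinarith
  have e1 : |a - 1| ≤ |a - d| / 2 + |a + d - 2| / 2 := by
    rw [show a - 1 = (a - d) / 2 + (a + d - 2) / 2 by ring]
    refine (abs_add_le _ _).trans ?_
    rw [abs_div, abs_div, abs_two]
  have e2 : |d - 1| ≤ |a - d| / 2 + |a + d - 2| / 2 := by
    rw [show d - 1 = (a + d - 2) / 2 - (a - d) / 2 by ring]
    refine (abs_sub _ _).trans ?_
    rw [abs_div, abs_div, abs_two]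
    linarith
  linarith

theorem trace_conj (b A : SL2) :
    (b⁻¹ * A * b).1 0 0 + (b⁻¹ * A * b).1 1 1 = A.1 0 0 + A.1 1 1 := by
  have hdet := SL2_det b
  simp only [SL2_mul_apply, SL2_inv_00, SL2_inv_01, SL2_inv_10, SL2_inv_11]
  linear_combination (A.1 0 0 + A.1 1 1) * hdet

theorem trace_nonneg_of_dsp_le {A : SL2} (h : dsp A ≤ 1) : 0 ≤ A.1 0 0 + A.1 1 1 := by
  unfold dsp nrm at h
  simp only [Matrix.sub_apply, Matrix.one_apply_eq,
    Matrix.one_apply_ne (show (0 : Fin 2) ≠ 1 by decide),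
    Matrix.one_apply_ne (show (1 : Fin 2) ≠ 0 by decide), sub_zero] at h
  have := neg_abs_le (A.1 0 0 - 1)
  have := neg_abs_le (A.1 1 1 - 1)
  have := abs_nonneg (A.1 0 1)
  have := abs_nonneg (A.1 1 0)
  linarith

theorem wgt_conj_amat (Y : SL2) (t : ℝ) :
    wgt ((amat t)⁻¹ * Y * amat t).1 =
      Real.exp (-t) * |Y.1 0 1| + Real.exp t * |Y.1 1 0| + |Y.1 0 0 - Y.1 1 1| := by
  have h1 : Real.exp t = Real.exp (t / 2) * Real.exp (t / 2) := by rw [← Real.exp_add]; congr 1; ring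
  have h2 : Real.exp (-t) = Real.exp (-(t / 2)) * Real.exp (-(t / 2)) := by
    rw [← Real.exp_add]; congr 1; ring
  have h3 : Real.exp (t / 2) * Real.exp (-(t / 2)) = 1 := by rw [← Real.exp_add]; simp
  have p1 := Real.exp_pos t
  have p2 := Real.exp_pos (-t)
  unfold wgt
  rw [show ((amat t)⁻¹ * Y * amat t).1 0 1 = Real.exp (-t) * Y.1 0 1 by
      rw [h2]
      simp only [SL2_mul_apply, SL2_inv_00, SL2_inv_01]
      simp [amat]
      ring,
    show ((amat t)⁻¹ * Y * amat t).1 1 0 = Real.exp t * Y.1 1 0 by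
      rw [h1]
      simp only [SL2_mul_apply, SL2_inv_10, SL2_inv_11]
      simp [amat]
      ring,
    show ((amat t)⁻¹ * Y * amat t).1 0 0 - ((amat t)⁻¹ * Y * amat t).1 1 1
        = Y.1 0 0 - Y.1 1 1 by
      simp only [SL2_mul_apply, SL2_inv_00, SL2_inv_01, SL2_inv_10, SL2_inv_11]
      simp [amat]
      linear_combination (Y.1 0 0 - Y.1 1 1) * h3,
    abs_mul, abs_mul, abs_of_pos p1, abs_of_pos p2]

/-- A geodesic ray along which the displacement tends to zero is stabilised by a unipotent. -/
theorem exists_unipotent_of_ray (Γ : Subgroup SL2) [DiscreteTopology Γ] {g : SL2}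
    (h : Tendsto (fun t => inj Γ (g * amat t)) atTop (𝓝 0)) :
    ∃ p > 0, g * nmat p * g⁻¹ ∈ Γ := by
  obtain ⟨t₀, ht₀⟩ := eventually_atTop.1 (h.eventually_lt_const (show (0:ℝ) < 1 / 1000 by norm_num))
  have hex : ∀ n : ℕ, ∃ γ ∈ Γ, γ ≠ 1 ∧
      dsp ((g * amat (t₀ + n))⁻¹ * γ * (g * amat (t₀ + n))) = inj Γ (g * amat (t₀ + n)) :=
    fun n => exists_minimizer Γ ((ht₀ _ (by simp)).trans (by norm_num))
  choose γ hγ hγ1 hγd using hex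
  set Y : ℕ → SL2 := fun n => g⁻¹ * γ n * g with hY
  have hconj : ∀ n m : ℕ, (g * amat (t₀ + n))⁻¹ * γ m * (g * amat (t₀ + n)) =
      (amat (t₀ + n))⁻¹ * Y m * amat (t₀ + n) := fun n m => by simp only [hY]; group
  have hdY : ∀ n : ℕ, dsp ((amat (t₀ + n))⁻¹ * Y n * amat (t₀ + n)) = inj Γ (g * amat (t₀ + n)) :=
    fun n => by rw [← hconj, hγd]
  have hY1 : ∀ n, Y n ≠ 1 := fun n h1 => hγ1 n (by
    calc γ n = g * Y n * g⁻¹ := by simp only [hY]; group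
      _ = 1 := by rw [h1]; group)
  have htr : ∀ n, 0 ≤ (Y n).1 0 0 + (Y n).1 1 1 := fun n => by
    rw [← trace_conj (amat (t₀ + n))]
    refine trace_nonneg_of_dsp_le ?_
    rw [hdY]
    exact inj_le_one Γ _
  have hw : ∀ n, inj Γ g / 2 ≤ wgt (Y n).1 := by
    intro n
    have h1 := dsp_le_wgt_of_trace_nonneg (htr n)
    have h2 := inj_le_dsp Γ g (hγ n) (hγ1 n)
    have h3 := inj_le_one Γ g
    have h4 : inj Γ g ≤ dsp (Y n) := h2
    have h5 := wgt_nonneg (Y n).1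
    by_contra! hlt
    nlinarith
  have hg0 := inj_pos Γ g
  have hcomm : ∀ n, Y n * Y (n + 1) = Y (n + 1) * Y n := by
    intro n
    have h1 : dsp ((g * amat (t₀ + n))⁻¹ * γ (n + 1) * (g * amat (t₀ + n))) < 1 / 18 := by
      have h2 := dsp_conj_le (amat (-1))
        ((g * amat (t₀ + (n + 1 : ℕ)))⁻¹ * γ (n + 1) * (g * amat (t₀ + (n + 1 : ℕ))))
      have h3 : amat (t₀ + n) = amat (t₀ + (n + 1 : ℕ)) * amat (-1) := by
        rw [← amat_add]; congr 1; push_cast; ring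
      have h4 : (g * amat (t₀ + n))⁻¹ * γ (n + 1) * (g * amat (t₀ + n)) = (amat (-1))⁻¹ *
          ((g * amat (t₀ + (n + 1 : ℕ)))⁻¹ * γ (n + 1) * (g * amat (t₀ + (n + 1 : ℕ)))) *
            amat (-1) := by rw [h3]; group
      rw [← h4, hγd] at h2
      refine h2.trans_lt ?_
      have h5 : nrm (amat (-1)).1 ^ 2 ≤ 12 := by
        calc nrm (amat (-1)).1 ^ 2 ≤ (2 * Real.exp (|(-1 : ℝ)| / 2)) ^ 2 :=
              pow_le_pow_left₀ (nrm_nonneg _) (nrm_amat_le _) 2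
          _ = 4 * Real.exp 1 := by
              rw [mul_pow, ← Real.exp_nat_mul]; norm_num
          _ ≤ 12 := by linarith [Real.exp_one_lt_d9]
      have h6 := ht₀ (t₀ + (n + 1 : ℕ)) (by linarith [(n + 1).cast_nonneg (α := ℝ)])
      have h7 := inj_nonneg Γ (g * amat (t₀ + (n + 1 : ℕ)))
      nlinarith
    have h8 := commute_of_minimizer Γ (hγ n) (hγ (n + 1))
      ((ht₀ _ (by simp)).trans (by norm_num)) (hγd n) h1
    calc Y n * Y (n + 1) = g⁻¹ * (γ n * γ (n + 1)) * g := by simp only [hY]; group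
      _ = Y (n + 1) * Y n := by rw [← h8]; simp only [hY]; group
  have hcd : ∀ n, ∃ c d : ℝ, (Y n).1 = c • (Y 0).1 + d • 1 := by
    intro n
    induction n with
    | zero => exact ⟨1, 0, by simp⟩
    | succ n ih =>
      obtain ⟨c, d, hcd⟩ := ih
      obtain ⟨c', d', h'⟩ := exists_affine_of_commute (hcomm n) (by have := hw n; linarith)
      refine ⟨c' * c, c' * d + d', ?_⟩
      rw [h', hcd, smul_add, smul_smul, smul_smul, add_smul, add_assoc]
  set w := wgt (Y 0).1 with hwdef
  have hbound : ∀ n : ℕ, wgt ((amat (t₀ + n))⁻¹ * Y 0 * amat (t₀ + n)).1 ≤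
      inj Γ (g * amat (t₀ + n)) * (2 * w / inj Γ g) := by
    intro n
    obtain ⟨c, d, h1⟩ := hcd n
    have h2 := wgt_le_dsp ((amat (t₀ + n))⁻¹ * Y n * amat (t₀ + n))
    rw [conj_affine h1, wgt_smul_add, hdY] at h2
    have h3 := hw n
    rw [h1, wgt_smul_add] at h3
    have h4 := wgt_nonneg ((amat (t₀ + n))⁻¹ * Y 0 * amat (t₀ + n)).1
    have hw0 : 0 < w := lt_of_lt_of_le (by linarith) (hw 0)
    have h5 : inj Γ g / (2 * w) ≤ |c| := by
      rw [div_le_iff₀ (by positivity)]; linarith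
    have h6 := (mul_le_mul_of_nonneg_right h5 h4).trans h2
    rw [show inj Γ g / (2 * w) = (2 * w / inj Γ g)⁻¹ by rw [inv_div], inv_mul_le_iff₀ (by positivity)]
      at h6
    linarith
  have hlim : Tendsto (fun n : ℕ => inj Γ (g * amat (t₀ + n)) * (2 * w / inj Γ g)) atTop (𝓝 0) := by
    have := (h.comp (tendsto_atTop_add_const_left _ t₀ tendsto_natCast_atTop_atTop)).mul_const
      (2 * w / inj Γ g)
    simpa [Function.comp_def] using this
  have hz : ∀ a : ℝ, (∀ n : ℕ, |a| ≤ wgt ((amat (t₀ + n))⁻¹ * Y 0 * amat (t₀ + n)).1 *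
      max 1 (Real.exp (-t₀))) → a = 0 := by
    intro a ha
    have h1 : Tendsto (fun n : ℕ => inj Γ (g * amat (t₀ + n)) * (2 * w / inj Γ g) *
        max 1 (Real.exp (-t₀))) atTop (𝓝 0) := by simpa using hlim.mul_const (max 1 (Real.exp (-t₀)))
    have h2 := ge_of_tendsto' h1 fun n => (ha n).trans
      (mul_le_mul_of_nonneg_right (hbound n) (by positivity))
    exact abs_nonpos_iff.1 h2
  have hdiag : (Y 0).1 0 0 - (Y 0).1 1 1 = 0 := by
    refine hz _ fun n => ?_
    rw [wgt_conj_amat]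
    refine le_trans ?_ (le_mul_of_one_le_right (by positivity) (le_max_left _ _))
    have : 0 ≤ Real.exp (-(t₀ + n)) * |(Y 0).1 0 1| := by positivity
    have : 0 ≤ Real.exp (t₀ + n) * |(Y 0).1 1 0| := by positivity
    linarith
  have hlow : (Y 0).1 1 0 = 0 := by
    refine hz _ fun n => ?_
    rw [wgt_conj_amat]
    have h1 : |(Y 0).1 1 0| ≤ Real.exp (t₀ + n) * |(Y 0).1 1 0| * Real.exp (-t₀) := by
      rw [mul_right_comm, ← Real.exp_add]
      refine le_mul_of_one_le_left (abs_nonneg _) (Real.one_le_exp ?_)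
      simp
    refine h1.trans (mul_le_mul ?_ (le_max_right _ _) (Real.exp_pos _).le (by positivity))
    have : 0 ≤ Real.exp (-(t₀ + n)) * |(Y 0).1 0 1| := by positivity
    have := abs_nonneg ((Y 0).1 0 0 - (Y 0).1 1 1)
    linarith
  have hone : (Y 0).1 0 0 = 1 := by
    have h1 := SL2_det (Y 0)
    have h2 := htr 0
    rw [hlow, ← sub_eq_zero.1 hdiag] at h1
    rw [← sub_eq_zero.1 hdiag] at h2
    nlinarith
  set q := (Y 0).1 0 1 with hq
  have hYn : Y 0 = nmat q := by
    refine SL2_ext ?_ ?_ ?_ ?_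
    · simp [hone]
    · simp [hq]
    · simp [hlow]
    · rw [← sub_eq_zero.1 hdiag, hone]; simp
  have hq0 : q ≠ 0 := fun h0 => hY1 0 (by rw [hYn, h0, nmat_zero])
  have hmem : g * nmat q * g⁻¹ ∈ Γ := by
    have : g * nmat q * g⁻¹ = γ 0 := by rw [← hYn]; simp only [hY]; group
    rw [this]; exact hγ 0
  rcases lt_or_gt_of_ne hq0 with hneg | hpos
  · refine ⟨-q, by linarith, ?_⟩
    have h1 : nmat (-q) = (nmat q)⁻¹ := by
      rw [eq_inv_iff_mul_eq_one, ← nmat_add]; simp [nmat_zero]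
    have h2 := Γ.inv_mem hmem
    rw [h1]
    convert h2 using 1
    group
  · exact ⟨q, hpos, hmem⟩

/-! ### Averages over closed horocycles -/

theorem integral_swap_interval {G : ℝ → ℝ → ℝ} (hG : Continuous (Function.uncurry G))
    {a b c d : ℝ} (hab : a ≤ b) (hcd : c ≤ d) :
    (∫ u in a..b, ∫ v in c..d, G u v) = ∫ v in c..d, ∫ u in a..b, G u v := by
  simp only [intervalIntegral.integral_of_le hab, intervalIntegral.integral_of_le hcd]
  refine integral_integral_swap ?_
  rw [Measure.prod_restrict]
  refine (hG.continuousOn.integrableOn_compact (isCompact_Icc.prod isCompact_Icc)).mono_set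
    (Set.prod_mono Set.Ioc_subset_Icc_self Set.Ioc_subset_Icc_self)

theorem continuous_integral_interval {Y : Type*} [TopologicalSpace Y] {G : Y → ℝ → ℝ}
    (hG : Continuous fun q : Y × ℝ => G q.1 q.2) (a b : ℝ) :
    Continuous fun y => ∫ u in a..b, G y u :=
  intervalIntegral.continuous_parametric_intervalIntegral_of_continuous' (μ := volume) (f := G) hG
    a b

theorem integral_periodic_smear {F : ℝ → ℝ} (hF : Continuous F) {p : ℝ} (hp : 0 ≤ p)
    (hper : Function.Periodic F p) (c : ℝ) :
    ∫ x in (0:ℝ)..p, ∫ u in (0:ℝ)..1, F (x + c * u) = ∫ x in (0:ℝ)..p, F x := by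
  rw [integral_swap_interval (G := fun x u => F (x + c * u))
    (hF.comp (by fun_prop : Continuous fun q : ℝ × ℝ => q.1 + c * q.2)) hp zero_le_one]
  have : ∀ u : ℝ, ∫ x in (0:ℝ)..p, F (x + c * u) = ∫ x in (0:ℝ)..p, F x := by
    intro u
    rw [intervalIntegral.integral_comp_add_right, add_comm p, zero_add,
      hper.intervalIntegral_add_eq (c * u) 0, zero_add]
  simp [this]

section

variable (Γ : Subgroup SL2)

/-- the average of `f` over the closed horocycle through `g * amat t` -/
def horoAvg (g : SL2) (p : ℝ) (f : XQuot Γ → ℝ) (t : ℝ) : ℝ :=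
  (1 / p) * ∫ x in (0:ℝ)..p, f (qmk Γ (g * (nmat x * amat t)))

variable {Γ} {g : SL2} {p : ℝ}

theorem continuous_horo {Y : Type*} [TopologicalSpace Y] {f : XQuot Γ → ℝ} (hf : Continuous f)
    (g : SL2) {a b : Y → ℝ} (ha : Continuous a) (hb : Continuous b) :
    Continuous fun y => f (qmk Γ (g * (nmat (a y) * amat (b y)))) :=
  hf.comp ((continuous_qmk Γ).comp (continuous_const.mul (continuous_na.comp (ha.prodMk hb))))

theorem continuous_horoAvg {f : XQuot Γ → ℝ} (hf : Continuous f) : Continuous (horoAvg Γ g p f) :=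
  continuous_const.mul (continuous_integral_interval
    (G := fun t x => f (qmk Γ (g * (nmat x * amat t))))
    (continuous_horo hf g continuous_snd continuous_fst) 0 p)

theorem horo_periodic (hγ : g * nmat p * g⁻¹ ∈ Γ) (f : XQuot Γ → ℝ) (h : SL2) :
    Function.Periodic (fun x => f (qmk Γ (g * (nmat x * h)))) p := by
  intro x
  simp only
  congr 1
  rw [show g * (nmat (x + p) * h) = (g * nmat p * g⁻¹) * (g * (nmat x * h)) by
    rw [add_comm, nmat_add]; group]
  exact qmk_mul_left Γ hγ _

theorem horo_mul (x t u s : ℝ) :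
    nmat x * amat t * (nmat u * amat s) = nmat (x + Real.exp t * u) * amat (t + s) := by
  rw [nmat_add, amat_add, mul_assoc, ← mul_assoc (amat t), amat_mul_nmat]
  simp only [mul_assoc]

theorem horoAvg_mono (hp : 0 < p) {f h : XQuot Γ → ℝ} (hf : Continuous f) (hh : Continuous h)
    (hle : ∀ x, f x ≤ h x) (t : ℝ) : horoAvg Γ g p f t ≤ horoAvg Γ g p h t := by
  refine mul_le_mul_of_nonneg_left ?_ (by positivity)
  refine intervalIntegral.integral_mono_on hp.le ?_ ?_ fun x _ => hle _
  · exact (continuous_horo hf g continuous_id continuous_const).intervalIntegrable _ _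
  · exact (continuous_horo hh g continuous_id continuous_const).intervalIntegrable _ _

theorem horoAvg_affine (hp : 0 < p) {f : XQuot Γ → ℝ} (hf : Continuous f) (c d t : ℝ) :
    horoAvg Γ g p (fun x => c * f x + d) t = c * horoAvg Γ g p f t + d := by
  unfold horoAvg
  rw [intervalIntegral.integral_add, intervalIntegral.integral_const_mul,
    intervalIntegral.integral_const]
  · simp only [sub_zero, smul_eq_mul]
    field_simp
  · exact (continuous_const.mul
      (continuous_horo hf g continuous_id continuous_const)).intervalIntegrable _ _
  · exact intervalIntegrable_const

theorem horoAvg_avgOp (hp : 0 < p) (hγ : g * nmat p * g⁻¹ ∈ Γ) {τ : ℝ} {f : XQuot Γ → ℝ}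
    (hf : Continuous f) (t : ℝ) :
    horoAvg Γ g p (avgOp Γ τ f) t = ∫ v in (0:ℝ)..1, horoAvg Γ g p f (t - τ - v) := by
  unfold horoAvg
  rw [intervalIntegral.integral_const_mul]
  congr 1
  simp only [avgOp, rmul_qmk, mul_assoc g, horo_mul]
  rw [integral_swap_interval (G := fun x v => ∫ u in (0:ℝ)..1,
    f (qmk Γ (g * (nmat (x + Real.exp t * u) * amat (t + (-τ - v)))))) ?_ hp.le zero_le_one]
  · refine intervalIntegral.integral_congr fun v _ => ?_
    have := integral_periodic_smear (F := fun x => f (qmk Γ (g * (nmat x * amat (t + (-τ - v))))))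
      (continuous_horo hf g continuous_id continuous_const)
      hp.le (horo_periodic hγ f _) (Real.exp t)
    rw [this, show t + (-τ - v) = t - τ - v by ring]
  · exact continuous_integral_interval (Y := ℝ × ℝ) (G := fun q u =>
      f (qmk Γ (g * (nmat (q.1 + Real.exp t * u) * amat (t + (-τ - q.2))))))
      (continuous_horo hf g (by fun_prop) (by fun_prop)) 0 1

theorem horoAvg_step {τ κ b : ℝ} {V : XQuot Γ → ℝ} (hV : IsHeight τ κ b V) (hp : 0 < p)
    (hγ : g * nmat p * g⁻¹ ∈ Γ) (t : ℝ) :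
    horoAvg Γ g p V (t - τ) ≤ κ * horoAvg Γ g p V t + b := by
  rw [← horoAvg_affine hp hV.cont]
  unfold horoAvg
  refine mul_le_mul_of_nonneg_left ?_ (by positivity)
  have := integral_periodic_smear (F := fun x => V (qmk Γ (g * (nmat x * amat (t - τ)))))
      (continuous_horo hV.cont g continuous_id continuous_const)
      hp.le (horo_periodic hγ V _) (Real.exp t)
  rw [← this]
  refine intervalIntegral.integral_mono_on hp.le ?_ ?_ fun x _ => ?_
  · exact (continuous_integral_interval
      (G := fun x u => V (qmk Γ (g * (nmat (x + Real.exp t * u) * amat (t - τ)))))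
      (continuous_horo hV.cont g (by fun_prop) (by fun_prop)) 0 1).intervalIntegrable _ _
  · exact ((continuous_const.mul (continuous_horo hV.cont g continuous_id continuous_const)).add
      continuous_const).intervalIntegrable _ _
  · have h := hV.step (qmk Γ (g * (nmat x * amat t))) 0 (by simp)
    simp only [rmul_qmk, mul_assoc g, horo_mul, sub_zero] at h
    exact h

/-- The height has bounded averages over the closed horocycles below a given one. -/
theorem exists_horoAvg_height_le {τ κ b : ℝ} {V : XQuot Γ → ℝ} (hV : IsHeight τ κ b V)
    (hτ : 10 ≤ τ) (hκ0 : 0 ≤ κ) (hκ1 : κ < 1) (hp : 0 < p) (hγ : g * nmat p * g⁻¹ ∈ Γ) (Y : ℝ) :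
    ∃ S, 0 ≤ S ∧ ∀ t ≤ Y, horoAvg Γ g p V t ≤ S := by
  obtain ⟨S₀, hS₀⟩ := (isCompact_Icc (a := Y - τ) (b := Y)).bddAbove_image
    (continuous_horoAvg (g := g) (p := p) hV.cont).continuousOn
  set S := max (max S₀ (b / (1 - κ))) 0 with hS
  have hκS : κ * S + b ≤ S := by
    have h1 : b / (1 - κ) ≤ S := (le_max_right _ _).trans (le_max_left _ _)
    rw [div_le_iff₀ (by linarith)] at h1
    linarith
  have key : ∀ n : ℕ, ∀ t ≤ Y, Y - (n + 1) * τ ≤ t → horoAvg Γ g p V t ≤ S := by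
    intro n
    induction n with
    | zero =>
      intro t h1 h2
      refine (hS₀ (Set.mem_image_of_mem _ ⟨?_, h1⟩)).trans
        ((le_max_left _ _).trans (le_max_left _ _))
      simpa using h2
    | succ n ih =>
      intro t h1 h2
      rcases le_or_gt (Y - τ) t with h3 | h3
      · exact (hS₀ (Set.mem_image_of_mem _ ⟨h3, h1⟩)).trans
          ((le_max_left _ _).trans (le_max_left _ _))
      · have h4 := horoAvg_step hV hp hγ (t + τ)
        rw [add_sub_cancel_right] at h4
        have h5 := ih (t + τ) (by linarith) (by push_cast at h2; linarith)
        exact h4.trans ((by gcongr : κ * horoAvg Γ g p V (t + τ) + b ≤ κ * S + b).trans hκS)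
  refine ⟨S, le_max_right _ _, fun t ht => ?_⟩
  obtain ⟨n, hn⟩ := exists_nat_ge ((Y - t) / τ)
  rw [div_le_iff₀ (by linarith)] at hn
  exact key n t ht (by linarith)

end

theorem abs_integral_sub_translate_le {h : ℝ → ℝ} (hc : Continuous h) {a Y s K : ℝ} (ha : a ≤ Y)
    (hs : 0 ≤ s) (hK : ∀ t ≤ Y, |h t| ≤ K) :
    |(∫ t in a..Y, h t) - ∫ t in a..Y, h (t - s)| ≤ 2 * s * K := by
  have hi : ∀ x y : ℝ, IntervalIntegrable h volume x y := fun x y => hc.intervalIntegrable x y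
  have bd : ∀ y ≤ Y, |∫ t in (y - s)..y, h t| ≤ K * s := by
    intro y hy
    have := intervalIntegral.norm_integral_le_of_norm_le_const (a := y - s) (b := y) (C := K)
      (f := h) (fun t ht => ?_)
    · rwa [Real.norm_eq_abs, sub_sub_cancel, abs_of_nonneg hs] at this
    · rw [Set.uIoc_of_le (by linarith)] at ht
      exact hK t (ht.2.trans hy)
  rw [intervalIntegral.integral_comp_sub_right]
  have h1 : (∫ t in a..Y, h t) - ∫ t in (a - s)..(Y - s), h t =
      (∫ t in (Y - s)..Y, h t) - ∫ t in (a - s)..a, h t := by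
    rw [intervalIntegral.integral_interval_sub_interval_comm (hi _ _) (hi _ _) (hi _ _),
      intervalIntegral.integral_symm (a - s) a, intervalIntegral.integral_symm (Y - s) Y]
    ring
  rw [h1]
  refine (abs_sub _ _).trans ?_
  linarith [bd Y le_rfl, bd a ha]

theorem abs_integral_le_of_smearing {H : ℕ → ℝ → ℝ} (hc : ∀ k, Continuous (H k)) {τ K ϱ Y : ℝ}
    (hτ : 0 ≤ τ) (hϱ0 : 0 ≤ ϱ) (hϱ1 : ϱ < 1)
    (hstep : ∀ k t, H (k + 1) t = ∫ v in (0:ℝ)..1, H k (t - τ - v))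
    (hK : ∀ k, ∀ t ≤ Y, |H k t| ≤ K * ϱ ^ k) {a : ℝ} (ha : a ≤ Y) :
    |∫ t in a..Y, H 0 t| ≤ 2 * (τ + 1) * K / (1 - ϱ) := by
  have hK0 : 0 ≤ K := by simpa using (abs_nonneg _).trans (hK 0 Y le_rfl)
  have hone : ∀ k, |(∫ t in a..Y, H k t) - ∫ t in a..Y, H (k + 1) t| ≤
      2 * (τ + 1) * K * ϱ ^ k := by
    intro k
    have h1 : ∫ t in a..Y, H (k + 1) t = ∫ v in (0:ℝ)..1, ∫ t in a..Y, H k (t - (τ + v)) := by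
      simp only [hstep]
      rw [integral_swap_interval (G := fun t v => H k (t - τ - v))
        ((hc k).comp (by fun_prop : Continuous fun q : ℝ × ℝ => q.1 - τ - q.2)) ha zero_le_one]
      simp only [sub_sub]
    have h2 : ∫ t in a..Y, H k t = ∫ _ in (0:ℝ)..1, ∫ t in a..Y, H k t := by simp
    rw [h1, h2]
    refine abs_integral_sub_le_unit continuous_const (continuous_integral_interval
      (G := fun v t => H k (t - (τ + v))) ((hc k).comp
        (by fun_prop : Continuous fun q : ℝ × ℝ => q.2 - (τ + q.1))) a Y) fun v hv => ?_
    refine (abs_integral_sub_translate_le (hc k) ha (by linarith [hv.1]) (hK k)).trans ?_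
    have : 0 ≤ K * ϱ ^ k := by positivity
    have := mul_le_mul_of_nonneg_right (by linarith [hv.2] : 2 * (τ + v) ≤ 2 * (τ + 1)) this
    linarith
  have htel : ∀ n, |∫ t in a..Y, H 0 t| ≤
      2 * (τ + 1) * K * ∑ k ∈ Finset.range n, ϱ ^ k + |∫ t in a..Y, H n t| := by
    intro n
    induction n with
    | zero => simp
    | succ n ih =>
      rw [Finset.sum_range_succ, mul_add]
      have h3 : |∫ t in a..Y, H n t| ≤ |(∫ t in a..Y, H n t) - ∫ t in a..Y, H (n + 1) t| +
          |∫ t in a..Y, H (n + 1) t| := by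
        simpa using abs_add_le ((∫ t in a..Y, H n t) - ∫ t in a..Y, H (n + 1) t)
          (∫ t in a..Y, H (n + 1) t)
      linarith [hone n]
  have hend : ∀ n, |∫ t in a..Y, H n t| ≤ K * (Y - a) * ϱ ^ n := by
    intro n
    have := intervalIntegral.norm_integral_le_of_norm_le_const (a := a) (b := Y) (C := K * ϱ ^ n)
      (f := H n) (fun t ht => ?_)
    · rw [Real.norm_eq_abs, abs_of_nonneg (by linarith : 0 ≤ Y - a)] at this
      linarith
    · rw [Set.uIoc_of_le ha] at ht
      exact hK n t ht.2
  have hlim : Tendsto (fun n : ℕ => 2 * (τ + 1) * K / (1 - ϱ) + K * (Y - a) * ϱ ^ n) atTop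
      (𝓝 (2 * (τ + 1) * K / (1 - ϱ) + K * (Y - a) * 0)) :=
    ((tendsto_pow_atTop_nhds_zero_of_lt_one hϱ0 hϱ1).const_mul _).const_add _
  rw [mul_zero, add_zero] at hlim
  refine ge_of_tendsto' hlim fun n => (htel n).trans (add_le_add ?_ (hend n))
  rw [div_eq_mul_inv]
  refine mul_le_mul_of_nonneg_left ?_ (by positivity)
  exact (Summable.sum_le_tsum _ (fun k _ => by positivity)
    (summable_geometric_of_lt_one hϱ0 hϱ1)).trans_eq (tsum_geometric_of_lt_one hϱ0 hϱ1)

/-- Long closed horocycles are equidistributed, with bounded total discrepancy. -/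
theorem exists_horoAvg_integral_bound {Γ : Subgroup SL2} {g : SL2} {p : ℝ} {τ κ b : ℝ}
    {V : XQuot Γ → ℝ} {μ : Measure (XQuot Γ)} [IsProbabilityMeasure μ]
    (hinv : ∀ g : SL2, Measure.map (fun x => rmul Γ x g) μ = μ)
    (hV : IsHeight τ κ b V) (hτ : 10 ≤ τ) (hκ0 : 0 ≤ κ) (hκ1 : κ < 1) (hb : 0 ≤ b)
    (hp : 0 < p) (hγ : g * nmat p * g⁻¹ ∈ Γ) {B L : ℝ} (hB : 0 ≤ B) (hL : 0 ≤ L) (Y : ℝ) :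
    ∃ C, 0 ≤ C ∧ ∀ f : XQuot Γ → ℝ, (∀ x, |f x| ≤ B) → IsLip V L f → ∀ a ≤ Y,
      |(∫ t in a..Y, horoAvg Γ g p f t) - (Y - a) * ∫ x, f x ∂μ| ≤ C := by
  obtain ⟨C, ϱ, hC, hϱ0, hϱ1, hmix⟩ := exists_exp_mixing hinv hV hτ hκ0 hκ1 hb hB hL
  obtain ⟨S, hS0, hS⟩ := exists_horoAvg_height_le hV hτ hκ0 hκ1 hp hγ Y
  have hden : 0 < 1 - ϱ := by linarith
  refine ⟨2 * (τ + 1) * (C * S) / (1 - ϱ), by positivity, fun f hfB hfL a ha => ?_⟩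
  have hfc : Continuous f := hfL.continuous hV hτ hL
  set m := ∫ x, f x ∂μ with hm
  have hfk : ∀ k, Continuous ((avgOp Γ τ)^[k] f) := fun k =>
    ((isMarkovOp_avgOp (Γ := Γ) τ).iterate k).cont hfc
  have hMc : ∀ k, Continuous (horoAvg Γ g p ((avgOp Γ τ)^[k] f)) := fun k =>
    continuous_horoAvg (hfk k)
  have hbnd : ∀ k, ∀ t ≤ Y, |horoAvg Γ g p ((avgOp Γ τ)^[k] f) t - m| ≤ C * S * ϱ ^ k := by
    intro k t ht
    have h1 := hmix f hfB hfL k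
    have hup := horoAvg_mono (g := g) (f := (avgOp Γ τ)^[k] f) (h := fun x => C * ϱ ^ k * V x + m)
      hp (hfk k) ((continuous_const.mul hV.cont).add continuous_const)
      (fun x => by linarith [(abs_le.1 (h1 x)).2]) t
    have hlo := horoAvg_mono (g := g) (f := fun x => -(C * ϱ ^ k) * V x + m)
      (h := (avgOp Γ τ)^[k] f) hp ((continuous_const.mul hV.cont).add continuous_const) (hfk k)
      (fun x => by linarith [(abs_le.1 (h1 x)).1]) t
    rw [horoAvg_affine hp hV.cont] at hup hlo
    have h2 := mul_le_mul_of_nonneg_left (hS t ht) (by positivity : 0 ≤ C * ϱ ^ k)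
    exact abs_le.2 ⟨by linarith, by linarith⟩
  have := abs_integral_le_of_smearing (H := fun k t => horoAvg Γ g p ((avgOp Γ τ)^[k] f) t - m)
    (τ := τ) (K := C * S) (ϱ := ϱ) (Y := Y) (a := a) (fun k => (hMc k).sub continuous_const)
    (by linarith) hϱ0.le hϱ1 (fun k t => ?_) hbnd ha
  · rw [intervalIntegral.integral_sub ((hMc 0).intervalIntegrable _ _) intervalIntegrable_const,
      intervalIntegral.integral_const, smul_eq_mul] at this
    exact this
  · rw [Function.iterate_succ_apply', horoAvg_avgOp hp hγ (hfk k), intervalIntegral.integral_sub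
      (f := fun v => horoAvg Γ g p ((avgOp Γ τ)^[k] f) (t - τ - v))
      (((hMc k).comp (by fun_prop : Continuous fun v : ℝ => t - τ - v)).intervalIntegrable _ _)
      intervalIntegrable_const]
    simp

/-! ### Exponentially spread orbits along closed horocycles -/

theorem abs_integral_expand_sub_shift_le {F : ℝ → ℝ → ℝ}
    (hF : Continuous fun q : ℝ × ℝ => F q.1 q.2) {B L : ℝ} (hB : ∀ x t, |F x t| ≤ B)
    (hL : ∀ x t s, |F x (t + s) - F x t| ≤ L * |s|) {S : ℝ} (hS : 0 ≤ S) (c y : ℝ) {ς : ℝ}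
    (hς : 0 ≤ ς) :
    |(∫ t in (0:ℝ)..S, F (c * (Real.exp t + ς)) (t + y)) -
      ∫ t in (0:ℝ)..S, F (c * Real.exp t) (t + y)| ≤ (3 * B + L) * ς := by
  have hB0 : 0 ≤ B := (abs_nonneg _).trans (hB 0 0)
  have hL0 : 0 ≤ L := by simpa using (abs_nonneg _).trans (hL 0 0 1)
  set W : ℝ → ℝ := fun u => F (c * u) (Real.log (max u 1) + y) / max u 1 with hW
  have hmax : ∀ u : ℝ, 0 < max u 1 := fun u => lt_max_of_lt_right one_pos
  have hWc : Continuous W := by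
    refine Continuous.div ?_ (by fun_prop) fun u => (hmax u).ne'
    exact hF.comp ((by fun_prop : Continuous fun u : ℝ => c * u).prodMk
      (((by fun_prop : Continuous fun u : ℝ => max u 1).log fun u => (hmax u).ne').add
        continuous_const))
  have hWb : ∀ u, |W u| ≤ B := by
    intro u
    rw [hW, abs_div, abs_of_pos (hmax u), div_le_iff₀ (hmax u)]
    exact (hB _ _).trans (le_mul_of_one_le_right hB0 (le_max_right _ _))
  have hWs : Continuous fun u => W (u + ς) :=
    hWc.comp (by fun_prop : Continuous fun u : ℝ => u + ς)
  have hsub : ∀ g : ℝ → ℝ, Continuous g →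
      ∫ t in (0:ℝ)..S, g (Real.exp t) * Real.exp t = ∫ u in (1:ℝ)..Real.exp S, g u := by
    intro g hg
    have := intervalIntegral.integral_comp_mul_deriv (a := 0) (b := S) (f := Real.exp)
      (f' := Real.exp) (g := g) (fun x _ => Real.hasDerivAt_exp x) Real.continuous_exp.continuousOn
      hg
    simpa [Function.comp_def] using this
  have h1 : ∫ t in (0:ℝ)..S, F (c * Real.exp t) (t + y) = ∫ u in (1:ℝ)..Real.exp S, W u := by
    rw [← hsub W hWc]
    refine intervalIntegral.integral_congr fun t ht => ?_
    rw [Set.uIcc_of_le hS] at ht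
    have : max (Real.exp t) 1 = Real.exp t := max_eq_left (Real.one_le_exp ht.1)
    simp only [hW, this, Real.log_exp]
    field_simp
  have h2 : |(∫ u in (1:ℝ)..Real.exp S, W (u + ς)) - ∫ u in (1:ℝ)..Real.exp S, W u| ≤
      2 * ς * B := by
    have := abs_integral_sub_translate_le (h := fun u => W (u + ς)) (K := B) hWs
      (Real.one_le_exp hS) hς fun t _ => hWb _
    simpa using this
  have h3 : |(∫ t in (0:ℝ)..S, F (c * (Real.exp t + ς)) (t + y)) -
      ∫ u in (1:ℝ)..Real.exp S, W (u + ς)| ≤ (L + B) * ς := by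
    rw [← hsub _ hWs, ← intervalIntegral.integral_sub]
    · have hbd : ∀ t ∈ Set.Ioc 0 S, ‖F (c * (Real.exp t + ς)) (t + y) -
          W (Real.exp t + ς) * Real.exp t‖ ≤ (L + B) * ς * Real.exp (-t) := by
        intro t ht
        have he1 : 1 ≤ Real.exp t := Real.one_le_exp ht.1.le
        have he := Real.exp_pos t
        have hm : max (Real.exp t + ς) 1 = Real.exp t + ς := max_eq_left (by linarith)
        have hpos : 0 < Real.exp t + ς := by linarith
        set s := Real.log (Real.exp t + ς) - t with hs
        have hs0 : 0 ≤ s := by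
          have := Real.log_le_log he (by linarith : Real.exp t ≤ Real.exp t + ς)
          rw [Real.log_exp] at this
          linarith
        have hs1 : s ≤ ς * Real.exp (-t) := by
          have e : s = Real.log (1 + ς * Real.exp (-t)) := by
            rw [hs, show Real.exp t + ς = Real.exp t * (1 + ς * Real.exp (-t)) by
              rw [Real.exp_neg]; field_simp, Real.log_mul he.ne' (by positivity), Real.log_exp]
            ring
          rw [e]
          have := Real.log_le_sub_one_of_pos (by positivity : 0 < 1 + ς * Real.exp (-t))
          linarith
        set x := c * (Real.exp t + ς) with hx
        have e1 : W (Real.exp t + ς) * Real.exp t =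
            F x (t + y + s) * (Real.exp t / (Real.exp t + ς)) := by
          simp only [hW, hm]
          rw [show Real.log (Real.exp t + ς) + y = t + y + s by rw [hs]; ring]
          ring
        have e2 : F x (t + y) - F x (t + y + s) * (Real.exp t / (Real.exp t + ς)) =
            -(F x (t + y + s) - F x (t + y)) + F x (t + y + s) * (ς / (Real.exp t + ς)) := by
          field_simp
          ring
        rw [Real.norm_eq_abs, e1, e2]
        refine (abs_add_le _ _).trans ?_
        rw [abs_neg, abs_mul, abs_of_nonneg (by positivity : 0 ≤ ς / (Real.exp t + ς))]
        have h4 : ς / (Real.exp t + ς) ≤ ς * Real.exp (-t) := by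
          rw [Real.exp_neg, ← div_eq_mul_inv]
          exact div_le_div_of_nonneg_left hς he (by linarith)
        have h5 := hL x (t + y) s
        rw [abs_of_nonneg hs0] at h5
        have h6 : L * s ≤ L * (ς * Real.exp (-t)) := mul_le_mul_of_nonneg_left hs1 hL0
        have h7 := mul_le_mul (hB x (t + y + s)) h4 (by positivity) hB0
        linarith
      have := intervalIntegral.norm_integral_le_of_norm_le hS (μ := volume)
        (g := fun t => (L + B) * ς * Real.exp (-t)) (Eventually.of_forall hbd)
        ((by fun_prop : Continuous fun t : ℝ =>
          (L + B) * ς * Real.exp (-t)).intervalIntegrable _ _)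
      rw [Real.norm_eq_abs] at this
      refine this.trans ?_
      rw [intervalIntegral.integral_const_mul, intervalIntegral.integral_comp_neg (f := Real.exp),
        integral_exp]
      refine mul_le_of_le_one_right (by positivity) ?_
      simp [Real.exp_pos (-S) |>.le]
    · exact (hF.comp (by fun_prop : Continuous fun t : ℝ =>
        (c * (Real.exp t + ς), t + y))).intervalIntegrable _ _
    · exact ((hWs.comp Real.continuous_exp).mul Real.continuous_exp).intervalIntegrable _ _
  rw [h1]
  have := abs_add_le ((∫ t in (0:ℝ)..S, F (c * (Real.exp t + ς)) (t + y)) -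
      ∫ u in (1:ℝ)..Real.exp S, W (u + ς))
    ((∫ u in (1:ℝ)..Real.exp S, W (u + ς)) - ∫ u in (1:ℝ)..Real.exp S, W u)
  rw [sub_add_sub_cancel] at this
  linarith

theorem integral_periodic_unit {f : ℝ → ℝ} {p σ : ℝ} (hp : 0 < p)
    (hf : Function.Periodic f p) (hσ : |σ| = p) (A : ℝ) :
    ∫ v in (0:ℝ)..1, f (A + σ * v) = 1 / p * ∫ x in (0:ℝ)..p, f x := by
  have hσ0 : σ ≠ 0 := by
    rintro rfl
    simp at hσ
    linarith
  rw [intervalIntegral.integral_comp_add_mul _ hσ0, mul_zero, add_zero, mul_one, smul_eq_mul]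
  have h0 := hf.intervalIntegral_add_eq 0 A
  rcases abs_eq hp.le |>.1 hσ with rfl | rfl
  · rw [← h0, zero_add, one_div]
  · have h1 := hf.intervalIntegral_add_eq 0 (A + -p)
    rw [neg_add_cancel_right, zero_add] at h1
    rw [h1, intervalIntegral.integral_symm A, inv_neg, one_div]
    ring

theorem abs_integral_expand_sub_average_le {F : ℝ → ℝ → ℝ}
    (hF : Continuous fun q : ℝ × ℝ => F q.1 q.2) {B L : ℝ} (hB : ∀ x t, |F x t| ≤ B)
    (hL : ∀ x t s, |F x (t + s) - F x t| ≤ L * |s|) {p : ℝ} (hp : 0 < p)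
    (hper : ∀ t, Function.Periodic (fun x => F x t) p) {S : ℝ} (hS : 0 ≤ S) {c : ℝ} (hc : c ≠ 0)
    (y : ℝ) :
    |(∫ t in y..(S + y), 1 / p * ∫ x in (0:ℝ)..p, F x t) -
      ∫ t in (0:ℝ)..S, F (c * Real.exp t) (t + y)| ≤ (3 * B + L) * (p / |c|) := by
  have hB0 : 0 ≤ B := (abs_nonneg _).trans (hB 0 0)
  have hL0 : 0 ≤ L := by simpa using (abs_nonneg _).trans (hL 0 0 1)
  have hc0 : 0 < |c| := abs_pos.2 hc
  set σ := c * (p / |c|) with hσ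
  have hσp : |σ| = p := by
    rw [hσ, abs_mul, abs_of_pos (by positivity : 0 < p / |c|)]
    field_simp
  have hG : Continuous fun q : ℝ × ℝ =>
      F (c * (Real.exp q.2 + p / |c| * q.1)) (q.2 + y) :=
    hF.comp (by fun_prop : Continuous fun q : ℝ × ℝ =>
      (c * (Real.exp q.2 + p / |c| * q.1), q.2 + y))
  have h1 : ∫ t in y..(S + y), 1 / p * ∫ x in (0:ℝ)..p, F x t =
      ∫ v in (0:ℝ)..1, ∫ t in (0:ℝ)..S, F (c * (Real.exp t + p / |c| * v)) (t + y) := by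
    have h2 := intervalIntegral.integral_comp_add_right (a := 0) (b := S)
      (fun t => 1 / p * ∫ x in (0:ℝ)..p, F x t) y
    rw [zero_add] at h2
    rw [← h2, integral_swap_interval (G := fun v t =>
      F (c * (Real.exp t + p / |c| * v)) (t + y)) hG zero_le_one hS]
    refine intervalIntegral.integral_congr fun t _ => ?_
    rw [← integral_periodic_unit hp (hper (t + y)) hσp (c * Real.exp t)]
    refine intervalIntegral.integral_congr fun v _ => ?_
    simp only [hσ]
    congr 1
    ring
  have h2 : ∫ t in (0:ℝ)..S, F (c * Real.exp t) (t + y) =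
      ∫ _ in (0:ℝ)..1, ∫ t in (0:ℝ)..S, F (c * Real.exp t) (t + y) := by simp
  rw [h1, h2]
  refine abs_integral_sub_le_unit (continuous_integral_interval (G := fun v t =>
      F (c * (Real.exp t + p / |c| * v)) (t + y)) hG 0 S) continuous_const fun v hv => ?_
  have hq : 0 ≤ p / |c| := by positivity
  refine (abs_integral_expand_sub_shift_le hF hB hL hS c y
    (mul_nonneg hq hv.1)).trans ?_
  refine mul_le_mul_of_nonneg_left ?_ (by positivity)
  exact mul_le_of_le_one_right hq hv.2

/-! ### Smooth compactly supported functions are uniformly Lipschitz -/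

section

variable {Γ : Subgroup SL2}

theorem exists_dsp_le_of_isCompact {K : Set (XQuot Γ)} (hK : IsCompact K) :
    ∃ R : ℝ, ∀ x ∈ K, ∃ g, qmk Γ g = x ∧ dsp g ≤ R := by
  obtain ⟨n, hn⟩ := hK.elim_directed_cover (fun n : ℕ => qmk Γ '' {g | dsp g < n})
    (fun n => (isOpenQuotientMap_qmk Γ).isOpenMap _ (isOpen_lt continuous_dsp continuous_const))
    (fun x _ => by
      obtain ⟨g, rfl⟩ := qmk_surjective Γ x
      obtain ⟨n, hn⟩ := exists_nat_gt (dsp g)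
      exact Set.mem_iUnion.2 ⟨n, g, hn, rfl⟩)
    (Monotone.directed_le fun m n hmn => Set.image_mono fun g (hg : dsp g < m) =>
      hg.trans_le (by exact_mod_cast hmn))
  refine ⟨n, fun x hx => ?_⟩
  obtain ⟨g, hg, rfl⟩ := hn hx
  exact ⟨g, rfl, hg.le⟩

theorem dsp_inv (g : SL2) : dsp g⁻¹ = dsp g := by
  simp only [dsp, nrm, Matrix.sub_apply, SL2_inv_00, SL2_inv_01, SL2_inv_10, SL2_inv_11]
  simp [abs_neg]
  ring

theorem norm_entries_le_nrm (A : Matrix (Fin 2) (Fin 2) ℝ) :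
    ‖(fun i j => A i j : Fin 2 → Fin 2 → ℝ)‖ ≤ nrm A := by
  have h00 := abs_nonneg (A 0 0)
  have h01 := abs_nonneg (A 0 1)
  have h10 := abs_nonneg (A 1 0)
  have h11 := abs_nonneg (A 1 1)
  refine (pi_norm_le_iff_of_nonneg (nrm_nonneg A)).2 fun i =>
    (pi_norm_le_iff_of_nonneg (nrm_nonneg A)).2 fun j => ?_
  rw [Real.norm_eq_abs, nrm]
  fin_cases i <;> fin_cases j <;> simp <;> linarith

theorem IsSmoothQuot.continuous {ψ : XQuot Γ → ℝ} (h : IsSmoothQuot Γ ψ) : Continuous ψ := by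
  obtain ⟨Ψ, hΨ, heq⟩ := h
  rw [(isOpenQuotientMap_qmk Γ).isQuotientMap.continuous_iff]
  have : ψ ∘ qmk Γ = fun g : SL2 => Ψ fun i j => g.1 i j := funext heq
  rw [this]
  exact hΨ.continuous.comp (continuous_pi fun i => continuous_pi fun j => continuous_entry i j)

theorem exists_bound_of_smooth {ψ : XQuot Γ → ℝ} (h : IsSmoothQuot Γ ψ)
    (hs : HasCompactSupport ψ) : ∃ B, 0 ≤ B ∧ ∀ x, |ψ x| ≤ B := by
  obtain ⟨B, hB⟩ := hs.exists_bound_of_continuous h.continuous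
  obtain ⟨x⟩ : Nonempty (XQuot Γ) := ⟨qmk Γ 1⟩
  exact ⟨B, (norm_nonneg _).trans (hB x), hB⟩

theorem exists_lipschitz_of_smooth {ψ : XQuot Γ → ℝ} (h : IsSmoothQuot Γ ψ)
    (hs : HasCompactSupport ψ) :
    ∃ L, 0 ≤ L ∧ ∀ x g, |ψ (rmul Γ x g) - ψ x| ≤ L * dsp g := by
  obtain ⟨B, hB0, hB⟩ := exists_bound_of_smooth h hs
  obtain ⟨R, hR⟩ := exists_dsp_le_of_isCompact hs.isCompact
  obtain ⟨Ψ, hΨ, heq⟩ := h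
  set R' := max R 0 with hR'
  have hR'0 : 0 ≤ R' := le_max_right _ _
  set s := (fun (g : SL2) (i j : Fin 2) => g.1 i j) '' {g | dsp g ≤ 2 + 2 * R'} with hsdef
  have hsc : IsCompact s := (isCompact_dsp_le _).image
    (continuous_pi fun i => continuous_pi fun j => continuous_entry i j)
  obtain ⟨M, hM⟩ := LocallyLipschitzOn.exists_lipschitzOnWith_of_compact hsc
    ((hΨ.of_le (by exact_mod_cast le_top)).locallyLipschitz (𝕂 := ℝ)).locallyLipschitzOn
  set L := 2 * B + M * (2 + R') with hL
  have hL0 : 0 ≤ L := by positivity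
  have hsub : ∀ g k : SL2, nrm ((g * k).1 - g.1) ≤ (2 + dsp g) * dsp k := by
    intro g k
    have e : (g * k).1 - g.1 = g.1 * (k.1 - 1) := by
      rw [Matrix.mul_sub, Matrix.mul_one]; rfl
    rw [e]
    exact (nrm_mul_le _ _).trans (mul_le_mul_of_nonneg_right (nrm_le_two_add_dsp g) (nrm_nonneg _))
  have hloc : ∀ x ∈ tsupport ψ, ∀ k, dsp k ≤ 1 → |ψ (rmul Γ x k) - ψ x| ≤ L * dsp k := by
    intro x hx k hk
    obtain ⟨g, rfl, hg⟩ := hR x hx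
    have hg' : dsp g ≤ R' := hg.trans (le_max_left _ _)
    have h0 := dsp_nonneg k
    have h1 := hsub g k
    have h2 : (2 + dsp g) * dsp k ≤ (2 + R') * dsp k :=
      mul_le_mul_of_nonneg_right (by linarith) h0
    have h3 : dsp (g * k) ≤ nrm ((g * k).1 - g.1) + dsp g := by
      have := nrm_add_le ((g * k).1 - g.1) (g.1 - 1)
      rwa [sub_add_sub_cancel] at this
    have h4 : (2 + R') * dsp k ≤ 2 + R' := mul_le_of_le_one_right (by linarith) hk
    rw [rmul_qmk, heq, heq]
    have h5 := hM.dist_le_mul _ (Set.mem_image_of_mem _ (show dsp (g * k) ≤ 2 + 2 * R' by linarith))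
      _ (Set.mem_image_of_mem _ (show dsp g ≤ 2 + 2 * R' by linarith))
    rw [Real.dist_eq, dist_eq_norm] at h5
    refine h5.trans ?_
    have h6 : ‖((fun i j => (g * k).1 i j) - fun i j => g.1 i j : Fin 2 → Fin 2 → ℝ)‖ ≤
        (2 + R') * dsp k :=
      (norm_entries_le_nrm ((g * k).1 - g.1)).trans (h1.trans h2)
    have h7 := mul_le_mul_of_nonneg_left h6 M.2
    have h8 : 0 ≤ 2 * B * dsp k := by positivity
    have h9 : (M : ℝ) * ((2 + R') * dsp k) ≤ L * dsp k := by rw [hL]; linarith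
    exact h7.trans h9
  refine ⟨L, hL0, fun x k => ?_⟩
  have h0 := dsp_nonneg k
  rcases le_or_gt (dsp k) 1 with hk | hk
  · by_cases hx : x ∈ tsupport ψ
    · exact hloc x hx k hk
    · by_cases hx' : rmul Γ x k ∈ tsupport ψ
      · have := hloc _ hx' k⁻¹ (by rwa [dsp_inv])
        rwa [rmul_rmul, mul_inv_cancel, rmul_one, dsp_inv, abs_sub_comm] at this
      · rw [image_eq_zero_of_notMem_tsupport hx, image_eq_zero_of_notMem_tsupport hx', sub_zero,
          abs_zero]
        positivity
  · have h1 := (abs_sub (ψ (rmul Γ x k)) (ψ x)).trans (add_le_add (hB _) (hB _))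
    have h2 : 0 ≤ (M : ℝ) * (2 + R') := by positivity
    have h3 : L ≤ L * dsp k := le_mul_of_one_le_right hL0 hk.le
    linarith

theorem dsp_nmat (s : ℝ) : dsp (nmat s) = |s| := by simp [dsp, nrm, nmat]

theorem dsp_lmat (s : ℝ) : dsp (lmat s) = |s| := by simp [dsp, nrm, lmat]

theorem dsp_amat_le {s : ℝ} (hs : |s| ≤ 1) : dsp (amat s) ≤ 2 * |s| := by
  have h1 := Real.abs_exp_sub_one_le (x := s / 2) (by rw [abs_div]; norm_num; linarith)
  have h2 := Real.abs_exp_sub_one_le (x := -(s / 2)) (by rw [abs_neg, abs_div]; norm_num; linarith)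
  rw [abs_neg] at h2
  rw [abs_div, abs_two] at h1 h2
  have : dsp (amat s) = |Real.exp (s / 2) - 1| + |Real.exp (-(s / 2)) - 1| := by
    simp [dsp, nrm, amat]
  linarith

variable {f : XQuot Γ → ℝ} {L : ℝ}

theorem isLip_of_lipschitz (hL0 : 0 ≤ L) (hL : ∀ x g, |f (rmul Γ x g) - f x| ≤ L * dsp g)
    {V : XQuot Γ → ℝ} (hV : ∀ x, 1 ≤ V x) : IsLip V (2 * L) f := by
  have key : ∀ x s, ∀ g, dsp g ≤ 2 * |s| → |f (rmul Γ x g) - f x| ≤ 2 * L * |s| * V x := by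
    intro x s g hg
    have h1 := mul_le_mul_of_nonneg_left hg hL0
    have h2 : 2 * L * |s| ≤ 2 * L * |s| * V x := le_mul_of_one_le_right (by positivity) (hV x)
    linarith [hL x g]
  refine ⟨fun x s hs => key x s _ ?_, fun x s hs => key x s _ (dsp_amat_le (by linarith)),
    fun x s hs => key x s _ ?_⟩
  · rw [dsp_nmat]
    linarith [abs_nonneg s]
  · rw [dsp_lmat]
    linarith [abs_nonneg s]

theorem lipschitz_amat {B : ℝ} (hL0 : 0 ≤ L) (hL : ∀ x g, |f (rmul Γ x g) - f x| ≤ L * dsp g)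
    (hB : ∀ x, |f x| ≤ B) (x : XQuot Γ) (s : ℝ) :
    |f (rmul Γ x (amat s)) - f x| ≤ 2 * (L + B) * |s| := by
  have hB0 : 0 ≤ B := (abs_nonneg _).trans (hB x)
  have hs := abs_nonneg s
  rcases le_or_gt |s| 1 with h | h
  · have h1 := mul_le_mul_of_nonneg_left (dsp_amat_le h) hL0
    have h2 : 0 ≤ B * |s| := by positivity
    linarith [hL x (amat s)]
  · have h1 := (abs_sub (f (rmul Γ x (amat s))) (f x)).trans (add_le_add (hB _) (hB _))
    have h2 : B ≤ B * |s| := le_mul_of_one_le_right hB0 h.le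
    have h3 : 0 ≤ L * |s| := by positivity
    linarith

theorem lipschitz_comp_rmul (hL0 : 0 ≤ L) (hL : ∀ x g, |f (rmul Γ x g) - f x| ≤ L * dsp g)
    {k : SL2} {N : ℝ} (hk : nrm k.1 ≤ N) (x : XQuot Γ) (g : SL2) :
    |f (rmul Γ (rmul Γ x g) k) - f (rmul Γ x k)| ≤ L * N ^ 2 * dsp g := by
  have h1 := hL (rmul Γ x k) (k⁻¹ * g * k)
  rw [rmul_rmul, show k * (k⁻¹ * g * k) = g * k by group] at h1
  rw [rmul_rmul]
  have h2 := dsp_conj_le k g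
  have h3 : nrm k.1 ^ 2 ≤ N ^ 2 := pow_le_pow_left₀ (nrm_nonneg _) hk 2
  have h4 := mul_le_mul_of_nonneg_right h3 (dsp_nonneg g)
  have h5 := mul_le_mul_of_nonneg_left (h2.trans h4) hL0
  linarith

end

/-! ### Conjugating the hyperbolic subgroup to the diagonal one -/

theorem exp_neg_half_log_two_sq : Real.exp (-(Real.log 2 / 2)) * Real.exp (-(Real.log 2 / 2)) =
    1 / 2 := by
  rw [← Real.exp_add, show -(Real.log 2 / 2) + -(Real.log 2 / 2) = -Real.log 2 by ring,
    Real.exp_neg, Real.exp_log two_pos]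
  norm_num

/-- the rotation by `π / 4` -/
def quarterRot : SL2 :=
  ⟨Real.exp (-(Real.log 2 / 2)) • !![1, -1; 1, 1], by
    rw [Matrix.det_fin_two]
    simp
    linarith [exp_neg_half_log_two_sq]⟩

theorem hmat_neg (t : ℝ) : hmat (-t) = quarterRot⁻¹ * amat t * quarterRot := by
  have h := exp_neg_half_log_two_sq
  have e1 := Real.cosh_eq (t / 2)
  have e2 := Real.sinh_eq (t / 2)
  refine SL2_ext ?_ ?_ ?_ ?_ <;>
    simp only [SL2_mul_apply, SL2_inv_00, SL2_inv_01, SL2_inv_10, SL2_inv_11] <;>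
    simp [hmat, amat, quarterRot, neg_div] <;>
    simp only [e1, e2]
  · linear_combination (-(Real.exp (t / 2)) - Real.exp (-(t / 2))) * h
  · linear_combination (Real.exp (t / 2) - Real.exp (-(t / 2))) * h
  · linear_combination (Real.exp (t / 2) - Real.exp (-(t / 2))) * h
  · linear_combination (-(Real.exp (t / 2)) - Real.exp (-(t / 2))) * h

theorem quarterRot_mul_amat (T : ℝ) : ∃ k : SL2, nrm k.1 ≤ 4 ∧ quarterRot * amat T =
    nmat (Real.tanh T) * amat (-Real.log (Real.cosh T)) * k := by
  have hc := Real.cosh_pos T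
  set l := Real.log (Real.cosh T) with hl
  have hel : Real.exp l = Real.cosh T := Real.exp_log hc
  set C := Real.exp ((T - l - Real.log 2) / 2) with hC
  set D := Real.exp ((-T - l - Real.log 2) / 2) with hD
  have hC2 : C * C = Real.exp T / (2 * Real.cosh T) := by
    rw [hC, ← Real.exp_add, ← hel, add_halves, Real.exp_sub, Real.exp_sub, Real.exp_log two_pos]
    field_simp
  have hD2 : D * D = Real.exp (-T) / (2 * Real.cosh T) := by
    rw [hD, ← Real.exp_add, ← hel, add_halves, Real.exp_sub, Real.exp_sub, Real.exp_log two_pos]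
    field_simp
  have hCD : C * C + D * D = 1 := by
    rw [hC2, hD2, ← add_div, Real.cosh_eq]
    field_simp
  have hC0 : 0 < C := Real.exp_pos _
  have hD0 : 0 < D := Real.exp_pos _
  have h1 : Real.exp (l / 2) * C = Real.exp (-(Real.log 2 / 2)) * Real.exp (T / 2) := by
    rw [hC, ← Real.exp_add, ← Real.exp_add]; ring_nf
  have h2 : Real.exp (l / 2) * D = Real.exp (-(Real.log 2 / 2)) * Real.exp (-(T / 2)) := by
    rw [hD, ← Real.exp_add, ← Real.exp_add]; ring_nf
  have h3 : Real.exp (-(l / 2)) * D * Real.cosh T =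
      Real.exp (-(Real.log 2 / 2)) * Real.exp (T / 2) * Real.exp (-T) := by
    rw [hD, ← hel, ← Real.exp_add, ← Real.exp_add, ← Real.exp_add, ← Real.exp_add]; ring_nf
  have h4 : Real.exp (-(l / 2)) * C * Real.cosh T =
      Real.exp (-(Real.log 2 / 2)) * Real.exp (-(T / 2)) * Real.exp T := by
    rw [hC, ← hel, ← Real.exp_add, ← Real.exp_add, ← Real.exp_add, ← Real.exp_add]; ring_nf
  obtain ⟨k, k00, k01, k10, k11⟩ : ∃ k : SL2,
      k.1 0 0 = D ∧ k.1 0 1 = -C ∧ k.1 1 0 = C ∧ k.1 1 1 = D :=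
    ⟨⟨!![D, -C; C, D], by rw [Matrix.det_fin_two_of]; linarith⟩, rfl, rfl, rfl, rfl⟩
  refine ⟨k, ?_, ?_⟩
  · have hC1 : C ≤ 1 := by nlinarith
    have hD1 : D ≤ 1 := by nlinarith
    simp only [nrm, k00, k01, k10, k11, abs_neg, abs_of_pos hC0, abs_of_pos hD0]
    linarith
  · refine SL2_ext ?_ ?_ ?_ ?_ <;>
      simp only [SL2_mul_apply, k00, k01, k10, k11] <;>
      simp [amat, nmat, quarterRot, neg_div, Real.tanh_eq_sinh_div_cosh] <;>
      field_simp
    · have := Real.cosh_sub_sinh T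
      linear_combination (-1) * h3 - Real.sinh T * h1 +
        Real.exp (-(Real.log 2 / 2)) * Real.exp (T / 2) * this
    · have := Real.cosh_add_sinh T
      linear_combination h4 - Real.sinh T * h2 -
        Real.exp (-(Real.log 2 / 2)) * Real.exp (-(T / 2)) * this
    · linear_combination -h1
    · linear_combination -h2

theorem exists_le_injQ_of_ne_zero (Γ : Subgroup SL2) [DiscreteTopology Γ] {ψ : XQuot Γ → ℝ}
    (hs : HasCompactSupport ψ) : ∃ ε > 0, ∀ x, ψ x ≠ 0 → ε ≤ injQ Γ x := by
  rcases (tsupport ψ).eq_empty_or_nonempty with h | h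
  · refine ⟨1, one_pos, fun x hx => ?_⟩
    have := subset_tsupport ψ hx
    simp [h] at this
  · obtain ⟨y, _, hy⟩ := hs.isCompact.exists_isMinOn h (continuous_injQ Γ).continuousOn
    exact ⟨injQ Γ y, injQ_pos Γ y, fun x hx => hy (subset_tsupport ψ hx)⟩

theorem inj_le_of_cusp (Γ : Subgroup SL2) {g : SL2} {p : ℝ} (hp : 0 < p)
    (hγ : g * nmat p * g⁻¹ ∈ Γ) (x y : ℝ) :
    inj Γ (g * (nmat x * amat y)) ≤ Real.exp (-y) * p := by
  have hne : g * nmat p * g⁻¹ ≠ 1 := by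
    intro h
    have h1 : nmat p = 1 := by simpa using h
    have h2 := dsp_nmat p
    rw [h1, dsp_one, abs_of_pos hp] at h2
    linarith
  refine (inj_le_dsp Γ _ hγ hne).trans_eq ?_
  have e : (g * (nmat x * amat y))⁻¹ * (g * nmat p * g⁻¹) * (g * (nmat x * amat y)) =
      nmat (Real.exp (-y) * p) := by
    have h1 : (g * (nmat x * amat y))⁻¹ * (g * nmat p * g⁻¹) * (g * (nmat x * amat y)) =
        (amat y)⁻¹ * ((nmat x)⁻¹ * (nmat p * nmat x) * amat y) := by group
    rw [h1, ← nmat_add, add_comm, nmat_add, inv_mul_cancel_left, nmat_mul_amat,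
      inv_mul_cancel_left]
  rw [e, dsp_nmat, abs_of_pos (by positivity)]

theorem exists_unipotent_of_divergent {Γ : Subgroup SL2} (hlat : IsLatticeSL2 Γ)
    [DiscreteTopology Γ] {g : SL2}
    (hdiv : ∀ C : Set (XQuot Γ), IsCompact C →
      ∃ s₁ : ℝ, 0 < s₁ ∧ ∀ s : ℝ, s ≤ -s₁ → rmul Γ (qmk Γ g) (hmat s) ∉ C) :
    ∃ p > 0, g * quarterRot⁻¹ * nmat p * (g * quarterRot⁻¹)⁻¹ ∈ Γ := by
  refine exists_unipotent_of_ray Γ ?_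
  set N := nrm (quarterRot⁻¹).1 ^ 2 with hN
  have h0 : Tendsto (fun t => inj Γ (g * hmat (-t))) atTop (𝓝 0) := by
    rw [Metric.tendsto_nhds]
    intro ε hε
    obtain ⟨s₁, _, hs⟩ := hdiv _ (isCompact_le_injQ hlat hε)
    filter_upwards [eventually_ge_atTop s₁] with t ht
    have h1 := hs (-t) (by linarith)
    rw [rmul_qmk, Set.mem_ofPred_eq, injQ_qmk, not_le] at h1
    rwa [Real.dist_eq, sub_zero, abs_of_nonneg (inj_nonneg Γ _)]
  have h1 := h0.const_mul N
  rw [mul_zero] at h1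
  refine squeeze_zero (fun t => inj_nonneg Γ _) (fun t => ?_) h1
  rw [show g * quarterRot⁻¹ * amat t = g * hmat (-t) * quarterRot⁻¹ by rw [hmat_neg]; group]
  exact inj_mul_le_sq Γ _ _

theorem quarter_le_abs_tanh {T : ℝ} (hT : 1 < |T|) : 1 / 4 ≤ |Real.tanh T| := by
  have key : ∀ T : ℝ, 1 < T → 1 / 4 ≤ Real.tanh T := by
    intro T hT
    rw [Real.tanh_eq_sinh_div_cosh, le_div_iff₀ (Real.cosh_pos T), Real.sinh_eq, Real.cosh_eq]
    have h1 := Real.add_one_le_exp T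
    have h2 : Real.exp (-T) ≤ 1 / 2 := by
      rw [Real.exp_neg, ← one_div]
      exact one_div_le_one_div_of_le two_pos (by linarith)
    linarith
  rcases lt_abs.1 hT with h | h
  · exact (key T h).trans (le_abs_self _)
  · have := key _ h
    rw [Real.tanh_neg] at this
    exact this.trans (neg_le_abs _)

theorem log_cosh_le_abs (T : ℝ) : Real.log (Real.cosh T) ≤ |T| := by
  rw [← Real.cosh_abs, Real.log_le_iff_le_exp (Real.cosh_pos _), Real.cosh_eq]
  have : Real.exp (-|T|) ≤ Real.exp |T| := Real.exp_le_exp.2 (by linarith [abs_nonneg T])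
  linarith

theorem abs_sub_one_le_log_cosh (T : ℝ) : |T| - 1 ≤ Real.log (Real.cosh T) := by
  rw [← Real.cosh_abs, Real.le_log_iff_exp_le (Real.cosh_pos _), Real.cosh_eq, Real.exp_sub,
    div_le_div_iff₀ (Real.exp_pos 1) two_pos]
  have h1 := Real.add_one_le_exp (1:ℝ)
  have h2 := Real.exp_pos |T|
  have h3 := Real.exp_pos (-|T|)
  nlinarith

theorem setIntegral_Iio_eq_intervalIntegral {G : ℝ → ℝ} {S : ℝ} (hS : 0 ≤ S)
    (h0 : ∀ t, S < t → G (-t) = 0) :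
    ∫ s in Set.Iio (0:ℝ), G s = ∫ t in (0:ℝ)..S, G (-t) := by
  have h1 := integral_comp_neg_Ioi (0:ℝ) G
  rw [neg_zero] at h1
  rw [← integral_Iic_eq_integral_Iio, ← h1, intervalIntegral.integral_of_le hS]
  refine setIntegral_eq_of_subset_of_forall_sdiff_eq_zero measurableSet_Ioi
    Set.Ioc_subset_Ioi_self fun t ht => ?_
  refine h0 t (not_le.1 fun h => ht.2 ⟨ht.1, h⟩)

theorem exists_cusp_vanishing {Γ : Subgroup SL2} [DiscreteTopology Γ] {ψ : XQuot Γ → ℝ}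
    (hs : HasCompactSupport ψ) {g : SL2} {p : ℝ} (hp : 0 < p) (hγ : g * nmat p * g⁻¹ ∈ Γ)
    {N : ℝ} (hN : 0 < N) :
    ∃ Y, 0 ≤ Y ∧ ∀ k : SL2, nrm k.1 ≤ N → ∀ x t, Y < t →
      ψ (rmul Γ (qmk Γ (g * (nmat x * amat t))) k) = 0 := by
  obtain ⟨ε, hε, hψ⟩ := exists_le_injQ_of_ne_zero Γ hs
  have hq : 0 < N ^ 2 * p / ε := by positivity
  refine ⟨max 0 (Real.log (N ^ 2 * p / ε)), le_max_left _ _, fun k hk x t ht => ?_⟩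
  by_contra hne
  have h1 := hψ _ hne
  rw [rmul_qmk, injQ_qmk] at h1
  have h2 := inj_mul_le_sq Γ (g * (nmat x * amat t)) k
  have h3 := inj_le_of_cusp Γ hp hγ x t
  have h4 : nrm k.1 ^ 2 ≤ N ^ 2 := pow_le_pow_left₀ (nrm_nonneg _) hk 2
  have h5 := mul_le_mul h4 h3 (inj_nonneg Γ _) (by positivity)
  have h6 := (Real.log_lt_iff_lt_exp hq).1 ((le_max_right _ _).trans_lt ht)
  rw [div_lt_iff₀ hε] at h6
  have h7 := mul_lt_mul_of_pos_left h6 (Real.exp_pos (-t))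
  rw [← mul_assoc _ (Real.exp t), ← Real.exp_add, neg_add_cancel, Real.exp_zero, one_mul] at h7
  linarith

/-- main term for the integral over `(-∞,0]` along a backward-divergent geodesic. -/
theorem integral_translate_divergent_backward
    (Γ : Subgroup SL2) (hlat : IsLatticeSL2 Γ)
    (μ : Measure (XQuot Γ)) (hprob : IsProbabilityMeasure μ)
    (hinv : ∀ g : SL2, Measure.map (fun x => rmul Γ x g) μ = μ)
    (x₀ : XQuot Γ)
    (hdiv : ∀ C : Set (XQuot Γ), IsCompact C →
      ∃ s₁ : ℝ, 0 < s₁ ∧ ∀ s : ℝ, s ≤ -s₁ → rmul Γ x₀ (hmat s) ∉ C)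
    (ψ : XQuot Γ → ℝ) (hsmooth : IsSmoothQuot Γ ψ) (hsupp : HasCompactSupport ψ) :
    ∃ C₀ > (0:ℝ), ∀ T : ℝ, 1 < |T| →
      |(∫ s in Set.Iio (0:ℝ), ψ (rmul Γ x₀ (hmat s * amat T)))
          - |T| * ∫ x, ψ x ∂μ| ≤ C₀ := by
  have : DiscreteTopology Γ := hlat.1
  obtain ⟨g₀, rfl⟩ := qmk_surjective Γ x₀
  obtain ⟨p, hp, hγ⟩ := exists_unipotent_of_divergent hlat hdiv
  set g := g₀ * quarterRot⁻¹ with hg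
  obtain ⟨B, hB0, hB⟩ := exists_bound_of_smooth hsmooth hsupp
  obtain ⟨L, hL0, hL⟩ := exists_lipschitz_of_smooth hsmooth hsupp
  obtain ⟨Y, hY0, hY⟩ := exists_cusp_vanishing hsupp hp hγ (N := 4) (by norm_num)
  set L' := L * 4 ^ 2 with hL'
  have hL'0 : 0 ≤ L' := by positivity
  obtain ⟨C, hC0, hC⟩ := exists_horoAvg_integral_bound hinv (isHeight_height Γ hlat) (by norm_num)
    (by norm_num) (by norm_num) heightConst_nonneg hp hγ hB0
    (by positivity : 0 ≤ 2 * L') Y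
  set m := ∫ x, ψ x ∂μ with hm
  refine ⟨(3 * B + 2 * (L' + B)) * (4 * p) + C + (Y + 1) * |m| + 1, by positivity,
    fun T hT => ?_⟩
  obtain ⟨k, hk, hkT⟩ := quarterRot_mul_amat T
  set c := Real.tanh T with hc
  set l := Real.log (Real.cosh T) with hl
  have hl0 : 0 ≤ l := Real.log_nonneg (Real.one_le_cosh T)
  have hcq : 1 / 4 ≤ |c| := quarter_le_abs_tanh hT
  have hc0 : c ≠ 0 := abs_pos.1 (by linarith)
  set f : XQuot Γ → ℝ := fun x => ψ (rmul Γ x k) with hf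
  have hψc := hsmooth.continuous
  have hfL : ∀ x h, |f (rmul Γ x h) - f x| ≤ L' * dsp h := lipschitz_comp_rmul hL0 hL hk
  have hfB : ∀ x, |f x| ≤ B := fun x => hB _
  have hfc : Continuous f := hψc.comp (continuous_rmul_left k)
  have hfm : ∫ x, f x ∂μ = m := integral_comp_rmul hinv hψc k
  set F : ℝ → ℝ → ℝ := fun x t => f (qmk Γ (g * (nmat x * amat t))) with hF
  have hpt : ∀ t, ψ (rmul Γ (qmk Γ g₀) (hmat (-t) * amat T)) =
      F (c * Real.exp t) (t + -l) := by
    intro t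
    simp only [hF, hf, rmul_qmk]
    congr 2
    have h1 := horo_mul 0 t c (-l)
    rw [nmat_zero, one_mul, zero_add, mul_comm (Real.exp t)] at h1
    rw [← h1, hmat_neg, hg]
    simp only [mul_assoc] at hkT ⊢
    rw [hkT]
  have hzero : ∀ t, Y + l < t → ψ (rmul Γ (qmk Γ g₀) (hmat (-t) * amat T)) = 0 := by
    intro t ht
    rw [hpt]
    exact hY k hk _ _ (by linarith)
  have hS : 0 ≤ Y + l := by linarith
  rw [setIntegral_Iio_eq_intervalIntegral (G := fun s =>
    ψ (rmul Γ (qmk Γ g₀) (hmat s * amat T))) hS hzero]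
  simp only [hpt]
  have hA := abs_integral_expand_sub_average_le (F := F) (B := B) (L := 2 * (L' + B))
    (continuous_horo hfc g continuous_fst continuous_snd) (fun x t => hfB _)
    (fun x t s => by
      have := lipschitz_amat hL'0 hfL hfB (qmk Γ (g * (nmat x * amat t))) s
      rw [rmul_qmk, mul_assoc g, mul_assoc (nmat x), ← amat_add] at this
      exact this) hp (fun t => horo_periodic hγ f (amat t)) hS hc0 (-l)
  rw [show Y + l + -l = Y by ring] at hA
  have hE := hC f hfB (isLip_of_lipschitz hL'0 hfL (one_le_height Γ)) (-l) (by linarith)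
  rw [hfm] at hE
  have hE' : (∫ t in (-l)..Y, horoAvg Γ g p f t) =
      ∫ t in (-l)..Y, 1 / p * ∫ x in (0:ℝ)..p, F x t := rfl
  rw [hE'] at hE
  set I := ∫ t in (0:ℝ)..(Y + l), F (c * Real.exp t) (t + -l) with hI
  set A := ∫ t in (-l)..Y, 1 / p * ∫ x in (0:ℝ)..p, F x t with hAdef
  have hpc : p / |c| ≤ 4 * p := by
    rw [div_le_iff₀ (by linarith)]
    nlinarith
  have hA' := hA.trans (mul_le_mul_of_nonneg_left hpc (by positivity))
  have hlast : |(Y + l - |T|) * m| ≤ (Y + 1) * |m| := by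
    rw [abs_mul]
    refine mul_le_mul_of_nonneg_right ?_ (abs_nonneg m)
    have h1 := log_cosh_le_abs T
    have h2 := abs_sub_one_le_log_cosh T
    exact abs_le.2 ⟨by linarith, by linarith⟩
  have e : I - |T| * m = -(A - I) + (A - (Y - -l) * m) + (Y + l - |T|) * m := by ring
  rw [e]
  have h1 := abs_add_le (-(A - I) + (A - (Y - -l) * m)) ((Y + l - |T|) * m)
  have h2 := abs_add_le (-(A - I)) (A - (Y - -l) * m)
  rw [abs_neg] at h2
  linarith
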